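/- arXiv:1002.1605 — 2 statements merged into one kernel-verified Lean document; each statement's English description precedes it below -/
import Mathlib

section
/- Let n ≥ 2 be an integer and fix δ > 0. Then there exist positive real numbers ε and C such that for every prime p, setting K = ℤ/pℤ, and for every set A ⊆ SL_n(K) that generates SL_n(K): if |A| < p^{n+1-δ}, then |A·A·A| ≥ C·|A|^{1+ε}. -/
open Pointwise

section RingLevel
variable {F : Type} [Field F]

/-- Algebraicity over a generated subalgebra specialises outside a hypersurface. -/
theorem exists_ne_zero_isAlgebraic_map {A : Type} [CommRing A] [IsDomain A] [Algebra F A]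
    (S : Set A) (g : A) (hg : IsAlgebraic (Algebra.adjoin F S) g) :
    ∃ c : A, c ≠ 0 ∧ ∀ (A' : Type) [CommRing A'] [IsDomain A'] [Algebra F A'] (ψ : A →ₐ[F] A'),
      ψ c ≠ 0 → IsAlgebraic (Algebra.adjoin F (ψ '' S)) (ψ g) := by
  obtain ⟨q, hq0, hq⟩ := hg
  refine ⟨(q.leadingCoeff : Algebra.adjoin F S), by simpa using hq0, ?_⟩
  intro A' _ _ _ ψ hψ
  have hmem : ∀ x : Algebra.adjoin F S, ψ x ∈ Algebra.adjoin F (ψ '' S) := by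
    intro x
    rw [← AlgHom.map_adjoin]
    exact ⟨x, x.2, rfl⟩
  let θ : Algebra.adjoin F S →+* Algebra.adjoin F (ψ '' S) :=
    ((ψ.comp (Algebra.adjoin F S).val).codRestrict (Algebra.adjoin F (ψ '' S)) hmem).toRingHom
  refine ⟨q.map θ, ?_, ?_⟩
  · intro h
    apply hψ
    have := congrArg (fun r => (r.coeff q.natDegree : A')) h
    have h2 : ((θ q.leadingCoeff : Algebra.adjoin F (ψ '' S)) : A') = 0 := by
      simpa [Polynomial.coeff_map] using this
    exact h2
  · have h1 : (algebraMap (Algebra.adjoin F (ψ '' S)) A').comp θ =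
        ψ.toRingHom.comp (algebraMap (Algebra.adjoin F S) A) := by
      ext x; rfl
    rw [Polynomial.aeval_def, Polynomial.eval₂_map, h1]
    rw [Polynomial.aeval_def] at hq
    have := congrArg ψ.toRingHom hq
    rw [Polynomial.hom_eval₂] at this
    simpa using this

theorem isAlgebraic_adjoin_of_generators {A : Type} [CommRing A] [IsDomain A] [Algebra F A]
    (S G : Set A) (hG : Algebra.adjoin F G = ⊤)
    (h : ∀ g ∈ G, IsAlgebraic (Algebra.adjoin F S) g) :
    Algebra.IsAlgebraic (Algebra.adjoin F S) A := by
  constructor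
  intro x
  have hx : x ∈ Algebra.adjoin F G := hG ▸ trivial
  induction hx using Algebra.adjoin_induction with
  | mem x hx => exact h x hx
  | algebraMap r =>
    have : (algebraMap F A r) = algebraMap (Algebra.adjoin F S) A (algebraMap F _ r) := rfl
    rw [this]; exact isAlgebraic_algebraMap _
  | add x y _ _ hx hy => exact hx.add hy
  | mul x y _ _ hx hy => exact hx.mul hy

theorem trdeg_le_of_generators {A : Type} [CommRing A] [IsDomain A] [Algebra F A]
    (S G : Set A) (hG : Algebra.adjoin F G = ⊤)
    (h : ∀ g ∈ G, IsAlgebraic (Algebra.adjoin F S) g) :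
    Algebra.trdeg F A ≤ Cardinal.mk S :=
  have := isAlgebraic_adjoin_of_generators S G hG h
  Algebra.IsAlgebraic.trdeg_le_cardinalMk F S

/-- A surjection between affine domains of equal transcendence degree is injective. -/
theorem injective_of_trdeg_le {A A' : Type} [CommRing A] [IsDomain A] [Algebra F A]
    [CommRing A'] [IsDomain A'] [Algebra F A'] [Algebra.FiniteType F A']
    (ψ : A →ₐ[F] A') (hψ : Function.Surjective ψ)
    (h : Algebra.trdeg F A ≤ Algebra.trdeg F A') : Function.Injective ψ := by
  obtain ⟨s, hs⟩ := exists_isTranscendenceBasis F A'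
  have hcard := hs.cardinalMk_eq_trdeg
  have hfin : Finite s := by
    rw [← Cardinal.lt_aleph0_iff_finite, hcard]
    exact trdeg_lt_aleph0_of_finiteType
  choose y hy using fun x : s => hψ x.1
  have hyc : ψ ∘ y = ((↑) : s → A') := funext hy
  have hyi : AlgebraicIndependent F y := by
    apply AlgebraicIndependent.of_comp ψ
    rw [hyc]; exact hs.1
  have hyb : IsTranscendenceBasis F y :=
    AlgebraicIndependent.isTranscendenceBasis_of_trdeg_le_of_finite hyi (by rw [hcard]; exact h)
  have halg := hyb.isAlgebraic
  rw [injective_iff_map_eq_zero]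
  intro f hf
  by_contra hf0
  have := Ideal.comap_ne_bot_of_algebraic_mem (R := Algebra.adjoin F (Set.range y))
    (I := RingHom.ker ψ) hf0 hf (halg.isAlgebraic f)
  apply this
  rw [eq_bot_iff]
  rintro ⟨a, ha⟩ ha'
  have ha0 : ψ a = 0 := ha'
  have hr := ha
  rw [Algebra.adjoin_range_eq_range_aeval] at hr
  obtain ⟨q, rfl⟩ := hr
  have h2 : MvPolynomial.aeval ((↑) : s → A') q = 0 := by
    rw [← hyc, ← ha0]
    exact (MvPolynomial.comp_aeval_apply (f := y) ψ q).symm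
  have h3 : q = 0 := (injective_iff_map_eq_zero _).1 hs.1 q h2
  subst h3
  exact Subtype.ext (map_zero (MvPolynomial.aeval y))

end RingLevel

section Dimension
open MvPolynomial
variable {F : Type} [Field F] {σ τ : Type}

/-- Irreducibility of a set of points, for the Zariski topology on points over `F`. -/
def IrredSet (X : Set (σ → F)) : Prop := (vanishingIdeal F X).IsPrime

/-- The dimension of (the Zariski closure of) a set of points. -/
noncomputable def vdim (X : Set (σ → F)) : ℕ :=
  Cardinal.toNat (Algebra.trdeg F (MvPolynomial σ F ⧸ vanishingIdeal F X))

/-- Zariski closure. -/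
def zcl (X : Set (σ → F)) : Set (σ → F) := zeroLocus F (vanishingIdeal F X)

theorem subset_zcl (X : Set (σ → F)) : X ⊆ zcl X := zeroLocus_vanishingIdeal_le X

theorem zcl_mono {X Y : Set (σ → F)} (h : X ⊆ Y) : zcl X ⊆ zcl Y :=
  zeroLocus_anti_mono (vanishingIdeal_anti_mono h)

theorem zcl_mono_ideal {X Y : Set (σ → F)} (h : vanishingIdeal F Y ≤ vanishingIdeal F X) :
    zcl X ⊆ zcl Y := zeroLocus_anti_mono h

@[simp] theorem vanishingIdeal_zcl (X : Set (σ → F)) :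
    vanishingIdeal F (zcl X) = vanishingIdeal F X :=
  le_antisymm (vanishingIdeal_anti_mono (subset_zcl X)) (le_vanishingIdeal_zeroLocus _)

@[simp] theorem zcl_zcl (X : Set (σ → F)) : zcl (zcl X) = zcl X := by
  simp only [zcl]
  exact congrArg (zeroLocus F) (vanishingIdeal_zcl X)

theorem mem_zcl {X : Set (σ → F)} {x : σ → F} :
    x ∈ zcl X ↔ ∀ p : MvPolynomial σ F, (∀ y ∈ X, aeval y p = 0) → aeval x p = 0 := Iff.rfl

theorem irredSet_zcl {X : Set (σ → F)} (h : IrredSet X) : IrredSet (zcl X) := by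
  unfold IrredSet; rwa [vanishingIdeal_zcl]

@[simp] theorem vdim_zcl (X : Set (σ → F)) : vdim (zcl X) = vdim X := by
  unfold vdim; rw [vanishingIdeal_zcl]

theorem IrredSet.nonempty {X : Set (σ → F)} (h : IrredSet X) : X.Nonempty := by
  by_contra h'
  rw [Set.not_nonempty_iff_eq_empty] at h'
  subst h'
  exact h.ne_top vanishingIdeal_empty

theorem irredSet_iff {X : Set (σ → F)} : IrredSet X ↔ X.Nonempty ∧
    ∀ p q : MvPolynomial σ F, (∀ x ∈ X, aeval x p * aeval x q = 0) →
      (∀ x ∈ X, aeval x p = 0) ∨ (∀ x ∈ X, aeval x q = 0) := by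
  constructor
  · intro h
    refine ⟨h.nonempty, fun p q hpq => ?_⟩
    apply h.mem_or_mem
    intro x hx
    rw [map_mul]; exact hpq x hx
  · rintro ⟨⟨x, hx⟩, h⟩
    refine ⟨fun h1 => ?_, fun {p q} hpq => ?_⟩
    · have : (1 : MvPolynomial σ F) ∈ vanishingIdeal F X := h1 ▸ trivial
      simpa using this x hx
    · apply h p q
      intro x hx
      rw [← map_mul]; exact hpq x hx

theorem irredSet_singleton (x : σ → F) : IrredSet {x} := by
  rw [irredSet_iff]
  simp [mul_eq_zero]

theorem adjoin_coords (I : Ideal (MvPolynomial σ F)) :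
    Algebra.adjoin F (Set.range fun s : σ => Ideal.Quotient.mkₐ F I (X s)) = ⊤ := by
  have h := MvPolynomial.adjoin_range_X (R := F) (σ := σ)
  have h2 := congrArg (Subalgebra.map (Ideal.Quotient.mkₐ F I)) h
  rw [AlgHom.map_adjoin, Algebra.map_top] at h2
  rw [← Set.range_comp] at h2
  rw [show (fun s : σ => Ideal.Quotient.mkₐ F I (X s)) = (Ideal.Quotient.mkₐ F I) ∘ X from rfl, h2]
  exact (AlgHom.range_eq_top _).2 (Ideal.Quotient.mkₐ_surjective F I)

variable [Finite σ]

theorem IrredSet.trdeg_eq {X : Set (σ → F)} :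
    Algebra.trdeg F (MvPolynomial σ F ⧸ vanishingIdeal F X) = (vdim X : Cardinal) := by
  unfold vdim
  rw [Cardinal.cast_toNat_of_lt_aleph0]
  exact trdeg_lt_aleph0_of_finiteType

/-- restriction of functions -/
noncomputable def restr {X Y : Set (σ → F)} (h : vanishingIdeal F Y ≤ vanishingIdeal F X) :
    (MvPolynomial σ F ⧸ vanishingIdeal F Y) →ₐ[F] (MvPolynomial σ F ⧸ vanishingIdeal F X) :=
  Ideal.Quotient.factorₐ F h

omit [Finite σ] in
theorem restr_surjective {X Y : Set (σ → F)} (h : vanishingIdeal F Y ≤ vanishingIdeal F X) :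
    Function.Surjective (restr h) := Ideal.Quotient.factor_surjective h

theorem vdim_mono_ideal {X Y : Set (σ → F)} (h : vanishingIdeal F Y ≤ vanishingIdeal F X) :
    vdim X ≤ vdim Y := by
  have := trdeg_le_of_surjective (restr h) (restr_surjective h)
  rw [IrredSet.trdeg_eq, IrredSet.trdeg_eq] at this
  exact_mod_cast this

theorem vdim_mono {X Y : Set (σ → F)} (h : X ⊆ Y) : vdim X ≤ vdim Y :=
  vdim_mono_ideal (vanishingIdeal_anti_mono h)

theorem IrredSet.vanishingIdeal_eq {X Y : Set (σ → F)} (hX : IrredSet X) (hY : IrredSet Y)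
    (h : X ⊆ zcl Y) (hd : vdim Y ≤ vdim X) : vanishingIdeal F Y = vanishingIdeal F X := by
  have hle : vanishingIdeal F Y ≤ vanishingIdeal F X := by
    rw [← vanishingIdeal_zcl Y]; exact vanishingIdeal_anti_mono h
  apply le_antisymm hle
  have := hX
  have := hY
  unfold IrredSet at *
  have hinj : Function.Injective (restr hle) := by
    apply injective_of_trdeg_le _ (restr_surjective hle)
    rw [IrredSet.trdeg_eq, IrredSet.trdeg_eq]
    exact_mod_cast hd
  intro p hp
  rw [← Ideal.Quotient.eq_zero_iff_mem]
  apply hinj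
  rw [map_zero]
  exact Ideal.Quotient.eq_zero_iff_mem.2 hp

theorem IrredSet.vdim_lt {X Y : Set (σ → F)} (hX : IrredSet X) (hY : IrredSet Y)
    (h : X ⊆ Y) (p : MvPolynomial σ F) (hp : ∀ x ∈ X, aeval x p = 0)
    (hp' : ∃ y ∈ Y, aeval y p ≠ 0) : vdim X < vdim Y := by
  by_contra hd
  have := IrredSet.vanishingIdeal_eq hX hY (h.trans (subset_zcl _)) (not_lt.1 hd)
  obtain ⟨y, hy, hy'⟩ := hp'
  apply hy'
  have hp2 : p ∈ vanishingIdeal F X := hp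
  rw [← this] at hp2
  exact hp2 y hy

theorem IrredSet.subset_singleton {X : Set (σ → F)} (hX : IrredSet X) (h : vdim X = 0)
    {x : σ → F} (hx : x ∈ X) : X ⊆ {x} := by
  have := IrredSet.vanishingIdeal_eq (irredSet_singleton x) hX
    ((Set.singleton_subset_iff.2 hx).trans (subset_zcl _)) (by omega)
  intro y hy
  rw [Set.mem_singleton_iff]
  funext s
  have hp : (MvPolynomial.X s - C (x s) : MvPolynomial σ F) ∈ vanishingIdeal F X := by
    rw [this]; simp
  have := hp y hy
  simpa [sub_eq_zero] using this

theorem exists_irred_decomposition (X : Set (σ → F)) :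
    ∃ 𝒞 : Set (Set (σ → F)), 𝒞.Finite ∧ (∀ Z ∈ 𝒞, IrredSet Z ∧ Z ⊆ X) ∧ ⋃₀ 𝒞 = X := by
  suffices H : ∀ (I : Ideal (MvPolynomial σ F)) (X : Set (σ → F)), vanishingIdeal F X = I →
      ∃ 𝒞 : Set (Set (σ → F)), 𝒞.Finite ∧ (∀ Z ∈ 𝒞, IrredSet Z ∧ Z ⊆ X) ∧ ⋃₀ 𝒞 = X from
    H _ X rfl
  intro I
  induction I using WellFoundedGT.induction with
  | ind I ih =>
  rintro X rfl
  by_cases hX : X = ∅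
  · exact ⟨∅, Set.finite_empty, by simp, by simp [hX]⟩
  by_cases hirr : IrredSet X
  · exact ⟨{X}, Set.finite_singleton X, by simp [hirr], by simp⟩
  rw [irredSet_iff, not_and] at hirr
  have := hirr (Set.nonempty_iff_ne_empty.2 hX)
  push Not at this
  obtain ⟨p, q, hpq, ⟨x, hx, hxp⟩, ⟨y, hy, hyq⟩⟩ := this
  have key : ∀ (r : MvPolynomial σ F) (z : σ → F), z ∈ X → aeval z r ≠ 0 →
      vanishingIdeal F {x ∈ X | aeval x r = 0} > vanishingIdeal F X := by
    intro r z hz hzr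
    refine lt_of_le_of_ne (vanishingIdeal_anti_mono fun x hx => hx.1) fun h => hzr ?_
    have : r ∈ vanishingIdeal F X := by rw [h]; exact fun x hx => hx.2
    exact this z hz
  obtain ⟨C1, h1f, h1, h1u⟩ := ih _ (key p x hx hxp) _ rfl
  obtain ⟨C2, h2f, h2, h2u⟩ := ih _ (key q y hy hyq) _ rfl
  refine ⟨C1 ∪ C2, h1f.union h2f, ?_, ?_⟩
  · rintro Z (hZ | hZ)
    · exact ⟨(h1 Z hZ).1, fun x hx => ((h1 Z hZ).2 hx).1⟩
    · exact ⟨(h2 Z hZ).1, fun x hx => ((h2 Z hZ).2 hx).1⟩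
  · rw [Set.sUnion_union, h1u, h2u]
    ext z
    constructor
    · rintro (h | h) <;> exact h.1
    · intro hz
      rcases mul_eq_zero.1 (hpq z hz) with h | h
      · exact Or.inl ⟨hz, h⟩
      · exact Or.inr ⟨hz, h⟩

end Dimension

section DimensionMaps
open MvPolynomial
variable {F : Type} [Field F] {σ τ : Type}

/-- A map between affine spaces given by polynomials. -/
def IsPolyMap (f : (σ → F) → (τ → F)) : Prop :=
  ∃ P : τ → MvPolynomial σ F, ∀ x t, f x t = aeval x (P t)

theorem aeval_polyMap {f : (σ → F) → (τ → F)} {P : τ → MvPolynomial σ F}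
    (hP : ∀ x t, f x t = aeval x (P t)) (q : MvPolynomial τ F) (x : σ → F) :
    aeval (f x) q = aeval x (aeval P q) := by
  rw [MvPolynomial.comp_aeval_apply]
  congr 2
  funext t
  exact hP x t

theorem IsPolyMap.exists_pullback {f : (σ → F) → (τ → F)} (hf : IsPolyMap f)
    (q : MvPolynomial τ F) : ∃ q' : MvPolynomial σ F, ∀ x, aeval (f x) q = aeval x q' := by
  obtain ⟨P, hP⟩ := hf
  exact ⟨aeval P q, aeval_polyMap hP q⟩

theorem IsPolyMap.comp {υ : Type} {f : (σ → F) → (τ → F)} {g : (τ → F) → (υ → F)}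
    (hg : IsPolyMap g) (hf : IsPolyMap f) : IsPolyMap (fun x => g (f x)) := by
  obtain ⟨Q, hQ⟩ := hg
  obtain ⟨P, hP⟩ := hf
  exact ⟨fun u => aeval P (Q u), fun x u => (hQ (f x) u).trans (aeval_polyMap hP _ _)⟩

theorem IrredSet.image {f : (σ → F) → (τ → F)} (hf : IsPolyMap f) {X : Set (σ → F)}
    (hX : IrredSet X) : IrredSet (f '' X) := by
  rw [irredSet_iff] at hX ⊢
  refine ⟨hX.1.image f, fun p q hpq => ?_⟩
  obtain ⟨p', hp⟩ := hf.exists_pullback p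
  obtain ⟨q', hq⟩ := hf.exists_pullback q
  simp only [Set.forall_mem_image, hp, hq] at hpq ⊢
  exact hX.2 p' q' hpq

theorem zcl_preimage {f : (σ → F) → (τ → F)} (hf : IsPolyMap f) {X : Set (σ → F)}
    {Y : Set (τ → F)} (h : ∀ x ∈ X, f x ∈ zcl Y) {x : σ → F} (hx : x ∈ zcl X) : f x ∈ zcl Y := by
  intro p hp
  obtain ⟨p', hp'⟩ := hf.exists_pullback p
  rw [hp']
  apply hx
  intro y hy
  rw [← hp']
  exact h y hy p hp

/-- Pullback of functions along a polynomial map. -/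
noncomputable def pullback (P : τ → MvPolynomial σ F) (f : (σ → F) → (τ → F))
    (hP : ∀ x t, f x t = aeval x (P t)) (X : Set (σ → F)) :
    (MvPolynomial τ F ⧸ vanishingIdeal F (f '' X)) →ₐ[F] (MvPolynomial σ F ⧸ vanishingIdeal F X) :=
  Ideal.quotientMapₐ _ (aeval P) (fun q hq => by
    intro x hx
    have := hq (f x) ⟨x, hx, rfl⟩
    rw [aeval_polyMap hP] at this
    exact this)

theorem pullback_injective (P : τ → MvPolynomial σ F) (f : (σ → F) → (τ → F))
    (hP : ∀ x t, f x t = aeval x (P t)) (X : Set (σ → F)) :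
    Function.Injective (pullback P f hP X) := by
  refine Ideal.quotientMap_injective'
    (f := (aeval P : MvPolynomial τ F →ₐ[F] MvPolynomial σ F).toRingHom) (H := ?_) ?_
  · intro q hq x hx
    have := hq (f x) ⟨x, hx, rfl⟩
    rw [aeval_polyMap hP] at this
    exact this
  intro q hq
  rw [mem_vanishingIdeal_iff]
  rintro _ ⟨x, hx, rfl⟩
  rw [aeval_polyMap hP]
  exact hq x hx

variable [Finite σ] [Finite τ]

theorem vdim_image_le {f : (σ → F) → (τ → F)} (hf : IsPolyMap f) (X : Set (σ → F)) :
    vdim (f '' X) ≤ vdim X := by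
  obtain ⟨P, hP⟩ := hf
  have := trdeg_le_of_injective (pullback P f hP X) (pullback_injective P f hP X)
  rw [IrredSet.trdeg_eq, IrredSet.trdeg_eq] at this
  exact_mod_cast this

/-- Dimension of generic fibres, in the direction which holds over any field. -/
theorem exists_fibre_bound {f : (σ → F) → (τ → F)} (hf : IsPolyMap f) {X : Set (σ → F)}
    (hX : IrredSet X) : ∃ c : MvPolynomial σ F, (∃ x ∈ X, aeval x c ≠ 0) ∧
      ∀ Z ⊆ X, IrredSet Z → (∃ z ∈ Z, aeval z c ≠ 0) → (∀ z ∈ Z, ∀ z' ∈ Z, f z = f z') →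
        vdim Z + vdim (f '' X) ≤ vdim X := by
  have hfX := hX.image hf
  obtain ⟨P, hP⟩ := hf
  have hXp : (vanishingIdeal F X).IsPrime := hX
  have hfXp : (vanishingIdeal F (f '' X)).IsPrime := hfX
  set A := MvPolynomial σ F ⧸ vanishingIdeal F X with hA
  set A' := MvPolynomial τ F ⧸ vanishingIdeal F (f '' X) with hA'
  let GA : Set A := Set.range fun s : σ => Ideal.Quotient.mkₐ F (vanishingIdeal F X) (MvPolynomial.X s)
  let GA' : Set A' := Set.range fun s : τ =>
    Ideal.Quotient.mkₐ F (vanishingIdeal F (f '' X)) (MvPolynomial.X s)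
  have hGA : Algebra.adjoin F GA = ⊤ := adjoin_coords _
  have hGA' : Algebra.adjoin F GA' = ⊤ := adjoin_coords _
  let φ := pullback P f hP X
  have hφ : Function.Injective φ := pullback_injective P f hP X
  have : Algebra.IsAlgebraic (Algebra.adjoin F GA') A' :=
    isAlgebraic_adjoin_of_generators _ GA' hGA' fun g hg =>
      isAlgebraic_algebraMap (⟨g, Algebra.subset_adjoin hg⟩ : Algebra.adjoin F GA')
  obtain ⟨s0, hs0, hb0⟩ := exists_isTranscendenceBasis_subset (R := F) GA'
  have hind : AlgebraicIndepOn F id (φ '' s0) := by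
    have h1 : AlgebraicIndependent F (φ ∘ ((↑) : s0 → A')) := hb0.1.map' hφ
    have h2 := h1.to_subtype_range
    rw [Set.range_comp, Subtype.range_coe] at h2
    exact h2
  have : Algebra.IsAlgebraic (Algebra.adjoin F (φ '' s0 ∪ GA)) A :=
    isAlgebraic_adjoin_of_generators _ GA hGA fun g hg =>
      isAlgebraic_algebraMap (⟨g, Algebra.subset_adjoin (Or.inr hg)⟩ :
        Algebra.adjoin F (φ '' s0 ∪ GA))
  obtain ⟨B, hB0, hB1, hB⟩ := exists_isTranscendenceBasis_between (R := F) (φ '' s0) (φ '' s0 ∪ GA)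
    Set.subset_union_left hind
  have hBalg := hB.isAlgebraic
  rw [Subtype.range_coe] at hBalg
  choose cf hcf0 hcf using fun s : σ => exists_ne_zero_isAlgebraic_map B
    (Ideal.Quotient.mkₐ F (vanishingIdeal F X) (MvPolynomial.X s)) (hBalg.isAlgebraic _)
  have := Fintype.ofFinite σ
  have hc0 : ∏ s, cf s ≠ 0 := Finset.prod_ne_zero_iff.2 fun s _ => hcf0 s
  obtain ⟨c, hc⟩ := Ideal.Quotient.mkₐ_surjective F (vanishingIdeal F X) (∏ s, cf s)
  have hnot : ∀ Z ⊆ X, (∃ z ∈ Z, aeval z c ≠ 0) → c ∉ vanishingIdeal F Z := by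
    rintro Z - ⟨z, hz, hzc⟩ h
    exact hzc (h z hz)
  refine ⟨c, ?_, ?_⟩
  · by_contra h
    push Not at h
    apply hc0
    rw [← hc]
    exact Ideal.Quotient.eq_zero_iff_mem.2 h
  intro Z hZX hZ hZc hconst
  have hle : vanishingIdeal F X ≤ vanishingIdeal F Z := vanishingIdeal_anti_mono hZX
  have hZp : (vanishingIdeal F Z).IsPrime := hZ
  let ψ := restr hle
  have hψc : ψ (∏ s, cf s) ≠ 0 := by
    rw [← hc]
    intro h
    exact hnot Z hZX hZc (Ideal.Quotient.eq_zero_iff_mem.1 h)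
  have hψ : ∀ s, ψ (cf s) ≠ 0 := by
    rw [map_prod, Finset.prod_ne_zero_iff] at hψc
    exact fun s => hψc s (Finset.mem_univ s)
  have hcount : Algebra.trdeg F (MvPolynomial σ F ⧸ vanishingIdeal F Z) ≤
      Cardinal.mk (B \ φ '' s0 : Set A) := by
    refine le_trans (trdeg_le_of_generators (ψ '' (B \ φ '' s0)) _ (adjoin_coords _) ?_)
      Cardinal.mk_image_le
    rintro _ ⟨s, rfl⟩
    have h1 := hcf s _ ψ (hψ s)
    have h2 : Algebra.adjoin F (ψ '' B) = Algebra.adjoin F (ψ '' (B \ φ '' s0)) := by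
      apply le_antisymm
      · apply Algebra.adjoin_le
        rintro _ ⟨b, hb, rfl⟩
        by_cases hb0 : b ∈ φ '' s0
        · obtain ⟨a, ha, rfl⟩ := hb0
          obtain ⟨t, rfl⟩ := hs0 ha
          obtain ⟨z, hz⟩ := hZ.nonempty
          have h3 : ψ (φ (Ideal.Quotient.mkₐ F _ (MvPolynomial.X t))) =
              algebraMap F _ (f z t) := by
            change Ideal.Quotient.mkₐ F (vanishingIdeal F Z) (aeval P (MvPolynomial.X t)) =
              Ideal.Quotient.mkₐ F (vanishingIdeal F Z) (C (f z t))
            rw [aeval_X, Ideal.Quotient.mkₐ_eq_mk, Ideal.Quotient.eq]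
            intro z' hz'
            rw [map_sub, ← hP, hconst z' hz' z hz]
            simp
          rw [h3]
          exact Subalgebra.algebraMap_mem _ _
        · exact Algebra.subset_adjoin ⟨b, ⟨hb, hb0⟩, rfl⟩
      · exact Algebra.adjoin_mono (Set.image_mono Set.sdiff_subset)
    rw [h2] at h1
    exact h1
  have hadd : Cardinal.mk (B \ φ '' s0 : Set A) + Algebra.trdeg F A' = Algebra.trdeg F A := by
    rw [← hB.cardinalMk_eq_trdeg, ← hb0.cardinalMk_eq_trdeg, ← Cardinal.mk_image_eq hφ,
      Cardinal.mk_sdiff_add_mk hB0]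
  have hfinal : Algebra.trdeg F (MvPolynomial σ F ⧸ vanishingIdeal F Z) + Algebra.trdeg F A' ≤
      Algebra.trdeg F A := by
    rw [← hadd]; gcongr
  have eA : Algebra.trdeg F A = (vdim X : Cardinal) := IrredSet.trdeg_eq
  have eA' : Algebra.trdeg F A' = (vdim (f '' X) : Cardinal) := IrredSet.trdeg_eq
  rw [IrredSet.trdeg_eq, eA, eA'] at hfinal
  exact_mod_cast hfinal

/-- Products of point sets. -/
def prodSet (X : Set (σ → F)) (Y : Set (τ → F)) : Set (σ ⊕ τ → F) :=
  {z | (fun s => z (Sum.inl s)) ∈ X ∧ (fun t => z (Sum.inr t)) ∈ Y}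

omit [Finite σ] [Finite τ] in
theorem mem_prodSet {X : Set (σ → F)} {Y : Set (τ → F)} {z : σ ⊕ τ → F} :
    z ∈ prodSet X Y ↔ (fun s => z (Sum.inl s)) ∈ X ∧ (fun t => z (Sum.inr t)) ∈ Y := Iff.rfl

omit [Finite σ] [Finite τ] in
theorem elim_mem_prodSet {X : Set (σ → F)} {Y : Set (τ → F)} {x : σ → F} {y : τ → F} :
    Sum.elim x y ∈ prodSet X Y ↔ x ∈ X ∧ y ∈ Y := Iff.rfl

omit [Finite σ] [Finite τ] in
theorem isPolyMap_inl : IsPolyMap (F := F) (fun z : σ ⊕ τ → F => fun s => z (Sum.inl s)) :=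
  ⟨fun s => MvPolynomial.X (Sum.inl s), by simp⟩

omit [Finite σ] [Finite τ] in
theorem isPolyMap_inr : IsPolyMap (F := F) (fun z : σ ⊕ τ → F => fun s => z (Sum.inr s)) :=
  ⟨fun s => MvPolynomial.X (Sum.inr s), by simp⟩

omit [Finite σ] [Finite τ] in
theorem isPolyMap_elim_left (x : σ → F) : IsPolyMap (fun y : τ → F => Sum.elim x y) :=
  ⟨Sum.elim (fun s => C (x s)) MvPolynomial.X, fun y t => by cases t <;> simp⟩

omit [Finite σ] [Finite τ] in
theorem isPolyMap_elim_right (y : τ → F) : IsPolyMap (fun x : σ → F => Sum.elim x y) :=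
  ⟨Sum.elim MvPolynomial.X (fun t => C (y t)), fun y t => by cases t <;> simp⟩

omit [Finite σ] [Finite τ] in
theorem IrredSet.prod {X : Set (σ → F)} {Y : Set (τ → F)} (hX : IrredSet X) (hY : IrredSet Y) :
    IrredSet (prodSet X Y) := by
  obtain ⟨x0, hx0⟩ := hX.nonempty
  obtain ⟨y0, hy0⟩ := hY.nonempty
  rw [irredSet_iff] at hX hY ⊢
  refine ⟨⟨Sum.elim x0 y0, hx0, hy0⟩, fun p q hpq => ?_⟩
  by_contra hcon
  push Not at hcon
  obtain ⟨⟨z, hz, hzp⟩, ⟨w, hw, hwq⟩⟩ := hcon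
  have hsplit : ∀ z : σ ⊕ τ → F, z = Sum.elim (fun s => z (Sum.inl s)) (fun t => z (Sum.inr t)) := by
    intro z; funext t; cases t <;> rfl
  obtain ⟨p1, hp1⟩ := (isPolyMap_elim_left (F := F) (τ := τ) fun s => z (Sum.inl s)).exists_pullback p
  obtain ⟨q1, hq1⟩ := (isPolyMap_elim_left (F := F) (τ := τ) fun s => w (Sum.inl s)).exists_pullback q
  have : ∃ y ∈ Y, aeval y p1 * aeval y q1 ≠ 0 := by
    by_contra h
    push Not at h
    rcases hY.2 p1 q1 h with h' | h'
    · apply hzp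
      rw [hsplit z, hp1]
      exact h' _ hz.2
    · apply hwq
      rw [hsplit w, hq1]
      exact h' _ hw.2
  obtain ⟨y, hy, hne⟩ := this
  obtain ⟨p2, hp2⟩ := (isPolyMap_elim_right (F := F) (σ := σ) y).exists_pullback p
  obtain ⟨q2, hq2⟩ := (isPolyMap_elim_right (F := F) (σ := σ) y).exists_pullback q
  rcases hX.2 p2 q2 (fun x hx => by rw [← hp2, ← hq2]; exact hpq _ ⟨hx, hy⟩) with h' | h'
  · apply hne
    rw [← hp1, hp2, h' _ hz.1, zero_mul]
  · apply hne
    rw [← hq1, hq2, h' _ hw.1, mul_zero]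

theorem vdim_prod_le {X : Set (σ → F)} {Y : Set (τ → F)} (hX : IrredSet X) (hY : IrredSet Y) :
    vdim (prodSet X Y) ≤ vdim X + vdim Y := by
  have hXY := hX.prod hY
  have hp1 : (fun z : σ ⊕ τ → F => fun s => z (Sum.inl s)) '' prodSet X Y = X := by
    obtain ⟨y, hy⟩ := hY.nonempty
    ext x
    constructor
    · rintro ⟨z, hz, rfl⟩; exact hz.1
    · intro hx; exact ⟨Sum.elim x y, ⟨hx, hy⟩, rfl⟩
  have hp2 : (fun z : σ ⊕ τ → F => fun s => z (Sum.inr s)) '' prodSet X Y = Y := by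
    obtain ⟨x, hx⟩ := hX.nonempty
    ext y
    constructor
    · rintro ⟨z, hz, rfl⟩; exact hz.2
    · intro hy; exact ⟨Sum.elim x y, ⟨hx, hy⟩, rfl⟩
  have hXYp : (vanishingIdeal F (prodSet X Y)).IsPrime := hXY
  have hl : ∀ (x : σ ⊕ τ → F) (s : σ), (fun z : σ ⊕ τ → F => fun s => z (Sum.inl s)) x s =
    aeval x (MvPolynomial.X (R := F) (Sum.inl s) : MvPolynomial (σ ⊕ τ) F) := by simp
  have hr : ∀ (x : σ ⊕ τ → F) (s : τ), (fun z : σ ⊕ τ → F => fun s => z (Sum.inr s)) x s =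
    aeval x (MvPolynomial.X (R := F) (Sum.inr s) : MvPolynomial (σ ⊕ τ) F) := by simp
  let φ1 := pullback _ _ hl (prodSet X Y)
  let φ2 := pullback _ _ hr (prodSet X Y)
  have hi1 : Function.Injective φ1 := pullback_injective _ _ hl _
  have hi2 : Function.Injective φ2 := pullback_injective _ _ hr _
  rw [← hp1] at hX
  rw [← hp2] at hY
  have hXp : (vanishingIdeal F ((fun z : σ ⊕ τ → F => fun s => z (Sum.inl s)) '' prodSet X Y)).IsPrime := hX
  have hYp : (vanishingIdeal F ((fun z : σ ⊕ τ → F => fun s => z (Sum.inr s)) '' prodSet X Y)).IsPrime := hY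
  obtain ⟨s1, hs1⟩ := exists_isTranscendenceBasis F (MvPolynomial σ F ⧸
    vanishingIdeal F ((fun z : σ ⊕ τ → F => fun s => z (Sum.inl s)) '' prodSet X Y))
  obtain ⟨s2, hs2⟩ := exists_isTranscendenceBasis F (MvPolynomial τ F ⧸
    vanishingIdeal F ((fun z : σ ⊕ τ → F => fun s => z (Sum.inr s)) '' prodSet X Y))
  have ha1 := hs1.isAlgebraic
  have ha2 := hs2.isAlgebraic
  rw [Subtype.range_coe] at ha1 ha2
  have key := trdeg_le_of_generators (F := F) (A := MvPolynomial (σ ⊕ τ) F ⧸ vanishingIdeal F (prodSet X Y))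
    (φ1 '' s1 ∪ φ2 '' s2) _ (adjoin_coords _) (by
      have up : ∀ (S S' : Set (MvPolynomial (σ ⊕ τ) F ⧸ vanishingIdeal F (prodSet X Y)))
          (x : MvPolynomial (σ ⊕ τ) F ⧸ vanishingIdeal F (prodSet X Y)), S ⊆ S' →
          IsAlgebraic (Algebra.adjoin F S) x → IsAlgebraic (Algebra.adjoin F S') x := by
        intro S S' x h hx
        exact hx.adjoin_of_forall_isAlgebraic (s := S) (t := S') fun y hy => (hy.2 (h hy.1)).elim
      rintro _ ⟨s | t, rfl⟩
      · obtain ⟨c, hc0, hc⟩ := exists_ne_zero_isAlgebraic_map s1 _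
          (ha1.isAlgebraic (Ideal.Quotient.mkₐ F _ (MvPolynomial.X s)))
        have := hc _ φ1 ((map_ne_zero_iff φ1 hi1).2 hc0)
        refine up _ _ _ Set.subset_union_left ?_
        have e : φ1 (Ideal.Quotient.mkₐ F _ (MvPolynomial.X s)) = Ideal.Quotient.mkₐ F
            (vanishingIdeal F (prodSet X Y)) (MvPolynomial.X (Sum.inl s)) :=
          congrArg (Ideal.Quotient.mkₐ F (vanishingIdeal F (prodSet X Y))) (aeval_X
            (fun i => (MvPolynomial.X (Sum.inl i) : MvPolynomial (σ ⊕ τ) F)) s)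
        rw [e] at this
        exact this
      · obtain ⟨c, hc0, hc⟩ := exists_ne_zero_isAlgebraic_map s2 _
          (ha2.isAlgebraic (Ideal.Quotient.mkₐ F _ (MvPolynomial.X t)))
        have := hc _ φ2 ((map_ne_zero_iff φ2 hi2).2 hc0)
        refine up _ _ _ Set.subset_union_right ?_
        have e : φ2 (Ideal.Quotient.mkₐ F _ (MvPolynomial.X t)) = Ideal.Quotient.mkₐ F
            (vanishingIdeal F (prodSet X Y)) (MvPolynomial.X (Sum.inr t)) :=
          congrArg (Ideal.Quotient.mkₐ F (vanishingIdeal F (prodSet X Y))) (aeval_X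
            (fun i => (MvPolynomial.X (Sum.inr i) : MvPolynomial (σ ⊕ τ) F)) t)
        rw [e] at this
        exact this)
  have key2 := key.trans ((Cardinal.mk_union_le _ _).trans (add_le_add
    (Cardinal.mk_image_le (s := s1) (f := φ1)) (Cardinal.mk_image_le (s := s2) (f := φ2))))
  have e1 : Cardinal.mk s1 = _ := hs1.cardinalMk_eq_trdeg
  have e2 : Cardinal.mk s2 = _ := hs2.cardinalMk_eq_trdeg
  rw [e1, e2, IrredSet.trdeg_eq, IrredSet.trdeg_eq, IrredSet.trdeg_eq, hp1, hp2] at key2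
  exact_mod_cast key2

omit [Finite τ] in
theorem irredSet_univ [Infinite F] : IrredSet (Set.univ : Set (σ → F)) := by
  rw [irredSet_iff]
  refine ⟨⟨0, trivial⟩, fun p q h => ?_⟩
  have : p * q = 0 := by
    apply MvPolynomial.funext
    intro x
    simpa using h x trivial
  rcases mul_eq_zero.1 this with h | h <;> simp [h]

omit [Finite τ] in
theorem vdim_le_card (X : Set (σ → F)) : vdim X ≤ Nat.card σ := by
  have := trdeg_le_of_surjective (Ideal.Quotient.mkₐ F (vanishingIdeal F X))
    (Ideal.Quotient.mkₐ_surjective F _)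
  rw [IrredSet.trdeg_eq, MvPolynomial.trdeg_of_isDomain] at this
  have h := Cardinal.toNat_le_toNat this (by simp)
  rw [Cardinal.toNat_natCast, Cardinal.lift_id] at h
  exact h

end DimensionMaps

section PolyFun
open MvPolynomial
variable {F : Type} [Field F] {σ τ : Type}

/-- Functions given by a polynomial. -/
def IsPolyFun (f : (σ → F) → F) : Prop := ∃ p : MvPolynomial σ F, ∀ x, f x = aeval x p

theorem isPolyMap_iff {f : (σ → F) → (τ → F)} : IsPolyMap f ↔ ∀ t, IsPolyFun fun x => f x t := by
  constructor
  · rintro ⟨P, hP⟩ t; exact ⟨P t, fun x => hP x t⟩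
  · intro h
    choose P hP using h
    exact ⟨P, fun x t => hP t x⟩

theorem IsPolyFun.const (c : F) : IsPolyFun fun _ : σ → F => c := ⟨C c, by simp⟩
theorem IsPolyFun.coord (s : σ) : IsPolyFun fun x : σ → F => x s := ⟨X s, by simp⟩
theorem IsPolyFun.add {f g : (σ → F) → F} (hf : IsPolyFun f) (hg : IsPolyFun g) :
    IsPolyFun fun x => f x + g x := by
  obtain ⟨p, hp⟩ := hf; obtain ⟨q, hq⟩ := hg
  exact ⟨p + q, by simp [hp, hq]⟩
theorem IsPolyFun.sub {f g : (σ → F) → F} (hf : IsPolyFun f) (hg : IsPolyFun g) :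
    IsPolyFun fun x => f x - g x := by
  obtain ⟨p, hp⟩ := hf; obtain ⟨q, hq⟩ := hg
  exact ⟨p - q, by simp [hp, hq]⟩
theorem IsPolyFun.mul {f g : (σ → F) → F} (hf : IsPolyFun f) (hg : IsPolyFun g) :
    IsPolyFun fun x => f x * g x := by
  obtain ⟨p, hp⟩ := hf; obtain ⟨q, hq⟩ := hg
  exact ⟨p * q, by simp [hp, hq]⟩
theorem IsPolyFun.sum {ι : Type} {s : Finset ι} {f : ι → (σ → F) → F}
    (hf : ∀ i, IsPolyFun (f i)) : IsPolyFun fun x => ∑ i ∈ s, f i x := by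
  choose p hp using hf
  exact ⟨∑ i ∈ s, p i, by simp [hp, map_sum]⟩
theorem IsPolyFun.prod {ι : Type} {s : Finset ι} {f : ι → (σ → F) → F}
    (hf : ∀ i, IsPolyFun (f i)) : IsPolyFun fun x => ∏ i ∈ s, f i x := by
  choose p hp using hf
  exact ⟨∏ i ∈ s, p i, by simp [hp, map_prod]⟩
theorem IsPolyFun.comp {f : (τ → F) → F} {g : (σ → F) → (τ → F)} (hf : IsPolyFun f)
    (hg : IsPolyMap g) : IsPolyFun fun x => f (g x) := by
  obtain ⟨p, hp⟩ := hf
  obtain ⟨q, hq⟩ := hg.exists_pullback p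
  exact ⟨q, fun x => (hp _).trans (hq x)⟩

variable {n : ℕ}

/-- Matrix valued polynomial maps. -/
def IsPolyMat (f : (σ → F) → Matrix (Fin n) (Fin n) F) : Prop := ∀ i j, IsPolyFun fun x => f x i j

theorem IsPolyMat.const (M : Matrix (Fin n) (Fin n) F) : IsPolyMat fun _ : σ → F => M :=
  fun i j => IsPolyFun.const (M i j)
theorem IsPolyMat.mul {f g : (σ → F) → Matrix (Fin n) (Fin n) F} (hf : IsPolyMat f)
    (hg : IsPolyMat g) : IsPolyMat fun x => f x * g x := by
  intro i j
  simp only [Matrix.mul_apply]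
  exact IsPolyFun.sum fun k => (hf i k).mul (hg k j)
theorem IsPolyMat.pow {f : (σ → F) → Matrix (Fin n) (Fin n) F} (hf : IsPolyMat f) (k : ℕ) :
    IsPolyMat fun x => f x ^ k := by
  induction k with
  | zero => simpa using IsPolyMat.const (1 : Matrix (Fin n) (Fin n) F)
  | succ k ih => simpa only [pow_succ] using ih.mul hf
theorem IsPolyMat.trace {f : (σ → F) → Matrix (Fin n) (Fin n) F} (hf : IsPolyMat f) :
    IsPolyFun fun x => (f x).trace := IsPolyFun.sum fun i => hf i i
theorem IsPolyMat.det {f : (σ → F) → Matrix (Fin n) (Fin n) F} (hf : IsPolyMat f) :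
    IsPolyFun fun x => (f x).det := by
  simp only [Matrix.det_apply']
  exact IsPolyFun.sum fun s => (IsPolyFun.const _).mul (IsPolyFun.prod fun i => hf _ _)
theorem IsPolyMat.adjugate {f : (σ → F) → Matrix (Fin n) (Fin n) F} (hf : IsPolyMat f) :
    IsPolyMat fun x => (f x).adjugate := by
  intro i j
  simp only [Matrix.adjugate_apply]
  apply IsPolyMat.det
  intro a b
  simp only [Matrix.updateRow_apply]
  split_ifs
  · exact IsPolyFun.const _
  · exact hf a b

/-- The entries of a matrix as a point of affine space. -/
def mv (M : Matrix (Fin n) (Fin n) F) : Fin n × Fin n → F := fun s => M s.1 s.2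
/-- The matrix with given entries. -/
def vm (x : Fin n × Fin n → F) : Matrix (Fin n) (Fin n) F := Matrix.of fun i j => x (i, j)
@[simp] theorem vm_mv (M : Matrix (Fin n) (Fin n) F) : vm (mv M) = M := rfl
@[simp] theorem mv_vm (x : Fin n × Fin n → F) : mv (vm x) = x := rfl
theorem mv_injective : Function.Injective (mv (F := F) (n := n)) := fun M N h => by
  rw [← vm_mv M, h, vm_mv]

theorem IsPolyMat.vm {g : (σ → F) → (Fin n × Fin n → F)} (hg : IsPolyMap g) :
    IsPolyMat fun x => vm (g x) := fun i j => isPolyMap_iff.1 hg (i, j)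
theorem isPolyMap_id : IsPolyMap (fun x : σ → F => x) := ⟨X, by simp⟩
theorem IsPolyMat.vm_id : IsPolyMat fun x : Fin n × Fin n → F => _root_.vm x :=
  IsPolyMat.vm isPolyMap_id
theorem IsPolyMat.mv {f : (σ → F) → Matrix (Fin n) (Fin n) F} (hf : IsPolyMat f) :
    IsPolyMap fun x => mv (f x) := isPolyMap_iff.2 fun s => hf s.1 s.2

/-- The coordinate point of an element of the special linear group. -/
def slpt (g : Matrix.SpecialLinearGroup (Fin n) F) : Fin n × Fin n → F := mv (g : Matrix _ _ F)
theorem slpt_injective : Function.Injective (slpt (F := F) (n := n)) := fun g h e =>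
  Subtype.ext (mv_injective e)

end PolyFun

section MatrixDim
open MvPolynomial
variable {F : Type} [Field F] {n : ℕ}

theorem le_vdim_SL [Infinite F] (hn : 1 ≤ n) :
    n ^ 2 - 1 ≤ vdim (Set.range (slpt (F := F) (n := n))) := by
  classical
  obtain ⟨m, rfl⟩ : ∃ m, n = m + 1 := ⟨n - 1, by omega⟩
  set W := Set.range (slpt (F := F) (n := m + 1)) with hW
  let ι := {s : Fin (m + 1) × Fin (m + 1) // s ≠ (0, 0)}
  let M : (ι → F) → F → Matrix (Fin (m + 1)) (Fin (m + 1)) F := fun y t =>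
    Matrix.of fun i j => if h : (i, j) ≠ (0, 0) then y ⟨(i, j), h⟩ else t
  have hMpoly : ∀ t, IsPolyMat fun y => M y t := by
    intro t i j
    by_cases h : (i, j) ≠ (0, 0)
    · simp only [M, Matrix.of_apply, dif_pos h]; exact IsPolyFun.coord _
    · simp only [M, Matrix.of_apply, dif_neg h]; exact IsPolyFun.const _
  let c : (ι → F) → F := fun y => ((M y 0).submatrix (Fin.succAbove 0) (Fin.succAbove 0)).det
  have hc : IsPolyFun c := by
    apply IsPolyMat.det
    intro i j
    exact hMpoly 0 (Fin.succAbove 0 i) (Fin.succAbove 0 j)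
  have hdet : ∀ y t, (M y t).det = (M y 0).det + t * c y := by
    intro y t
    rw [Matrix.det_succ_row_zero, Matrix.det_succ_row_zero, Fin.sum_univ_succ, Fin.sum_univ_succ]
    have hsub : ∀ (k : Fin (m + 1)) , (M y t).submatrix Fin.succ (Fin.succAbove k) =
        (M y 0).submatrix Fin.succ (Fin.succAbove k) := by
      intro k
      ext i j
      simp [M, Fin.succ_ne_zero]
    have h00 : ∀ t, M y t 0 0 = t := by intro t; simp [M]
    have h0k : ∀ t (k : Fin m), M y t 0 k.succ = M y 0 0 k.succ := by
      intro t k; simp [M, Fin.succ_ne_zero]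
    simp only [hsub, h00, h0k, c]
    simp
    ring
  have hind : AlgebraicIndependent F
      (fun s : ι => Ideal.Quotient.mkₐ F (vanishingIdeal F W) (X s.1)) := by
    rw [algebraicIndependent_iff]
    intro p hp
    have hp' : ∀ x ∈ W, aeval (fun s : ι => x s.1) p = 0 := by
      have h1 : Ideal.Quotient.mkₐ F (vanishingIdeal F W)
          (aeval (fun s : ι => (X s.1 : MvPolynomial (Fin (m + 1) × Fin (m + 1)) F)) p) = 0 := by
        rw [MvPolynomial.comp_aeval_apply]; exact hp
      rw [Ideal.Quotient.mkₐ_eq_mk, Ideal.Quotient.eq_zero_iff_mem] at h1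
      intro x hx
      have := h1 x hx
      rw [MvPolynomial.comp_aeval_apply] at this
      simpa using this
    obtain ⟨q, hq⟩ := hc
    have hpq : p * q = 0 := by
      apply MvPolynomial.funext
      intro y
      rw [map_zero, map_mul, ← MvPolynomial.coe_aeval_eq_eval, mul_eq_zero]
      by_cases hy : c y = 0
      · right; exact (hq y).symm.trans hy
      left
      have hd : (M y ((1 - (M y 0).det) / c y)).det = 1 := by
        rw [hdet]; field_simp; ring
      have := hp' _ ⟨⟨_, hd⟩, rfl⟩
      have e : (fun s : ι => slpt ⟨_, hd⟩ s.1) = y := funext fun s => by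
        have hs := s.2
        simp only [slpt, mv, M, Matrix.of_apply]
        rw [dif_pos hs]
      rwa [e] at this
    rcases mul_eq_zero.1 hpq with h | h
    · exact h
    exfalso
    have h1 := hq (fun s => (1 : Matrix (Fin (m + 1)) (Fin (m + 1)) F) s.1.1 s.1.2)
    rw [h, map_zero] at h1
    have h2 : (M (fun s => (1 : Matrix (Fin (m + 1)) (Fin (m + 1)) F) s.1.1 s.1.2) 0).submatrix
        (Fin.succAbove 0) (Fin.succAbove 0) = 1 := by
      ext i j
      simp [M, Fin.succ_ne_zero, Matrix.one_apply]
    simp only [c, h2, Matrix.det_one] at h1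
    exact one_ne_zero h1
  have h1 := hind.cardinalMk_le_trdeg
  rw [IrredSet.trdeg_eq] at h1
  have h2 : Cardinal.mk ι = (((m + 1) ^ 2 - 1 : ℕ) : Cardinal) := by
    rw [Cardinal.mk_fintype]
    congr 1
    simp only [ι, ne_eq]
    rw [Fintype.card_subtype_compl]
    simp [sq]
  rw [h2] at h1
  exact_mod_cast h1

/-- Krylov matrix of a vector. -/
def krylov {R : Type*} [CommRing R] (x : Matrix (Fin n) (Fin n) R) (v : Fin n → R) :
    Matrix (Fin n) (Fin n) R := Matrix.of fun i j => (x ^ (j : ℕ)).mulVec v i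

theorem krylov_map {R S : Type*} [CommRing R] [CommRing S] (f : R →+* S)
    (x : Matrix (Fin n) (Fin n) R) (v : Fin n → R) :
    (krylov x v).map f = krylov (x.map f) (fun i => f (v i)) := by
  ext i j
  simp only [krylov, Matrix.map_apply, Matrix.of_apply]
  rw [RingHom.map_mulVec]
  congr 1
  rw [← RingHom.mapMatrix_apply, map_pow]
  rfl

theorem det_krylov_map {R S : Type*} [CommRing R] [CommRing S] (f : R →+* S)
    (x : Matrix (Fin n) (Fin n) R) (v : Fin n → R) :
    f (krylov x v).det = (krylov (x.map f) (fun i => f (v i))).det := by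
  rw [RingHom.map_det, RingHom.mapMatrix_apply, krylov_map]

theorem pow_natDegree_mulVec_mem {A : Type} [CommRing A] [Algebra F A]
    (x : Matrix (Fin n) (Fin n) A) (v : Fin n → A) (q : Polynomial F) (hm : q.Monic)
    (hdeg : q.natDegree = n) (hx : Polynomial.aeval x q = 0) (R : Subalgebra F A)
    (hb : ∀ k < n, ∀ i, (x ^ k).mulVec v i ∈ R) (i : Fin n) : (x ^ n).mulVec v i ∈ R := by
  rw [Polynomial.aeval_eq_sum_range, hdeg, Finset.sum_range_succ] at hx
  have hlead : q.coeff n = 1 := by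
    have := hm.coeff_natDegree
    rwa [hdeg] at this
  rw [hlead, one_smul] at hx
  have h4 := congrArg (fun N : Matrix (Fin n) (Fin n) A => N.mulVec v i) hx
  simp only [Matrix.add_mulVec, Matrix.zero_mulVec, Pi.add_apply, Pi.zero_apply,
    Matrix.sum_mulVec, Finset.sum_apply, Matrix.smul_mulVec, Pi.smul_apply] at h4
  rw [eq_neg_of_add_eq_zero_right h4]
  apply R.neg_mem
  apply R.sum_mem
  intro l hl
  exact R.smul_mem (hb l (Finset.mem_range.1 hl) i) _

theorem det_mul_entry_mem {A : Type} [CommRing A] [Algebra F A]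
    (x P : Matrix (Fin n) (Fin n) A) (R : Subalgebra F A)
    (hPR : ∀ i j, P i j ∈ R) (hQR : ∀ i j, (x * P) i j ∈ R) :
    P.det ∈ R ∧ ∀ i j, P.det * x i j ∈ R := by
  have hadj : ∀ N : Matrix (Fin n) (Fin n) A, (∀ i j, N i j ∈ R) →
      ∃ N' : Matrix (Fin n) (Fin n) R, N'.map (algebraMap R A) = N := fun N hN =>
    ⟨Matrix.of fun i j => ⟨N i j, hN i j⟩, by ext i j; rfl⟩
  obtain ⟨P', hP'⟩ := hadj P hPR
  have hd : algebraMap R A P'.det = P.det := by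
    rw [RingHom.map_det, RingHom.mapMatrix_apply, hP']
  refine ⟨hd ▸ (P'.det).2, fun i j => ?_⟩
  have h1 : P'.adjugate.map (algebraMap R A) = P.adjugate := by
    rw [← RingHom.mapMatrix_apply, RingHom.map_adjugate, RingHom.mapMatrix_apply, hP']
  have h5 : (x * P) * P.adjugate = P.det • x := by
    rw [Matrix.mul_assoc, Matrix.mul_adjugate, Matrix.mul_smul, Matrix.mul_one]
  have h6 : P.det * x i j = ((x * P) * P.adjugate) i j := by
    rw [h5]; rfl
  rw [h6, Matrix.mul_apply]
  apply R.sum_mem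
  intro k _
  refine R.mul_mem (hQR i k) ?_
  rw [← h1]
  exact (P'.adjugate k j).2

theorem exists_generators_of_aeval_eq_zero {A : Type} [CommRing A] [IsDomain A] [Algebra F A]
    (hn : 0 < n) (x : Matrix (Fin n) (Fin n) A) (v : Fin n → F) (q : Polynomial F) (hm : q.Monic)
    (hdeg : q.natDegree = n) (hx : Polynomial.aeval x q = 0)
    (hdet : (krylov x fun i => algebraMap F A (v i)).det ≠ 0) :
    ∃ b : Set A, Cardinal.mk b ≤ ((n * (n - 1) : ℕ) : Cardinal) ∧
      ∀ i j, IsAlgebraic (Algebra.adjoin F b) (x i j) := by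
  set vA : Fin n → A := fun i => algebraMap F A (v i) with hvA
  let b : Set A := Set.range fun s : Fin n × Fin (n - 1) => (x ^ ((s.2 : ℕ) + 1)).mulVec vA s.1
  have hb : ∀ k < n, ∀ i, (x ^ k).mulVec vA i ∈ Algebra.adjoin F b := by
    intro k hk i
    rcases Nat.eq_zero_or_pos k with h0 | h0
    · subst h0
      simp only [pow_zero, Matrix.one_mulVec]
      exact (Algebra.adjoin F b).algebraMap_mem _
    · apply Algebra.subset_adjoin
      refine ⟨(i, ⟨k - 1, by omega⟩), ?_⟩
      have e : k - 1 + 1 = k := by omega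
      simp only [e]
  have hbn : ∀ k ≤ n, ∀ i, (x ^ k).mulVec vA i ∈ Algebra.adjoin F b := by
    intro k hk i
    rcases hk.lt_or_eq with h | h
    · exact hb k h i
    rw [h]
    exact pow_natDegree_mulVec_mem x vA q hm hdeg hx _ hb i
  refine ⟨b, Cardinal.mk_range_le.trans (by simp), fun i j => ?_⟩
  obtain ⟨h1, h2⟩ := det_mul_entry_mem x (krylov x vA) (Algebra.adjoin F b)
    (fun i j => hb j j.2 i) (fun i j => by
      have : (x * krylov x vA) i j = (x ^ ((j : ℕ) + 1)).mulVec vA i := by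
        rw [pow_succ', ← Matrix.mulVec_mulVec]
        rfl
      rw [this]
      exact hbn _ j.2 i)
  refine ⟨Polynomial.C ⟨_, h1⟩ * Polynomial.X - Polynomial.C ⟨_, h2 i j⟩, ?_, ?_⟩
  · intro h0
    have h3 := congrArg (fun q => q.coeff 1) h0
    simp only [Polynomial.coeff_sub, Polynomial.coeff_C_mul, Polynomial.coeff_X_one, mul_one,
      Polynomial.coeff_C_of_ne_zero one_ne_zero, sub_zero, Polynomial.coeff_zero] at h3
    exact hdet (congrArg Subtype.val h3)
  · simp only [map_sub, map_mul, Polynomial.aeval_C, Polynomial.aeval_X]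
    exact sub_self _

theorem vdim_conj_le (g : Matrix (Fin n) (Fin n) F) (v : Fin n → F) (hv : (krylov g v).det ≠ 0)
    (W : Set (Fin n × Fin n → F)) (hW : IrredSet W)
    (hg : mv g ∈ W) (hWg : ∀ w ∈ W, Polynomial.aeval (vm w) g.charpoly = 0) :
    vdim W ≤ n * (n - 1) := by
  rcases Nat.eq_zero_or_pos n with hn0 | hn
  · subst hn0
    have := vdim_le_card W
    simpa using this
  have hWp : (vanishingIdeal F W).IsPrime := hW
  let π : MvPolynomial (Fin n × Fin n) F →ₐ[F] (MvPolynomial (Fin n × Fin n) F ⧸ vanishingIdeal F W) :=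
    Ideal.Quotient.mkₐ F (vanishingIdeal F W)
  let G : Matrix (Fin n) (Fin n) (MvPolynomial (Fin n × Fin n) F) := Matrix.of fun i j => X (i, j)
  have hGw : ∀ w : Fin n × Fin n → F, G.map (aeval w : _ →ₐ[F] F) = vm w := by
    intro w; ext i j; simp [G, vm]
  have hx : Polynomial.aeval (G.map π) g.charpoly = 0 := by
    have h1 : G.map π = (π.mapMatrix) G := rfl
    rw [h1, Polynomial.aeval_algHom_apply]
    ext i j
    change π _ = 0
    rw [Ideal.Quotient.mkₐ_eq_mk, Ideal.Quotient.eq_zero_iff_mem]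
    intro w hw
    have h2 := Polynomial.aeval_algHom_apply
      ((aeval w : MvPolynomial (Fin n × Fin n) F →ₐ[F] F).mapMatrix (m := Fin n)) G g.charpoly
    have h3 : ((aeval w : MvPolynomial (Fin n × Fin n) F →ₐ[F] F).mapMatrix (m := Fin n)) G = vm w :=
      hGw w
    rw [h3, hWg w hw] at h2
    exact (congrFun (congrFun h2 i) j).symm
  have hdet : (krylov (G.map π) fun i => algebraMap F _ (v i)).det ≠ 0 := by
    intro h
    have h6 := det_krylov_map π.toRingHom G fun i => C (v i)
    have h6' : π.toRingHom (krylov G fun i => C (v i)).det = 0 := h6.trans h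
    have h6'' : (krylov G fun i => C (v i)).det ∈ vanishingIdeal F W :=
      Ideal.Quotient.eq_zero_iff_mem.1 h6'
    have h7 := h6'' (mv g) hg
    have h8 := det_krylov_map (aeval (mv g) : MvPolynomial (Fin n × Fin n) F →ₐ[F] F).toRingHom
      G fun i => C (v i)
    apply hv
    have h9 : (krylov (G.map (aeval (mv g) : MvPolynomial (Fin n × Fin n) F →ₐ[F] F).toRingHom)
      fun i => (aeval (mv g) : MvPolynomial (Fin n × Fin n) F →ₐ[F] F).toRingHom (C (v i))) =
        krylov g v := by
      congr 1
      · exact hGw _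
      · funext i; simp
    rw [← h9, ← h8]
    exact h7
  obtain ⟨b, hbc, hb⟩ := exists_generators_of_aeval_eq_zero hn (G.map π) v g.charpoly
    g.charpoly_monic (by simp) hx hdet
  have hfin := trdeg_le_of_generators (F := F) b _ (adjoin_coords (vanishingIdeal F W)) (by
    rintro _ ⟨⟨i, j⟩, rfl⟩
    exact hb i j)
  have e : Algebra.trdeg F (MvPolynomial (Fin n × Fin n) F ⧸ vanishingIdeal F W) =
    (vdim W : Cardinal) := IrredSet.trdeg_eq
  rw [e] at hfin
  exact_mod_cast hfin.trans hbc

end MatrixDim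

section Regular
open MvPolynomial

/-- The discriminant of the characteristic polynomial, as a determinant of power sums. -/
def tdisc {R : Type*} [CommRing R] {n : ℕ} (x : Matrix (Fin n) (Fin n) R) : R :=
  (Matrix.of fun i j : Fin n => (x ^ ((i : ℕ) + (j : ℕ))).trace).det

theorem tdisc_map {R S : Type*} [CommRing R] [CommRing S] {n : ℕ} (f : R →+* S)
    (x : Matrix (Fin n) (Fin n) R) : tdisc (x.map f) = f (tdisc x) := by
  rw [tdisc, tdisc, RingHom.map_det]
  congr 1
  ext i j
  simp only [Matrix.of_apply, RingHom.mapMatrix_apply, Matrix.map_apply]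
  have : (x.map f) ^ ((i : ℕ) + (j : ℕ)) = (x ^ ((i : ℕ) + (j : ℕ))).map f := by
    rw [← RingHom.mapMatrix_apply, ← RingHom.mapMatrix_apply, map_pow]
  rw [this]
  simp [Matrix.trace, map_sum]

theorem tdisc_conj {R : Type*} [CommRing R] {n : ℕ} (x P Q : Matrix (Fin n) (Fin n) R)
    (h : Q * P = 1) : tdisc (P * x * Q) = tdisc x := by
  rw [tdisc, tdisc]
  congr 1
  ext i j
  simp only [Matrix.of_apply]
  have : ∀ k : ℕ, (P * x * Q) ^ k = P * x ^ k * Q := by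
    intro k
    induction k with
    | zero => simp [mul_eq_one_comm.1 h]
    | succ k ih =>
      rw [pow_succ, ih, pow_succ]
      calc P * x ^ k * Q * (P * x * Q) = P * x ^ k * (Q * P) * x * Q := by noncomm_ring
        _ = _ := by rw [h]; noncomm_ring
  rw [this, Matrix.trace_mul_comm, ← Matrix.mul_assoc, h, Matrix.one_mul]

theorem tdisc_smul {R : Type*} [CommRing R] {n : ℕ} (c : R) (x : Matrix (Fin n) (Fin n) R) :
    tdisc (c • x) = (∏ i : Fin n, c ^ (i : ℕ)) * ((∏ i : Fin n, c ^ (i : ℕ)) * tdisc x) := by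
  rw [tdisc, tdisc, ← Matrix.det_mul_row, ← Matrix.det_mul_column]
  congr 1
  ext i j
  simp only [Matrix.of_apply, smul_pow, Matrix.trace_smul, smul_eq_mul]
  rw [pow_add, mul_assoc]

variable {F : Type} [Field F] {n : ℕ}

theorem IsPolyMat.tdisc {σ : Type} {f : (σ → F) → Matrix (Fin n) (Fin n) F} (hf : IsPolyMat f) :
    IsPolyFun fun x => tdisc (f x) := by
  apply IsPolyMat.det
  intro i j
  exact (hf.pow _).trace

theorem isPolyMap_linear {σ τ : Type} [Finite σ] (f : (σ → F) →ₗ[F] (τ → F)) : IsPolyMap f := by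
  classical
  cases nonempty_fintype σ
  refine isPolyMap_iff.2 fun t => ?_
  have : (fun x => f x t) = fun x => ∑ s, x s * f (Pi.single s 1) t := by
    funext x
    conv_lhs => rw [LinearMap.pi_apply_eq_sum_univ f x]
    simp only [Finset.sum_apply, Pi.smul_apply, smul_eq_mul]
    refine Finset.sum_congr rfl fun s _ => ?_
    have e : (fun j => if s = j then 1 else 0) = (Pi.single s 1 : σ → F) := by
      funext j
      simp [Pi.single_apply, eq_comm]
    rw [e]
  rw [this]
  exact IsPolyFun.sum fun s => (IsPolyFun.coord s).mul (IsPolyFun.const _)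

theorem eq_zero_of_mulVec_eq_zero {R : Type*} [Field R] {x t : Matrix (Fin n) (Fin n) R}
    {v : Fin n → R} (hv : (krylov t v).det ≠ 0) (h : x * t = t * x) (hx : x.mulVec v = 0) :
    x = 0 := by
  have h1 : x * krylov t v = 0 := by
    ext i j
    have h2 : (x * krylov t v) i j = (x * t ^ (j : ℕ)).mulVec v i := by
      rw [← Matrix.mulVec_mulVec]; rfl
    have h3 : x * t ^ (j : ℕ) = t ^ (j : ℕ) * x := (Commute.pow_right h _)
    rw [h2, h3, ← Matrix.mulVec_mulVec, hx, Matrix.mulVec_zero]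
    rfl
  have hu : IsUnit (krylov t v) := (Matrix.isUnit_iff_isUnit_det _).2 (isUnit_iff_ne_zero.2 hv)
  exact (hu.mul_left_eq_zero).1 h1

/-- Points of affine space corresponding to matrices commuting with `t`. -/
def commSet (t : Matrix (Fin n) (Fin n) F) : Set (Fin n × Fin n → F) :=
  {x | vm x * t = t * vm x}

theorem commSet_irred [Infinite F] (t : Matrix (Fin n) (Fin n) F) (v : Fin n → F)
    (hv : (krylov t v).det ≠ 0) : IrredSet (commSet t) ∧ vdim (commSet t) ≤ n := by
  let E : Submodule F (Fin n × Fin n → F) :=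
    { carrier := commSet t
      add_mem' := by
        intro a b ha hb
        have e : vm (a + b) = vm a + vm b := rfl
        simp only [commSet, Set.mem_ofPred_eq] at ha hb ⊢
        rw [e, add_mul, mul_add, ha, hb]
      zero_mem' := by
        have e : vm (0 : Fin n × Fin n → F) = 0 := rfl
        simp only [commSet, Set.mem_ofPred_eq, e, zero_mul, mul_zero]
      smul_mem' := by
        intro c a ha
        have e : vm (c • a) = c • vm a := rfl
        simp only [commSet, Set.mem_ofPred_eq] at ha ⊢
        rw [e, Matrix.smul_mul, Matrix.mul_smul, ha] }
  let φ : E →ₗ[F] (Fin n → F) :=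
    { toFun := fun x => (vm x.1).mulVec v
      map_add' := fun a b => Matrix.add_mulVec _ _ _
      map_smul' := fun c a => Matrix.smul_mulVec c (vm a.1) v }
  have hφ : LinearMap.ker φ = ⊥ := by
    rw [LinearMap.ker_eq_bot']
    intro x hx
    have h0 : vm x.1 = 0 := eq_zero_of_mulVec_eq_zero hv x.2 hx
    apply Subtype.ext
    funext s
    exact congrFun (congrFun h0 s.1) s.2
  obtain ⟨ψ, hψ⟩ := LinearMap.exists_leftInverse_of_injective φ hφ
  have him : commSet t = (E.subtype ∘ₗ ψ) '' Set.univ := by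
    ext x
    constructor
    · intro hx
      refine ⟨φ ⟨x, hx⟩, trivial, ?_⟩
      have := LinearMap.congr_fun hψ ⟨x, hx⟩
      exact congrArg Subtype.val this
    · rintro ⟨y, -, rfl⟩
      exact (ψ y).2
  have hp := isPolyMap_linear (E.subtype ∘ₗ ψ)
  rw [him]
  refine ⟨irredSet_univ.image hp, (vdim_image_le hp _).trans ?_⟩
  simpa using vdim_le_card (Set.univ : Set (Fin n → F))

theorem vdim_singular_commutant_le [Infinite F] (hn : 2 ≤ n) (t : Matrix (Fin n) (Fin n) F)
    (v : Fin n → F) (hv : (krylov t v).det ≠ 0) (ht : tdisc t ≠ 0)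
    (Z : Set (Fin n × Fin n → F)) (hZ : IrredSet Z)
    (hZt : ∀ z ∈ Z, vm z * t = t * vm z ∧ (vm z).det = 1 ∧ tdisc (vm z) = 0) :
    vdim Z ≤ n - 2 := by
  obtain ⟨hE, hEn⟩ := commSet_irred t v hv
  let cone : (Unit ⊕ (Fin n × Fin n) → F) → (Fin n × Fin n → F) := fun z s =>
    z (Sum.inl ()) * z (Sum.inr s)
  have hcone : IsPolyMap cone := isPolyMap_iff.2 fun s =>
    (IsPolyFun.coord _).mul (IsPolyFun.coord _)
  set Z' := cone '' prodSet (Set.univ : Set (Unit → F)) Z with hZ'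
  have hirr : IrredSet Z' := (irredSet_univ.prod hZ).image hcone
  have hmem : ∀ c : F, ∀ z ∈ Z, (fun s => c * z s) ∈ Z' := fun c z hz =>
    ⟨Sum.elim (fun _ => c) z, elim_mem_prodSet.2 ⟨trivial, hz⟩, rfl⟩
  have hform : ∀ y ∈ Z', ∃ c : F, ∃ z ∈ Z, vm y = c • vm z := by
    rintro _ ⟨w, hw, rfl⟩
    exact ⟨w (Sum.inl ()), _, (mem_prodSet.1 hw).2, rfl⟩
  obtain ⟨p, hp⟩ := ((IsPolyMat.vm_id (F := F) (n := n)).det).sub (IsPolyFun.const 1)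
  obtain ⟨q, hq⟩ := (IsPolyMat.vm_id (F := F) (n := n)).tdisc
  obtain ⟨z₀, hz₀⟩ := hZ.nonempty
  have h1 : vdim Z < vdim Z' := by
    refine hZ.vdim_lt hirr (fun z hz => by simpa using hmem 1 z hz) p (fun z hz => ?_)
      ⟨_, hmem 0 z₀ hz₀, ?_⟩
    · rw [← hp]
      simp only [(hZt z hz).2.1, sub_self]
    · rw [← hp]
      have e : vm (fun s => 0 * z₀ s) = 0 := by ext; simp [vm]
      have : Nonempty (Fin n) := ⟨⟨0, by omega⟩⟩
      simp only [e, Matrix.det_zero]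
      simp
  have h2 : vdim Z' < vdim (commSet t) := by
    refine hirr.vdim_lt hE (fun y hy => ?_) q (fun y hy => ?_) ⟨mv t, rfl, ?_⟩
    · obtain ⟨c, z, hz, e⟩ := hform y hy
      change vm y * t = t * vm y
      rw [e, Matrix.smul_mul, Matrix.mul_smul, (hZt z hz).1]
    · obtain ⟨c, z, hz, e⟩ := hform y hy
      rw [← hq]
      simp only [e, tdisc_smul, (hZt z hz).2.2, mul_zero]
    · rw [← hq]; exact ht
  omega

end Regular

section RegularDiag
open Polynomial
variable {L : Type} [Field L] {n : ℕ}

theorem eq_zero_of_isNilpotent_aeval {x : Matrix (Fin n) (Fin n) L} (h : tdisc x ≠ 0) {q : L[X]}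
    (hq : q.degree < n) (hnil : IsNilpotent (aeval x q)) : q = 0 := by
  by_contra hq0
  have hsum := aeval_eq_sum_range' ((natDegree_lt_iff_degree_lt hq0).2 hq) x
  rw [Finset.sum_range] at hsum
  have hc : (fun i : Fin n => q.coeff i) = 0 := by
    apply Matrix.eq_zero_of_mulVec_eq_zero h
    funext j
    have hcomm : Commute (aeval x q) (x ^ (j : ℕ)) := by
      have e : x ^ (j : ℕ) = aeval x (X ^ (j : ℕ) : L[X]) := by simp
      rw [e]
      exact Commute.map (Commute.all q (X ^ (j : ℕ))) (aeval x)
    have h1 := (Matrix.isNilpotent_trace_of_isNilpotent (hcomm.isNilpotent_mul_right hnil)).eq_zero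
    rw [hsum, Finset.sum_mul, Matrix.trace_sum] at h1
    simp only [Matrix.mulVec, dotProduct, Matrix.of_apply, Pi.zero_apply]
    rw [← h1]
    refine Finset.sum_congr rfl fun i _ => ?_
    rw [Matrix.smul_mul, Matrix.trace_smul, smul_eq_mul, mul_comm, ← pow_add, add_comm]
  apply hq0
  ext k
  rw [coeff_zero]
  rcases lt_or_ge k n with hk | hk
  · exact congrFun hc ⟨k, hk⟩
  · exact coeff_eq_zero_of_degree_lt (hq.trans_le (by exact_mod_cast hk))

theorem nodup_roots_charpoly {x : Matrix (Fin n) (Fin n) L} (h : tdisc x ≠ 0) :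
    x.charpoly.roots.Nodup := by
  classical
  rw [Multiset.nodup_iff_count_le_one]
  intro a
  by_contra hc
  push Not at hc
  rw [count_roots] at hc
  have h1 : (X - C a) ^ 2 ∣ x.charpoly :=
    (pow_dvd_pow _ hc).trans (pow_rootMultiplicity_dvd _ _)
  obtain ⟨r, hr⟩ := h1
  have hm := x.charpoly_monic
  have hr0 : r ≠ 0 := by
    rintro rfl
    rw [mul_zero] at hr
    exact hm.ne_zero hr
  have hdeg : x.charpoly.natDegree = n := by simp
  have hd : x.charpoly.natDegree = 2 + r.natDegree := by
    rw [hr, natDegree_mul (pow_ne_zero _ (X_sub_C_ne_zero a)) hr0, natDegree_pow, natDegree_X_sub_C]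
  have hq : ((X - C a) * r) = 0 := by
    apply eq_zero_of_isNilpotent_aeval h
    · rw [degree_lt_iff_coeff_zero]
      intro m hm
      apply coeff_eq_zero_of_natDegree_lt
      rw [natDegree_mul (X_sub_C_ne_zero a) hr0, natDegree_X_sub_C]
      omega
    · refine ⟨2, ?_⟩
      rw [← map_pow]
      have : ((X - C a) * r) ^ 2 = x.charpoly * r := by rw [hr]; ring
      rw [this, map_mul, Matrix.aeval_self_charpoly, zero_mul]
  rcases mul_eq_zero.1 hq with h0 | h0
  · exact X_sub_C_ne_zero a h0
  · exact hr0 h0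

theorem exists_diagonalization [IsAlgClosed L] {x : Matrix (Fin n) (Fin n) L} (h : tdisc x ≠ 0) :
    ∃ (P Q : Matrix (Fin n) (Fin n) L) (μ : Fin n → L), Q * P = 1 ∧ P * Q = 1 ∧
      Function.Injective μ ∧ x = P * Matrix.diagonal μ * Q := by
  classical
  have hcard : x.charpoly.roots.toFinset.card = n := by
    rw [Multiset.toFinset_card_of_nodup (nodup_roots_charpoly h),
      ← (IsAlgClosed.splits x.charpoly).natDegree_eq_card_roots]
    simp
  let e := (Finset.equivFinOfCardEq hcard).symm
  let μ : Fin n → L := fun i => (e i : L)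
  have hμ : Function.Injective μ := Subtype.val_injective.comp e.injective
  have hev : ∀ i, ∃ v : Fin n → L, v ≠ 0 ∧ x.mulVec v = μ i • v := by
    intro i
    have h1 : (μ i) ∈ x.charpoly.roots := Multiset.mem_toFinset.1 (e i).2
    have h2 := (mem_roots'.1 h1).2
    rw [IsRoot, Matrix.eval_charpoly] at h2
    obtain ⟨v, hv, hv'⟩ := Matrix.exists_mulVec_eq_zero_iff.2 h2
    refine ⟨v, hv, ?_⟩
    rw [Matrix.sub_mulVec, sub_eq_zero] at hv'
    rw [← hv']
    simp [Matrix.scalar_apply]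
  choose v hv0 hv using hev
  have hli : LinearIndependent L v :=
    Module.End.eigenvectors_linearIndependent' (Matrix.toLin' x) μ hμ v fun i =>
      ⟨Module.End.mem_eigenspace_iff.2 (by rw [Matrix.toLin'_apply]; exact hv i), hv0 i⟩
  let P : Matrix (Fin n) (Fin n) L := Matrix.of fun i j => v j i
  have hP : IsUnit P := by
    rw [← Matrix.linearIndependent_cols_iff_isUnit]
    exact hli
  have hdet := (Matrix.isUnit_iff_isUnit_det _).1 hP
  refine ⟨P, P⁻¹, μ, Matrix.nonsing_inv_mul _ hdet, Matrix.mul_nonsing_inv _ hdet, hμ, ?_⟩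
  have hxP : x * P = P * Matrix.diagonal μ := by
    ext i j
    rw [Matrix.mul_diagonal]
    have := congrFun (hv j) i
    simp only [Pi.smul_apply, smul_eq_mul] at this
    rw [mul_comm]
    exact this
  rw [← hxP, Matrix.mul_assoc, Matrix.mul_nonsing_inv _ hdet, Matrix.mul_one]

theorem tdisc_diagonal (μ : Fin n → L) :
    tdisc (Matrix.diagonal μ) = (Matrix.vandermonde μ).det * (Matrix.vandermonde μ).det := by
  suffices this : (Matrix.of fun i j : Fin n => (Matrix.diagonal μ ^ ((i : ℕ) + (j : ℕ))).trace) =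
      (Matrix.vandermonde μ).transpose * Matrix.vandermonde μ by
    rw [tdisc, this, Matrix.det_mul, Matrix.det_transpose]
  ext i j
  simp only [Matrix.of_apply, Matrix.diagonal_pow, Matrix.trace_diagonal, Matrix.mul_apply,
    Matrix.transpose_apply, Matrix.vandermonde_apply, Pi.pow_apply]
  exact Finset.sum_congr rfl fun _ _ => pow_add _ _ _

theorem eq_conj_diagonal {P Q x h : Matrix (Fin n) (Fin n) L} {μ : Fin n → L} (h1 : Q * P = 1)
    (h2 : P * Q = 1) (hμ : Function.Injective μ) (hh : h = P * Matrix.diagonal μ * Q)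
    (hx : x * h = h * x) : ∃ ν : Fin n → L, x = P * Matrix.diagonal ν * Q := by
  have hc : (Q * x * P) * Matrix.diagonal μ = Matrix.diagonal μ * (Q * x * P) := by
    have e : Matrix.diagonal μ = Q * h * P := by
      rw [hh]
      calc Matrix.diagonal μ = 1 * Matrix.diagonal μ * 1 := by simp
        _ = (Q * P) * Matrix.diagonal μ * (Q * P) := by rw [h1]
        _ = _ := by noncomm_ring
    rw [e]
    calc Q * x * P * (Q * h * P) = Q * x * (P * Q) * h * P := by noncomm_ring
      _ = Q * (x * h) * P := by rw [h2]; noncomm_ring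
      _ = Q * h * 1 * x * P := by rw [hx]; noncomm_ring
      _ = Q * h * (P * Q) * x * P := by rw [h2]
      _ = _ := by noncomm_ring
  refine ⟨fun i => (Q * x * P) i i, ?_⟩
  have hd : Matrix.diagonal (fun i => (Q * x * P) i i) = Q * x * P := by
    ext i j
    by_cases hij : i = j
    · subst hij; simp
    · rw [Matrix.diagonal_apply_ne _ hij]
      have := congrFun (congrFun hc i) j
      rw [Matrix.mul_diagonal, Matrix.diagonal_mul, mul_comm, ← sub_eq_zero, ← sub_mul] at this
      rcases mul_eq_zero.1 this with h0 | h0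
      · exact absurd (hμ (sub_eq_zero.1 h0)).symm hij
      · exact h0.symm
  rw [hd]
  calc x = 1 * x * 1 := by simp
    _ = (P * Q) * x * (P * Q) := by rw [h2]
    _ = _ := by noncomm_ring

end RegularDiag

section RegularField
open Polynomial
variable {K : Type} [Field K] {n : ℕ}

theorem commute_of_commute_regular {h x y : Matrix (Fin n) (Fin n) K} (hr : tdisc h ≠ 0)
    (hx : x * h = h * x) (hy : y * h = h * y) : x * y = y * x := by
  let f := algebraMap K (AlgebraicClosure K)
  have hr' : tdisc (h.map f) ≠ 0 := by
    rw [tdisc_map]; exact (map_ne_zero f).2 hr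
  obtain ⟨P, Q, μ, h1, h2, hμ, hh⟩ := exists_diagonalization hr'
  have hm : ∀ a b : Matrix (Fin n) (Fin n) K, (a * b).map f = a.map f * b.map f := fun a b =>
    Matrix.map_mul
  obtain ⟨ν, hν⟩ := eq_conj_diagonal h1 h2 hμ hh (x := x.map f) (by rw [← hm, hx, hm])
  obtain ⟨ξ, hξ⟩ := eq_conj_diagonal h1 h2 hμ hh (x := y.map f) (by rw [← hm, hy, hm])
  apply Matrix.map_injective f.injective
  have key : ∀ a b : Fin n → AlgebraicClosure K,
      P * Matrix.diagonal a * Q * (P * Matrix.diagonal b * Q) =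
        P * Matrix.diagonal (fun i => a i * b i) * Q := by
    intro a b
    calc _ = P * Matrix.diagonal a * (Q * P) * Matrix.diagonal b * Q := by noncomm_ring
      _ = P * (Matrix.diagonal a * Matrix.diagonal b) * Q := by rw [h1]; noncomm_ring
      _ = _ := by rw [Matrix.diagonal_mul_diagonal]
  change (x * y).map f = (y * x).map f
  rw [hm, hm, hν, hξ, key, key]
  simp only [mul_comm]

theorem ncard_commute_charpoly_le [Finite K] {t : Matrix (Fin n) (Fin n) K} (hr : tdisc t ≠ 0)
    (χ : K[X]) (hχ : χ.natDegree = n) :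
    {x : Matrix (Fin n) (Fin n) K | x * t = t * x ∧ x.charpoly = χ}.ncard ≤ n ^ n := by
  classical
  let f := algebraMap K (AlgebraicClosure K)
  have hr' : tdisc (t.map f) ≠ 0 := by
    rw [tdisc_map]; exact (map_ne_zero f).2 hr
  obtain ⟨P, Q, μ, h1, h2, hμ, hh⟩ := exists_diagonalization hr'
  have hm : ∀ a b : Matrix (Fin n) (Fin n) K, (a * b).map f = a.map f * b.map f := fun a b =>
    Matrix.map_mul
  set S := {x : Matrix (Fin n) (Fin n) K | x * t = t * x ∧ x.charpoly = χ}
  let R := (χ.map f).roots.toFinset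
  have hR : R.card ≤ n := by
    refine (Multiset.toFinset_card_le _).trans ((card_roots' _).trans ?_)
    rw [natDegree_map, hχ]
  have hex : ∀ x : Matrix (Fin n) (Fin n) K, ∃ ν : Fin n → AlgebraicClosure K, x ∈ S →
      x.map f = P * Matrix.diagonal ν * Q ∧ ν ∈ Fintype.piFinset fun _ : Fin n => R := by
    intro x
    by_cases hx : x ∈ S
    · obtain ⟨ν, hν⟩ := eq_conj_diagonal h1 h2 hμ hh (x := x.map f) (by rw [← hm, hx.1, hm])
      refine ⟨ν, fun _ => ⟨hν, ?_⟩⟩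
      rw [Fintype.mem_piFinset]
      intro i
      have hch : χ.map f = (Matrix.diagonal ν).charpoly := by
        rw [← hx.2, ← Matrix.charpoly_map, hν, Matrix.charpoly_mul_comm, ← Matrix.mul_assoc, h1,
          Matrix.one_mul]
      rw [Multiset.mem_toFinset, mem_roots', hch]
      refine ⟨(Matrix.charpoly_monic _).ne_zero, ?_⟩
      rw [IsRoot, Matrix.eval_charpoly, Matrix.scalar_apply, Matrix.diagonal_sub,
        Matrix.det_diagonal]
      exact Finset.prod_eq_zero (Finset.mem_univ i) (sub_self _)
    · exact ⟨0, fun h => absurd h hx⟩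
  choose ν hν using hex
  have hinj : Set.InjOn ν S := by
    intro x hx y hy e
    apply Matrix.map_injective f.injective
    change x.map f = y.map f
    rw [(hν x hx).1, (hν y hy).1, e]
  have := Set.ncard_le_ncard_of_injOn ν (t := (Fintype.piFinset fun _ : Fin n => R : Finset _))
    (fun x hx => (hν x hx).2) hinj (Finset.finite_toSet _)
  refine this.trans ?_
  rw [Set.ncard_coe_finset, Fintype.card_piFinset]
  simp only [Finset.prod_const, Finset.card_univ, Fintype.card_fin]
  exact Nat.pow_le_pow_left hR n

theorem exists_cyclic_vector [Infinite K] {t : Matrix (Fin n) (Fin n) K} (hr : tdisc t ≠ 0) :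
    ∃ v : Fin n → K, (krylov t v).det ≠ 0 := by
  let f := algebraMap K (AlgebraicClosure K)
  have hr' : tdisc (t.map f) ≠ 0 := by
    rw [tdisc_map]; exact (map_ne_zero f).2 hr
  obtain ⟨P, Q, μ, h1, h2, hμ, hh⟩ := exists_diagonalization hr'
  have hpow : ∀ k : ℕ, (t.map f) ^ k * P = P * Matrix.diagonal (fun i => μ i ^ k) := by
    intro k
    induction k with
    | zero => simp
    | succ k ih =>
      rw [pow_succ', Matrix.mul_assoc, ih, hh]
      calc _ = P * Matrix.diagonal μ * (Q * P) * Matrix.diagonal (fun i => μ i ^ k) := by noncomm_ring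
        _ = P * (Matrix.diagonal μ * Matrix.diagonal (fun i => μ i ^ k)) := by
          rw [h1]; noncomm_ring
        _ = _ := by
          rw [Matrix.diagonal_mul_diagonal]
          simp only [pow_succ']
  let w : Fin n → AlgebraicClosure K := P.mulVec fun _ => 1
  have hk : krylov (t.map f) w = P * Matrix.vandermonde μ := by
    ext i j
    simp only [krylov, Matrix.of_apply, w]
    rw [Matrix.mulVec_mulVec, hpow, ← Matrix.mulVec_mulVec, Matrix.mul_apply]
    simp [Matrix.mulVec, dotProduct, Matrix.diagonal_apply]
  have hd : (krylov (t.map f) w).det ≠ 0 := by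
    rw [hk, Matrix.det_mul]
    refine mul_ne_zero ?_ (Matrix.det_vandermonde_ne_zero_iff.2 hμ)
    intro h0
    have := congrArg Matrix.det h1
    rw [Matrix.det_mul, h0, mul_zero, Matrix.det_one] at this
    exact zero_ne_one this
  by_contra hcon
  push Not at hcon
  have hp : (krylov (t.map (MvPolynomial.C : K →+* MvPolynomial (Fin n) K))
      fun i => MvPolynomial.X i).det = 0 := by
    apply MvPolynomial.funext
    intro v
    rw [det_krylov_map, map_zero, ← hcon v]
    congr 2
    · ext i j; simp
    · funext i; simp
  apply hd
  have := det_krylov_map (MvPolynomial.eval₂Hom f w)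
    (t.map (MvPolynomial.C : K →+* MvPolynomial (Fin n) K)) fun i => MvPolynomial.X i
  rw [hp, map_zero] at this
  rw [this]
  congr 2
  · ext i j; simp
  · funext i; simp

end RegularField

section Counting
variable {K : Type} [Field K] {n : ℕ}

theorem exists_regular_SL [CharZero K] (hn : 1 ≤ n) :
    ∃ g : Matrix.SpecialLinearGroup (Fin n) K, tdisc (g : Matrix (Fin n) (Fin n) K) ≠ 0 := by
  obtain ⟨m, rfl⟩ : ∃ m, n = m + 1 := ⟨n - 1, by omega⟩
  let e : Fin (m + 1) → ℤ := Fin.snoc (α := fun _ => ℤ) (fun i : Fin m => (i : ℤ) + 1)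
    (-∑ i : Fin m, ((i : ℤ) + 1))
  have he : ∑ i, e i = 0 := by
    rw [Fin.sum_univ_castSucc]
    simp [e]
  have hinj : Function.Injective e := by
    have hneg : ∀ i : Fin m, e i.castSucc ≠ e (Fin.last m) := by
      intro i
      simp only [e, Fin.snoc_castSucc, Fin.snoc_last]
      have : 0 ≤ ∑ i : Fin m, ((i : ℤ) + 1) := Finset.sum_nonneg fun i _ => by positivity
      have hi : (0 : ℤ) ≤ (i : ℤ) := by positivity
      omega
    intro i j
    induction i using Fin.lastCases with
    | last =>
      induction j using Fin.lastCases with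
      | last => intro _; rfl
      | cast j => intro h; exact absurd h.symm (hneg j)
    | cast i =>
      induction j using Fin.lastCases with
      | last => intro h; exact absurd h (hneg i)
      | cast j =>
        intro h
        simp only [e, Fin.snoc_castSucc] at h
        congr 1
        apply Fin.ext
        omega
  let d : Fin (m + 1) → ℚ := fun i => 2 ^ e i
  have hd : Function.Injective d := (zpow_right_injective₀ (by norm_num) (by norm_num)).comp hinj
  have hdet : (Matrix.diagonal d).det = 1 := by
    rw [Matrix.det_diagonal]
    have hz : ∀ s : Finset (Fin (m + 1)), ∏ i ∈ s, d i = (2 : ℚ) ^ (∑ i ∈ s, e i) := by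
      intro s
      classical
      induction s using Finset.induction_on with
      | empty => simp
      | insert a s ha ih =>
        rw [Finset.prod_insert ha, Finset.sum_insert ha, ih, zpow_add₀ (by norm_num)]
    rw [hz, he, zpow_zero]
  have hdisc : tdisc (Matrix.diagonal d) ≠ 0 := by
    rw [tdisc_diagonal]
    exact mul_ne_zero (Matrix.det_vandermonde_ne_zero_iff.2 hd)
      (Matrix.det_vandermonde_ne_zero_iff.2 hd)
  refine ⟨⟨(Matrix.diagonal d).map (algebraMap ℚ K), ?_⟩, ?_⟩
  · rw [← RingHom.mapMatrix_apply, ← RingHom.map_det, hdet, map_one]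
  · change tdisc ((Matrix.diagonal d).map (algebraMap ℚ K)) ≠ 0
    rw [tdisc_map]
    exact (map_ne_zero _).2 hdisc

variable [Finite K]

theorem card_units_mul_centralizer_le (hn : 1 ≤ n) (h : Matrix (Fin n) (Fin n) K) (v : Fin n → K)
    (hv : (krylov h v).det ≠ 0) :
    (Nat.card K - 1) * {x : Matrix.SpecialLinearGroup (Fin n) K |
      (x : Matrix (Fin n) (Fin n) K) * h = h * (x : Matrix (Fin n) (Fin n) K)}.ncard
      ≤ n * Nat.card K ^ n := by
  classical
  cases nonempty_fintype K
  have hU : Nat.card K - 1 = Nat.card Kˣ := by rw [Nat.card_units]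
  set S := {x : Matrix.SpecialLinearGroup (Fin n) K |
      (x : Matrix (Fin n) (Fin n) K) * h = h * (x : Matrix (Fin n) (Fin n) K)}
  have hS : S.ncard = S.toFinset.card := by rw [Set.ncard_eq_toFinset_card']
  rw [hU, hS, Nat.card_eq_fintype_card, ← Finset.card_univ, ← Finset.card_product]
  have hK : Nat.card K ^ n = (Finset.univ : Finset (Fin n → K)).card := by
    rw [Finset.card_univ, Fintype.card_fun, Fintype.card_fin, Nat.card_eq_fintype_card]
  rw [hK]
  let φ : Kˣ × Matrix.SpecialLinearGroup (Fin n) K → (Fin n → K) := fun z =>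
    ((z.1 : K) • (z.2 : Matrix (Fin n) (Fin n) K)).mulVec v
  refine Finset.card_le_mul_card_image_of_maps_to (f := φ) (fun _ _ => Finset.mem_univ _) n ?_
  intro b _
  by_cases hb : ∃ z ∈ (Finset.univ : Finset Kˣ) ×ˢ S.toFinset, φ z = b
  · obtain ⟨⟨c₀, x₀⟩, hz₀, rfl⟩ := hb
    have key : ∀ z ∈ ((Finset.univ : Finset Kˣ) ×ˢ S.toFinset).filter
        (fun z => φ z = φ (c₀, x₀)),
        (z.1 : K) • (z.2 : Matrix (Fin n) (Fin n) K) = (c₀ : K) • (x₀ : Matrix (Fin n) (Fin n) K) := by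
      rintro ⟨c, x⟩ hz
      simp only [Finset.mem_filter, Finset.mem_product, Finset.mem_univ, true_and,
        Set.mem_toFinset] at hz hz₀
      rw [← sub_eq_zero]
      apply eq_zero_of_mulVec_eq_zero hv
      · rw [sub_mul, mul_sub, Matrix.smul_mul, Matrix.smul_mul, Matrix.mul_smul, Matrix.mul_smul,
          hz.1, hz₀]
      · rw [Matrix.sub_mulVec, sub_eq_zero]
        exact hz.2
    refine le_trans (Finset.card_le_card_of_injOn (fun z => (z.1 : K))
      (t := (Polynomial.nthRoots n ((c₀ : K) ^ n)).toFinset) ?_ ?_) ?_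
    · rintro ⟨c, x⟩ hz
      have := congrArg Matrix.det (key _ hz)
      rw [Matrix.det_smul, Matrix.det_smul, x.2, x₀.2] at this
      simp only [mul_one, Fintype.card_fin] at this
      simp only [Finset.mem_coe, Multiset.mem_toFinset]
      rw [Polynomial.mem_nthRoots (by omega)]
      exact this
    · rintro ⟨c, x⟩ hz ⟨c', x'⟩ hz' e
      have e' : c = c' := Units.ext e
      subst e'
      have := (key _ hz).trans (key _ hz').symm
      have hx : (x : Matrix (Fin n) (Fin n) K) = x' := smul_right_injective _ c.ne_zero this
      exact Prod.ext rfl (Subtype.ext hx)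
    · exact (Multiset.toFinset_card_le _).trans (Polynomial.card_nthRoots _ _)
  · rw [Finset.filter_eq_empty_iff.2 (fun z hz e => hb ⟨z, hz, e⟩)]
    simp

theorem card_SL_ge : Nat.card K ^ (n * n) ≤
    2 ^ n * ((Nat.card K - 1) * Nat.card (Matrix.SpecialLinearGroup (Fin n) K)) := by
  classical
  cases nonempty_fintype K
  set q := Nat.card K with hq
  have hq2 : 2 ≤ q := by
    rw [hq, Nat.card_eq_fintype_card]
    exact Fintype.one_lt_card
  have h1 : Nat.card (GL (Fin n) K) ≤ (q - 1) * Nat.card (Matrix.SpecialLinearGroup (Fin n) K) := by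
    have hU : q - 1 = Nat.card Kˣ := by rw [Nat.card_units]
    let f : GL (Fin n) K →* Kˣ := Matrix.GeneralLinearGroup.det
    have h3 : Nat.card (GL (Fin n) K) = Nat.card f.ker * f.ker.index := by
      rw [Subgroup.card_mul_index]
    rw [h3, mul_comm, hU]
    refine Nat.mul_le_mul ?_ ?_
    · rw [Subgroup.index_ker]
      exact Nat.card_le_card_of_injective _ Subtype.val_injective
    · apply Nat.card_le_card_of_injective
        (fun g : f.ker => (⟨(g.1 : Matrix (Fin n) (Fin n) K), by
          have := g.2
          rw [MonoidHom.mem_ker] at this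
          exact congrArg Units.val this⟩ : Matrix.SpecialLinearGroup (Fin n) K))
      intro a b e
      exact Subtype.ext (Units.ext (congrArg Subtype.val e))
  have h2 : q ^ (n * n) ≤ 2 ^ n * Nat.card (GL (Fin n) K) := by
    rw [Matrix.card_GL_field, ← Nat.card_eq_fintype_card, ← hq]
    have : ∀ i : Fin n, q ^ n ≤ 2 * (q ^ n - q ^ (i : ℕ)) := by
      intro i
      have h4 : q ^ (i : ℕ) * 2 ≤ q ^ n := by
        calc q ^ (i : ℕ) * 2 ≤ q ^ (i : ℕ) * q := Nat.mul_le_mul_left _ hq2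
          _ = q ^ ((i : ℕ) + 1) := (pow_succ _ _).symm
          _ ≤ q ^ n := Nat.pow_le_pow_right (by omega) i.2
      omega
    calc q ^ (n * n) = ∏ _i : Fin n, q ^ n := by
          rw [Finset.prod_const, Finset.card_univ, Fintype.card_fin, ← pow_mul]
      _ ≤ ∏ i : Fin n, 2 * (q ^ n - q ^ (i : ℕ)) := Finset.prod_le_prod' fun i _ => this i
      _ = _ := by rw [Finset.prod_mul_distrib, Finset.prod_const, Finset.card_univ, Fintype.card_fin]
  calc _ ≤ _ := h2
    _ ≤ _ := Nat.mul_le_mul_left _ h1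

end Counting

section DoubleCount
variable {K : Type} [Field K] [Finite K] {n : ℕ}

theorem card_SL_mul_le (t₀ : Matrix.SpecialLinearGroup (Fin n) K)
    (ht₀ : tdisc (t₀ : Matrix (Fin n) (Fin n) K) ≠ 0)
    (R : Finset (Matrix.SpecialLinearGroup (Fin n) K)) (L M : ℕ)
    (hL : ∀ g : Matrix.SpecialLinearGroup (Fin n) K,
      L ≤ {h | h ∈ R ∧ Commute h (g * t₀ * g⁻¹)}.ncard)
    (hM : ∀ h ∈ R, {x : Matrix.SpecialLinearGroup (Fin n) K | Commute x h}.ncard ≤ M) :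
    Nat.card (Matrix.SpecialLinearGroup (Fin n) K) * L ≤ R.card * (M * n ^ n) := by
  classical
  cases nonempty_fintype K
  rw [Nat.card_eq_fintype_card, ← Finset.card_univ]
  apply Finset.card_mul_le_card_mul (fun g h => Commute h (g * t₀ * g⁻¹))
  · intro g _
    refine (hL g).trans_eq ?_
    rw [← Set.ncard_coe_finset]
    congr 1
    ext h
    simp
  · intro h hh
    set G := Finset.bipartiteBelow (fun g h => Commute h (g * t₀ * g⁻¹)) Finset.univ h with hG
    let T : Set (Matrix (Fin n) (Fin n) K) :=
      {x | x * (t₀ : Matrix (Fin n) (Fin n) K) = t₀ * x ∧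
        x.charpoly = (h : Matrix (Fin n) (Fin n) K).charpoly}
    have hT : T.toFinset.card ≤ n ^ n := by
      rw [← Set.ncard_eq_toFinset_card']
      exact ncard_commute_charpoly_le ht₀ _ (by simp)
    let φ : Matrix.SpecialLinearGroup (Fin n) K → Matrix (Fin n) (Fin n) K := fun g =>
      (g⁻¹ * h * g : Matrix.SpecialLinearGroup (Fin n) K)
    have hmaps : ∀ g ∈ G, φ g ∈ T.toFinset := by
      intro g hg
      rw [hG, Finset.mem_bipartiteBelow] at hg
      rw [Set.mem_toFinset]
      constructor
      · have h1 : g⁻¹ * h * g * t₀ = t₀ * (g⁻¹ * h * g) := by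
          have h2 := hg.2.eq
          calc g⁻¹ * h * g * t₀ = g⁻¹ * (h * (g * t₀ * g⁻¹)) * g := by group
            _ = g⁻¹ * ((g * t₀ * g⁻¹) * h) * g := by rw [h2]
            _ = _ := by group
        exact congrArg Subtype.val h1
      · change (g⁻¹ * h * g).1.charpoly = _
        have e1 : (g⁻¹ * h * g).1 = (g⁻¹ * h).1 * g.1 := rfl
        have e2 : g.1 * (g⁻¹ * h).1 = (g * (g⁻¹ * h)).1 := rfl
        rw [e1, Matrix.charpoly_mul_comm, e2, mul_inv_cancel_left]
    have hfib : ∀ x ∈ T.toFinset, (G.filter fun g => φ g = x).card ≤ M := by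
      intro x _
      by_cases hx : ∃ g₀ ∈ G, φ g₀ = x
      · obtain ⟨g₀, -, rfl⟩ := hx
        refine le_trans ?_ (hM h hh)
        rw [← Set.ncard_coe_finset]
        refine Set.ncard_le_ncard_of_injOn (fun g => g * g₀⁻¹) ?_ ?_ (Set.toFinite _)
        · intro g hg
          simp only [Finset.coe_filter, Set.mem_ofPred_eq] at hg
          have h2 : g⁻¹ * h * g = g₀⁻¹ * h * g₀ := Subtype.ext hg.2
          change g * g₀⁻¹ * h = h * (g * g₀⁻¹)
          calc g * g₀⁻¹ * h = g * (g₀⁻¹ * h * g₀) * g₀⁻¹ := by group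
            _ = g * (g⁻¹ * h * g) * g₀⁻¹ := by rw [h2]
            _ = _ := by group
        · intro a _ b _ e
          exact mul_right_cancel e
      · rw [Finset.filter_eq_empty_iff.2 fun g hg e => hx ⟨g, hg, e⟩]
        simp
    refine (Finset.card_le_mul_card_image_of_maps_to hmaps M hfib).trans ?_
    exact Nat.mul_le_mul_left _ hT

end DoubleCount

section Simplicity

open Matrix Matrix.SpecialLinearGroup

variable {F ι : Type*} [Field F] [Fintype ι] [DecidableEq ι]

lemma diag2n_eq_prod_transvections {i j : ι} (hij : i ≠ j) {a : F} (ha : a ≠ 0) :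
    diag2n hij a ha = transvection hij a * transvection hij.symm (-a⁻¹) * transvection hij a *
      transvection hij (-1) * transvection hij.symm 1 * transvection hij (-1) := by
  have hji : j ≠ i := hij.symm
  have h1 : ∀ b c : F, single i j b * single i j c = 0 := fun b c =>
    single_mul_single_of_ne _ _ _ _ hji _
  have h2 : ∀ b c : F, single j i b * single j i c = 0 := fun b c =>
    single_mul_single_of_ne _ _ _ _ hij _
  apply Subtype.ext
  simp only [coe_mul, transvection_coe, diag2n_coe, add_mul, mul_add, one_mul, mul_one,
    single_mul_single_same, h1, h2]
  ext x y
  by_cases hx : x = i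
  · subst hx
    by_cases hy : y = x
    · subst hy
      simp [hij, hji, ha]
    · by_cases hy' : y = j
      · subst hy'
        simp [hij, hji, ha]
      · simp [hij, hji, ha, Ne.symm hy, Ne.symm hy']
  · by_cases hx' : x = j
    · subst hx'
      by_cases hy : y = x
      · subst hy
        simp [hij, hji, ha]
      · by_cases hy' : y = i
        · subst hy'
          simp [hij, hji, ha]
        · simp [hij, hji, ha, Ne.symm hy, Ne.symm hy']
    · simp [single_apply, diagonal_apply, one_apply, hx, hx', Ne.symm hx, Ne.symm hx']

lemma eq_top_of_transvection_mem [Nontrivial ι] (H : Subgroup (SpecialLinearGroup ι F))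
    (h : ∀ (i j : ι) (hij : i ≠ j) (a : F), transvection hij a ∈ H) : H = ⊤ := by
  refine (Subgroup.eq_top_iff' H).2 fun M => ?_
  refine diagonal_transvection_induction' (· ∈ H) M (fun i j hij c hc => ?_) h
    fun _ _ => mul_mem
  rw [diag2n_eq_prod_transvections hij hc]
  exact mul_mem (mul_mem (mul_mem (mul_mem (mul_mem (h _ _ _ _) (h _ _ _ _)) (h _ _ _ _))
    (h _ _ _ _)) (h _ _ _ _)) (h _ _ _ _)

open scoped commutatorElement in
lemma commutator_SL_eq_top [Nontrivial ι] [CharZero F] :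
    commutator (SpecialLinearGroup ι F) = ⊤ := by
  refine eq_top_of_transvection_mem _ fun i j hij c => ?_
  have h2 : (2 : F) ≠ 0 := two_ne_zero
  have key : ∀ b : F, diag2n hij 2 h2 * transvection hij b =
      transvection hij (4 * b) * diag2n hij 2 h2 := by
    intro b
    have e1 : ∀ d : ι → F, diagonal d * single i j b = single i j (d i * b) := by
      intro d; ext x y
      rw [diagonal_mul]
      by_cases hx : i = x <;> simp [single_apply, hx]
    have e2 : ∀ d : ι → F, single i j (4 * b) * diagonal d = single i j (4 * b * d j) := by
      intro d; ext x y
      rw [mul_diagonal]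
      by_cases hx : j = y <;> simp [single_apply, hx]
    apply Subtype.ext
    simp only [coe_mul, transvection_coe, diag2n_coe, add_mul, mul_add, one_mul, mul_one, e1, e2]
    simp only [hij.symm, if_true, if_false]
    congr 2
    field_simp
    ring
  have hc : ⁅diag2n hij 2 h2, transvection hij (c / 3)⁆ = transvection hij c := by
    rw [commutatorElement_def, key, mul_inv_cancel_right, transvection_inv, ← transvection_add]
    congr 1
    ring
  rw [← hc]
  exact Subgroup.commutator_mem_commutator (Subgroup.mem_top _) (Subgroup.mem_top _)

open scoped LinearAlgebra.Projectivization in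
/-- The Iwasawa structure on `SL` acting on projective space. -/
noncomputable abbrev iwasawaSL [Nontrivial ι] :
    MulAction.IwasawaStructure (SpecialLinearGroup ι F) (ℙ F (ι → F)) where
  T p := lineStab p.submodule
  is_comm p := by
    rw [← Projectivization.mk_rep p, Projectivization.submodule_mk]
    exact lineStab_isMulCommutative_of_span p.rep p.rep_nonzero
  is_conj g p := by
    rw [PSL.smul_submodule, lineStab_smul]
  is_generator := by
    refine eq_top_of_transvection_mem _ fun i j hij a => ?_
    have h := SL2Gen.transvection_mem_lineStab hij a
    rw [← Projectivization.submodule_mk (K := F) _ (Pi.single_ne_zero_iff.2 one_ne_zero)] at h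
    exact Subgroup.mem_iSup_of_mem _ h

open scoped LinearAlgebra.Projectivization in
lemma normal_eq_top [Nontrivial ι] [CharZero F] (N : Subgroup (SpecialLinearGroup ι F))
    [N.Normal] (hN : ¬ N ≤ Subgroup.center _) : N = ⊤ := by
  rw [eq_top_iff, ← commutator_SL_eq_top]
  refine iwasawaSL.commutator_le N fun h => hN fun g hg => ?_
  rw [← Projectivization.SL_mulAction_ker, MonoidHom.mem_ker]
  ext x
  have hx : x ∈ MulAction.fixedPoints N (ℙ F (ι → F)) := h ▸ Set.mem_univ x
  exact hx ⟨g, hg⟩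

lemma finite_center_SL [Nonempty ι] : ((Subgroup.center (SpecialLinearGroup ι F) : Subgroup _) :
    Set (SpecialLinearGroup ι F)).Finite := by
  obtain ⟨i⟩ := ‹Nonempty ι›
  have : NeZero (Fintype.card ι) := ⟨Fintype.card_ne_zero⟩
  have : Finite (rootsOfUnity (Fintype.card ι) F) := inferInstance
  have : Finite (Subgroup.center (SpecialLinearGroup ι F)) :=
    Finite.of_equiv _ (center_equiv_rootsOfUnity' (R := F) i).symm.toEquiv
  exact Set.toFinite _

end Simplicity

section Ultra
open MvPolynomial

variable {K : ℕ → Type} [∀ i, Field (K i)] {F : Type} [Field F]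

/-- `u` exhibits `F` as the ultraproduct of the fields `K i` along `𝒰`. -/
structure IsUltra (𝒰 : Ultrafilter ℕ) (u : (∀ i, K i) →+* F) : Prop where
  surj : Function.Surjective u
  eq_zero_iff : ∀ f, u f = 0 ↔ ∀ᶠ i in 𝒰, f i = 0

theorem exists_isUltra (𝒰 : Ultrafilter ℕ) (K : ℕ → Type) [∀ i, Field (K i)] :
    ∃ (F : Type) (_ : Field F) (u : (∀ i, K i) →+* F), IsUltra 𝒰 u := by
  classical
  let J : Ideal (∀ i, K i) :=
    { carrier := {f | ∀ᶠ i in 𝒰, f i = 0}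
      add_mem' := fun {f g} hf hg => by
        filter_upwards [hf, hg] with i h1 h2
        simp [h1, h2]
      zero_mem' := Filter.Eventually.of_forall fun i => rfl
      smul_mem' := fun c f hf => by
        filter_upwards [hf] with i h1
        simp [h1] }
  have memJ : ∀ f, f ∈ J ↔ ∀ᶠ i in 𝒰, f i = 0 := fun f => Iff.rfl
  have hJ : J.IsMaximal := by
    rw [Ideal.isMaximal_iff]
    constructor
    · rw [memJ]
      intro h
      obtain ⟨i, hi⟩ := h.exists
      exact one_ne_zero hi
    · intro I f hle hf hfI
      rw [memJ, Ultrafilter.eventually_not.symm] at hf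
      have h1 : (fun i => (f i)⁻¹) * f ∈ I := I.mul_mem_left _ hfI
      have h2 : 1 - (fun i => (f i)⁻¹) * f ∈ I := by
        apply hle
        rw [memJ]
        filter_upwards [hf] with i hi
        simp [inv_mul_cancel₀ hi]
      simpa using I.add_mem h2 h1
  let fld : Field ((∀ i, K i) ⧸ J) := Ideal.Quotient.field J
  exact ⟨(∀ i, K i) ⧸ J, fld, Ideal.Quotient.mk J, @IsUltra.mk K _ _ fld 𝒰 _
    Ideal.Quotient.mk_surjective fun f => Ideal.Quotient.eq_zero_iff_mem.trans (memJ f)⟩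

theorem eventually_forall_of_forall_seq {𝒰 : Ultrafilter ℕ} {α : ℕ → Type*} [∀ i, Nonempty (α i)]
    {P : ∀ i, α i → Prop} (h : ∀ x : ∀ i, α i, ∀ᶠ i in 𝒰, P i (x i)) :
    ∀ᶠ i in 𝒰, ∀ a, P i a := by
  classical
  let x : ∀ i, α i := fun i => if h : ∃ a, ¬ P i a then h.choose else Classical.arbitrary _
  filter_upwards [h x] with i hi a
  by_contra ha
  have hex : ∃ a, ¬ P i a := ⟨a, ha⟩
  simp only [x, dif_pos hex] at hi
  exact hex.choose_spec hi

theorem exists_seq_of_eventually {𝒰 : Ultrafilter ℕ} {α : ℕ → Type*} [∀ i, Nonempty (α i)]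
    {P : ∀ i, α i → Prop} (h : ∀ᶠ i in 𝒰, ∃ a, P i a) : ∃ x : ∀ i, α i, ∀ᶠ i in 𝒰, P i (x i) := by
  classical
  refine ⟨fun i => if h : ∃ a, P i a then h.choose else Classical.arbitrary _, ?_⟩
  filter_upwards [h] with i hi
  simp only [dif_pos hi]
  exact hi.choose_spec

variable {𝒰 : Ultrafilter ℕ} {u : (∀ i, K i) →+* F}

theorem IsUltra.eq_iff (hu : IsUltra 𝒰 u) (f g : ∀ i, K i) : u f = u g ↔ ∀ᶠ i in 𝒰, f i = g i := by
  rw [← sub_eq_zero, ← map_sub, hu.eq_zero_iff]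
  simp [sub_eq_zero]

theorem IsUltra.ne_zero_iff (hu : IsUltra 𝒰 u) (f : ∀ i, K i) :
    u f ≠ 0 ↔ ∀ᶠ i in 𝒰, f i ≠ 0 := by
  rw [Ne, hu.eq_zero_iff, Ultrafilter.eventually_not]

theorem IsUltra.charZero (hu : IsUltra 𝒰 u)
    (h : ∀ m : ℕ, m ≠ 0 → ∀ᶠ i in 𝒰, (m : K i) ≠ 0) : CharZero F := by
  refine charZero_of_inj_zero fun m hm => ?_
  by_contra hm0
  have h1 : u (m : ∀ i, K i) = 0 := by rw [map_natCast, hm]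
  rw [hu.eq_zero_iff] at h1
  obtain ⟨i, hi, hi'⟩ := (h1.and (h m hm0)).exists
  exact hi' (by simpa using hi)

/-- The point of affine space over the ultraproduct given by a sequence of points. -/
def upt (u : (∀ i, K i) →+* F) {σ : Type} (x : ∀ i, σ → K i) : σ → F :=
  fun s => u fun i => x i s

theorem exists_aeval_upt (hu : IsUltra 𝒰 u) {σ : Type} (p : MvPolynomial σ F) :
    ∃ q : ∀ i, MvPolynomial σ (K i), ∀ x : ∀ i, σ → K i,
      aeval (upt u x) p = u fun i => aeval (x i) (q i) := by
  obtain ⟨P, rfl⟩ := MvPolynomial.map_surjective u hu.surj p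
  refine ⟨fun i => MvPolynomial.map (Pi.evalRingHom K i) P, fun x => ?_⟩
  have h : (fun i => aeval (x i) (MvPolynomial.map (Pi.evalRingHom K i) P)) =
      eval (fun s i => x i s) P := by
    funext i
    have := (eval₂_comp_left (Pi.evalRingHom K i) (RingHom.id _) (fun s i => x i s) P).symm
    rw [aeval_def, eval₂_map]
    exact this
  rw [h, aeval_def, eval₂_map, ← eval₂_id, eval₂_comp_left u]
  rfl

/-- Sets of points that are ultraproducts of sets. -/
def Internal (𝒰 : Ultrafilter ℕ) (u : (∀ i, K i) →+* F) {σ : Type} (X : Set (σ → F)) : Prop :=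
  ∃ Z : ∀ i, Set (σ → K i), ∀ x, upt u x ∈ X ↔ ∀ᶠ i in 𝒰, x i ∈ Z i

theorem Internal.inter {σ : Type} {X Y : Set (σ → F)} (hX : Internal 𝒰 u X)
    (hY : Internal 𝒰 u Y) : Internal 𝒰 u (X ∩ Y) := by
  obtain ⟨Z, hZ⟩ := hX
  obtain ⟨Z', hZ'⟩ := hY
  refine ⟨fun i => Z i ∩ Z' i, fun x => ?_⟩
  rw [Set.mem_inter_iff, hZ, hZ', ← Filter.eventually_and]
  rfl

theorem internal_zero (hu : IsUltra 𝒰 u) {σ : Type} (p : MvPolynomial σ F) :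
    Internal 𝒰 u {x | aeval x p = 0} := by
  obtain ⟨q, hq⟩ := exists_aeval_upt hu p
  refine ⟨fun i => {x | aeval x (q i) = 0}, fun x => ?_⟩
  rw [Set.mem_ofPred_eq, hq, hu.eq_zero_iff]
  rfl

theorem internal_zcl (hu : IsUltra 𝒰 u) {σ : Type} [Finite σ] (X : Set (σ → F)) :
    Internal 𝒰 u (zcl X) := by
  classical
  obtain ⟨s, hs⟩ := (isNoetherianRing_iff_ideal_fg (MvPolynomial σ F)).1 inferInstance
    (vanishingIdeal F X)
  have key : zcl X = {x | ∀ p ∈ s, aeval x p = 0} := by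
    ext x
    constructor
    · intro hx p hp
      exact hx p (hs ▸ Ideal.subset_span hp)
    · intro hx p hp
      rw [← hs] at hp
      exact Submodule.span_induction (p := fun p _ => aeval x p = 0) (fun p hp => hx p hp)
        (map_zero _) (fun p q _ _ h1 h2 => by rw [map_add, h1, h2, add_zero])
        (fun a p _ h => by rw [smul_eq_mul, map_mul, h, mul_zero]) hp
  rw [key]
  clear hs key
  induction s using Finset.induction_on with
  | empty => exact ⟨fun i => Set.univ, by simp⟩
  | insert p s _ ih =>
    convert (internal_zero hu p).inter ih using 1
    ext x
    simp

theorem zcl_singleton {σ : Type} (x : σ → F) : zcl {x} = {x} := by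
  refine Set.Subset.antisymm (fun y hy => ?_) (subset_zcl _)
  funext s
  have := hy (X s - C (x s)) (by intro z hz; rw [Set.mem_singleton_iff.1 hz]; simp)
  simpa [sub_eq_zero] using this

variable {n : ℕ}

/-- A sequence of elements of special linear groups, as a matrix over the product ring. -/
def slPi (g : ∀ i, Matrix.SpecialLinearGroup (Fin n) (K i)) :
    Matrix.SpecialLinearGroup (Fin n) (∀ i, K i) :=
  ⟨Matrix.of fun x y i => g i x y, by
    funext i
    exact ((Pi.evalRingHom K i).map_det (Matrix.of fun x y i => g i x y)).trans (g i).2⟩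

theorem slPi_apply (g : ∀ i, Matrix.SpecialLinearGroup (Fin n) (K i)) (x y : Fin n) (i : ℕ) :
    slPi g x y i = g i x y := rfl

/-- The ultraproduct of a sequence of elements of special linear groups. -/
noncomputable def usl (u : (∀ i, K i) →+* F) :
    (∀ i, Matrix.SpecialLinearGroup (Fin n) (K i)) →* Matrix.SpecialLinearGroup (Fin n) F :=
  (Matrix.SpecialLinearGroup.map u).comp
    { toFun := slPi
      map_one' := by
        ext x y i
        rw [slPi_apply]
        by_cases h : x = y
        · subst h; simp
        · simp [h]
      map_mul' := fun g h => by
        ext x y i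
        rw [slPi_apply, Matrix.SpecialLinearGroup.coe_mul, Pi.mul_apply,
          Matrix.SpecialLinearGroup.coe_mul, Matrix.mul_apply, Matrix.mul_apply, Finset.sum_apply]
        rfl }

theorem usl_apply (g : ∀ i, Matrix.SpecialLinearGroup (Fin n) (K i)) (x y : Fin n) :
    usl u g x y = u fun i => g i x y := rfl

theorem slpt_usl (g : ∀ i, Matrix.SpecialLinearGroup (Fin n) (K i)) :
    slpt (usl u g) = upt u fun i => slpt (g i) := rfl

theorem usl_surjective (hu : IsUltra 𝒰 u) : Function.Surjective (usl (n := n) u) := by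
  classical
  intro h
  choose m hm using fun x y => hu.surj (h x y)
  have hdet : ∀ᶠ i in 𝒰, (Matrix.of fun x y => m x y i).det = 1 := by
    have h1 : u (Matrix.of fun x y => m x y).det = 1 := by
      rw [RingHom.map_det, ← h.2]
      congr 1
      ext x y
      exact hm x y
    rw [← map_one u, hu.eq_iff] at h1
    filter_upwards [h1] with i hi
    have := (Pi.evalRingHom K i).map_det (Matrix.of fun x y => m x y)
    exact this.symm.trans hi
  obtain ⟨g, hg⟩ := exists_seq_of_eventually (𝒰 := 𝒰)
    (P := fun i (g : Matrix.SpecialLinearGroup (Fin n) (K i)) => ∀ x y, g x y = m x y i)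
    (hdet.mono fun i hi => ⟨⟨_, hi⟩, fun x y => rfl⟩)
  refine ⟨g, ?_⟩
  ext x y
  rw [usl_apply, ← hm, hu.eq_iff]
  filter_upwards [hg] with i hi using hi x y

theorem usl_eq_iff (hu : IsUltra 𝒰 u) (g h : ∀ i, Matrix.SpecialLinearGroup (Fin n) (K i)) :
    usl u g = usl u h ↔ ∀ᶠ i in 𝒰, g i = h i := by
  constructor
  · intro e
    have : ∀ x y, ∀ᶠ i in 𝒰, g i x y = h i x y := fun x y => by
      rw [← hu.eq_iff, ← usl_apply, ← usl_apply, e]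
    have h2 : ∀ᶠ i in 𝒰, ∀ x y, g i x y = h i x y := by
      rw [Filter.eventually_all]; intro x
      rw [Filter.eventually_all]; exact this x
    filter_upwards [h2] with i hi
    ext x y; exact hi x y
  · intro e
    ext x y
    rw [usl_apply, usl_apply, hu.eq_iff]
    filter_upwards [e] with i hi
    rw [hi]

end Ultra

section Exponent
open Filter

/-- `N i` is at most `a i ^ (e + o(1))` along `𝒰`. -/
def ExpLE (𝒰 : Ultrafilter ℕ) (a : ℕ → ℝ) (N : ℕ → ℝ) (e : ℝ) : Prop :=
  ∀ η : ℝ, 0 < η → ∀ᶠ i in 𝒰, N i ≤ a i ^ (e + η)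

variable {𝒰 : Ultrafilter ℕ} {a : ℕ → ℝ} {N M : ℕ → ℝ} {e f : ℝ}

theorem ExpLE.mono (h : ExpLE 𝒰 a N e) (hNM : ∀ᶠ i in 𝒰, M i ≤ N i) : ExpLE 𝒰 a M e := by
  intro η hη
  filter_upwards [h η hη, hNM] with i h1 h2 using h2.trans h1

theorem ExpLE.mono_exp (ha : Tendsto a 𝒰 atTop) (h : ExpLE 𝒰 a N e) (hef : e ≤ f) :
    ExpLE 𝒰 a N f := by
  intro η hη
  filter_upwards [h η hη, ha.eventually_ge_atTop 1] with i h1 h2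
  exact h1.trans (Real.rpow_le_rpow_of_exponent_le h2 (by linarith))

theorem ExpLE.add (ha : Tendsto a 𝒰 atTop) (hN : ExpLE 𝒰 a N e) (hM : ExpLE 𝒰 a M e) :
    ExpLE 𝒰 a (fun i => N i + M i) e := by
  intro η hη
  have h2 : ∀ᶠ i in 𝒰, 2 ≤ a i ^ (η / 2) :=
    ((tendsto_rpow_atTop (half_pos hη)).comp ha).eventually_ge_atTop 2
  filter_upwards [hN (η / 2) (half_pos hη), hM (η / 2) (half_pos hη), h2,
    ha.eventually_ge_atTop 1] with i h1 h2 h3 h4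
  have : a i ^ (e + η) = a i ^ (e + η / 2) * a i ^ (η / 2) := by
    rw [← Real.rpow_add (by linarith)]; congr 1; ring
  rw [this]
  have h5 : 0 ≤ a i ^ (e + η / 2) := Real.rpow_nonneg (by linarith) _
  nlinarith

theorem ExpLE.mul (ha : Tendsto a 𝒰 atTop) (hN : ExpLE 𝒰 a N e) (hM : ExpLE 𝒰 a M f)
    (hM0 : ∀ i, 0 ≤ M i) : ExpLE 𝒰 a (fun i => N i * M i) (e + f) := by
  intro η hη
  filter_upwards [hN (η / 2) (half_pos hη), hM (η / 2) (half_pos hη),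
    ha.eventually_ge_atTop 1] with i h1 h2 h4
  have : a i ^ (e + f + η) = a i ^ (e + η / 2) * a i ^ (f + η / 2) := by
    rw [← Real.rpow_add (by linarith)]; congr 1; ring
  rw [this]
  exact mul_le_mul h1 h2 (hM0 i) (Real.rpow_nonneg (by linarith) _)

theorem expLE_const (ha : Tendsto a 𝒰 atTop) (c : ℝ) : ExpLE 𝒰 a (fun _ => c) 0 := by
  intro η hη
  rw [zero_add]
  exact ((tendsto_rpow_atTop hη).comp ha).eventually_ge_atTop c

theorem ExpLE.one_le (ha : Tendsto a 𝒰 atTop) (h : ExpLE 𝒰 a a e) : 1 ≤ e := by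
  by_contra he
  push Not at he
  obtain ⟨i, h1, h2⟩ := ((h ((1 - e) / 2) (by linarith)).and (ha.eventually_gt_atTop 1)).exists
  have := Real.rpow_lt_rpow_of_exponent_lt h2 (show e + (1 - e) / 2 < 1 by linarith)
  rw [Real.rpow_one] at this
  linarith

theorem ncard_le_mul_of_fibres {α β : Type*} [Finite α] (E : Set α) (g : α → β) (L : ℕ)
    (h : ∀ y ∈ g '' E, {x | x ∈ E ∧ g x = y}.ncard ≤ L) : E.ncard ≤ (g '' E).ncard * L := by
  classical
  have := Fintype.ofFinite α
  have hE : E.Finite := E.toFinite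
  have := Finset.card_le_mul_card_image (f := g) hE.toFinset L (fun b hb => by
    have hb' : b ∈ g '' E := by simpa using hb
    refine le_trans (le_of_eq ?_) (h b hb')
    rw [← Set.ncard_coe_finset]
    congr 1
    ext x; simp)
  rw [Set.ncard_eq_toFinset_card E hE]
  refine this.trans (le_of_eq ?_)
  rw [mul_comm, ← Set.ncard_coe_finset, Finset.coe_image, Set.Finite.coe_toFinset]

theorem ExpLE.fibre (ha : Tendsto a 𝒰 atTop) {α β : ℕ → Type*} [∀ i, Finite (α i)]
    [∀ i, Nonempty (β i)]
    (E : ∀ i, Set (α i)) (g : ∀ i, α i → β i)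
    (h1 : ExpLE 𝒰 a (fun i => ((g i '' E i).ncard : ℝ)) e)
    (h2 : ∀ y : ∀ i, β i, (∀ᶠ i in 𝒰, y i ∈ g i '' E i) →
      ExpLE 𝒰 a (fun i => ({x | x ∈ E i ∧ g i x = y i}.ncard : ℝ)) f) :
    ExpLE 𝒰 a (fun i => ((E i).ncard : ℝ)) (e + f) := by
  classical
  by_cases hne : ∀ᶠ i in 𝒰, (E i).Nonempty
  · have hmax : ∀ i, (E i).Nonempty → ∃ y ∈ g i '' E i, ∀ z ∈ g i '' E i,
        {x | x ∈ E i ∧ g i x = z}.ncard ≤ {x | x ∈ E i ∧ g i x = y}.ncard := fun i hi =>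
      Set.exists_max_image _ _ ((E i).toFinite.image _) (hi.image _)
    let y : ∀ i, β i := fun i => if h : (E i).Nonempty then (hmax i h).choose
      else Classical.arbitrary _
    have hy : ∀ᶠ i in 𝒰, y i ∈ g i '' E i ∧ ∀ z ∈ g i '' E i,
        {x | x ∈ E i ∧ g i x = z}.ncard ≤ {x | x ∈ E i ∧ g i x = y i}.ncard := by
      filter_upwards [hne] with i hi
      simp only [y, dif_pos hi]
      exact (hmax i hi).choose_spec
    refine (h1.mul ha (h2 y (hy.mono fun i h => h.1)) fun i => Nat.cast_nonneg _).mono ?_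
    filter_upwards [hy] with i hi
    exact_mod_cast ncard_le_mul_of_fibres (E i) (g i) _ hi.2
  · rw [← Ultrafilter.eventually_not] at hne
    intro η hη
    filter_upwards [hne, ha.eventually_ge_atTop 1] with i hi h1
    rw [Set.not_nonempty_iff_eq_empty.1 hi]
    simpa using Real.rpow_nonneg (by linarith) _

end Exponent

section Approx
open Filter MvPolynomial

variable {K : ℕ → Type} [∀ i, Field (K i)] {F : Type} [Field F] {n : ℕ}

/-- A sequence of symmetric generating sets of `SL n (K i)` of subpolynomial growth. -/
structure Approx (𝒰 : Ultrafilter ℕ) (u : (∀ i, K i) →+* F)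
    (B : ∀ i, Set (Matrix.SpecialLinearGroup (Fin n) (K i))) : Prop where
  ultra : IsUltra 𝒰 u
  one_mem : ∀ i, 1 ∈ B i
  inv_mem : ∀ i, ∀ g ∈ B i, g⁻¹ ∈ B i
  closure : ∀ i, Subgroup.closure (B i) = ⊤
  tendsto : Tendsto (fun i => ((B i).ncard : ℝ)) 𝒰 atTop
  growth : ∀ k : ℕ, ExpLE 𝒰 (fun i => ((B i).ncard : ℝ)) (fun i => ((B i ^ k).ncard : ℝ)) 1

/-- Sets in a bounded power of `B` that land in `X` have size at most `|B| ^ (e + o(1))`. -/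
def Bound (𝒰 : Ultrafilter ℕ) (u : (∀ i, K i) →+* F)
    (B : ∀ i, Set (Matrix.SpecialLinearGroup (Fin n) (K i))) (X : Set (Fin n × Fin n → F))
    (e : ℝ) : Prop :=
  ∀ (k : ℕ) (S : ∀ i, Set (Matrix.SpecialLinearGroup (Fin n) (K i))),
    (∀ᶠ i in 𝒰, S i ⊆ B i ^ k) → (∀ g, (∀ᶠ i in 𝒰, g i ∈ S i) → slpt (usl u g) ∈ X) →
    ExpLE 𝒰 (fun i => ((B i).ncard : ℝ)) (fun i => ((S i).ncard : ℝ)) e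

variable {𝒰 : Ultrafilter ℕ} {u : (∀ i, K i) →+* F}
  {B : ∀ i, Set (Matrix.SpecialLinearGroup (Fin n) (K i))} {X Y : Set (Fin n × Fin n → F)}
  {e f : ℝ}

theorem Approx.pow_mono (h : Approx 𝒰 u B) (i : ℕ) {k l : ℕ} (hkl : k ≤ l) :
    B i ^ k ⊆ B i ^ l := Set.pow_subset_pow_right (h.one_mem i) hkl

theorem Approx.inv_mem_pow (h : Approx 𝒰 u B) (i : ℕ) (k : ℕ)
    {g : Matrix.SpecialLinearGroup (Fin n) (K i)} (hg : g ∈ B i ^ k) : g⁻¹ ∈ B i ^ k := by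
  have hB : (B i)⁻¹ = B i := by
    apply Set.Subset.antisymm
    · intro x hx
      simpa using h.inv_mem i _ (Set.mem_inv.1 hx)
    · intro x hx
      exact Set.mem_inv.2 (h.inv_mem i x hx)
  have h1 := Set.inv_mem_inv.2 hg
  rwa [← inv_pow, hB] at h1

theorem Approx.exists_mem_pow (h : Approx 𝒰 u B) (i : ℕ) [Finite (K i)]
    (g : Matrix.SpecialLinearGroup (Fin n) (K i)) : ∃ k, g ∈ B i ^ k := by
  have hg : g ∈ Subgroup.closure (B i) := h.closure i ▸ Subgroup.mem_top g
  induction hg using Subgroup.closure_induction with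
  | mem x hx => exact ⟨1, by simpa using hx⟩
  | one => exact ⟨0, by simp⟩
  | mul x y _ _ hx hy =>
    obtain ⟨k, hk⟩ := hx
    obtain ⟨l, hl⟩ := hy
    exact ⟨k + l, by rw [pow_add]; exact Set.mul_mem_mul hk hl⟩
  | inv x _ hx =>
    obtain ⟨k, hk⟩ := hx
    exact ⟨k, h.inv_mem_pow i k hk⟩

theorem Bound.mono (h : Bound 𝒰 u B X e) (hYX : Y ⊆ X) : Bound 𝒰 u B Y e :=
  fun k S hS hSY => h k S hS fun g hg => hYX (hSY g hg)

theorem Bound.mono_exp (hB : Approx 𝒰 u B) (h : Bound 𝒰 u B X e) (hef : e ≤ f) :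
    Bound 𝒰 u B X f :=
  fun k S hS hSX => (h k S hS hSX).mono_exp hB.tendsto hef

theorem bound_one [∀ i, Finite (K i)] (hB : Approx 𝒰 u B) : Bound 𝒰 u B X 1 := by
  intro k S hS _
  refine (hB.growth k).mono ?_
  filter_upwards [hS] with i hi
  exact_mod_cast Set.ncard_le_ncard hi (Set.toFinite _)

theorem bound_empty (hB : Approx 𝒰 u B) : Bound 𝒰 u B ∅ e := by
  intro k S _ hSX
  have h : ∀ᶠ i in 𝒰, S i = ∅ := by
    by_contra h
    rw [← Ultrafilter.eventually_not] at h
    obtain ⟨g, hg⟩ := exists_seq_of_eventually (𝒰 := 𝒰) (P := fun i g => g ∈ S i)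
      (h.mono fun i hi => Set.nonempty_iff_ne_empty.2 hi)
    exact hSX g hg
  intro η _
  filter_upwards [h, hB.tendsto.eventually_ge_atTop 1] with i hi h1
  rw [hi]
  simpa using Real.rpow_nonneg (by linarith) _

theorem bound_union [∀ i, Finite (K i)] (hB : Approx 𝒰 u B) (hX : Internal 𝒰 u X)
    (h1 : Bound 𝒰 u B X e) (h2 : Bound 𝒰 u B Y e) : Bound 𝒰 u B (X ∪ Y) e := by
  obtain ⟨Z, hZ⟩ := hX
  intro k S hS hSX
  have e1 := h1 k (fun i => {g | g ∈ S i ∧ slpt g ∈ Z i}) (hS.mono fun i hi g hg => hi hg.1)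
    (fun g hg => by rw [slpt_usl, hZ]; exact hg.mono fun i hi => hi.2)
  have e2 := h2 k (fun i => {g | g ∈ S i ∧ slpt g ∉ Z i}) (hS.mono fun i hi g hg => hi hg.1)
    (fun g hg => by
      refine (hSX g (hg.mono fun i hi => hi.1)).resolve_left fun h => ?_
      rw [slpt_usl, hZ] at h
      obtain ⟨i, hi, hi'⟩ := (h.and hg).exists
      exact hi'.2 hi)
  refine (e1.add hB.tendsto e2).mono (Eventually.of_forall fun i => ?_)
  have : S i ⊆ {g | g ∈ S i ∧ slpt g ∈ Z i} ∪ {g | g ∈ S i ∧ slpt g ∉ Z i} := fun g hg => by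
    by_cases h : slpt g ∈ Z i
    · exact Or.inl ⟨hg, h⟩
    · exact Or.inr ⟨hg, h⟩
  exact_mod_cast (Set.ncard_le_ncard this (Set.toFinite _)).trans (Set.ncard_union_le _ _)

theorem bound_sUnion [∀ i, Finite (K i)] (hB : Approx 𝒰 u B) {𝒞 : Set (Set (Fin n × Fin n → F))}
    (hfin : 𝒞.Finite) (h : ∀ Z ∈ 𝒞, Internal 𝒰 u Z ∧ Bound 𝒰 u B Z e) :
    Bound 𝒰 u B (⋃₀ 𝒞) e := by
  induction 𝒞, hfin using Set.Finite.induction_on with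
  | empty => rw [Set.sUnion_empty]; exact bound_empty hB
  | insert _ _ ih =>
    rw [Set.sUnion_insert]
    exact bound_union hB (h _ (Set.mem_insert _ _)).1 (h _ (Set.mem_insert _ _)).2
      (ih fun Z hZ => h Z (Set.mem_insert_of_mem _ hZ))

theorem bound_of_irred [∀ i, Finite (K i)] (hB : Approx 𝒰 u B)
    (h : ∀ Z ⊆ X, IrredSet Z → Bound 𝒰 u B (zcl Z) e) : Bound 𝒰 u B X e := by
  obtain ⟨𝒞, hfin, hZ, hU⟩ := exists_irred_decomposition X
  have : Bound 𝒰 u B (⋃₀ (zcl '' 𝒞)) e := by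
    refine bound_sUnion hB (hfin.image _) ?_
    rintro _ ⟨Z, hZC, rfl⟩
    exact ⟨internal_zcl hB.ultra Z, h Z (hZ Z hZC).2 (hZ Z hZC).1⟩
  refine this.mono fun x hx => ?_
  rw [← hU] at hx
  obtain ⟨Z, hZC, hxZ⟩ := hx
  exact ⟨zcl Z, ⟨Z, hZC, rfl⟩, subset_zcl Z hxZ⟩

theorem bound_singleton [∀ i, Finite (K i)] (hB : Approx 𝒰 u B) (x : Fin n × Fin n → F) :
    Bound 𝒰 u B {x} 0 := by
  intro k S hS hSX
  refine (expLE_const hB.tendsto 1).mono ?_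
  have h : ∀ᶠ i in 𝒰, (S i).Subsingleton := by
    by_contra h
    rw [← Ultrafilter.eventually_not] at h
    obtain ⟨g, hg⟩ := exists_seq_of_eventually (𝒰 := 𝒰)
      (P := fun i (g : Matrix.SpecialLinearGroup (Fin n) (K i) ×
        Matrix.SpecialLinearGroup (Fin n) (K i)) => g.1 ∈ S i ∧ g.2 ∈ S i ∧ g.1 ≠ g.2)
      (h.mono fun i hi => by
        rw [Set.not_subsingleton_iff] at hi
        obtain ⟨x, hx, y, hy, hxy⟩ := hi
        exact ⟨(x, y), hx, hy, hxy⟩)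
    have e1 := hSX (fun i => (g i).1) (hg.mono fun i hi => hi.1)
    have e2 := hSX (fun i => (g i).2) (hg.mono fun i hi => hi.2.1)
    have e3 := slpt_injective ((Set.mem_singleton_iff.1 e1).trans (Set.mem_singleton_iff.1 e2).symm)
    rw [usl_eq_iff hB.ultra] at e3
    obtain ⟨i, hi, hi'⟩ := (e3.and hg).exists
    exact hi'.2.2 hi
  filter_upwards [h] with i hi
  exact_mod_cast (Set.ncard_le_one (Set.toFinite _)).2 fun a ha b hb => hi ha hb

/-- The elements of the ultraproduct represented in a bounded power of `B`. -/
def uPow (𝒰 : Ultrafilter ℕ) (u : (∀ i, K i) →+* F)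
    (B : ∀ i, Set (Matrix.SpecialLinearGroup (Fin n) (K i))) :
    Set (Matrix.SpecialLinearGroup (Fin n) F) :=
  {γ | ∃ (k : ℕ) (g : ∀ i, Matrix.SpecialLinearGroup (Fin n) (K i)),
    γ = usl u g ∧ ∀ᶠ i in 𝒰, g i ∈ B i ^ k}

theorem isPolyMap_mul_left (M : Matrix (Fin n) (Fin n) F) :
    IsPolyMap fun x : Fin n × Fin n → F => mv (M * vm x) :=
  ((IsPolyMat.const M).mul IsPolyMat.vm_id).mv

theorem Approx.dense [∀ i, Finite (K i)] (hB : Approx 𝒰 u B)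
    (h : Matrix.SpecialLinearGroup (Fin n) F) : slpt h ∈ zcl (slpt '' uPow 𝒰 u B) := by
  obtain ⟨Z, hZ⟩ := internal_zcl hB.ultra (slpt '' uPow 𝒰 u B)
  have h1 : ∀ᶠ i in 𝒰, slpt (1 : Matrix.SpecialLinearGroup (Fin n) (K i)) ∈ Z i := by
    rw [← hZ]
    refine subset_zcl _ ⟨usl u 1, ⟨0, 1, rfl, Eventually.of_forall fun i => by simp⟩, ?_⟩
    rw [slpt_usl]; rfl
  have h2 : ∀ᶠ i in 𝒰, ∀ q : Matrix.SpecialLinearGroup (Fin n) (K i) ×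
      Matrix.SpecialLinearGroup (Fin n) (K i), q.1 ∈ B i → slpt q.2 ∈ Z i →
        slpt (q.1 * q.2) ∈ Z i := by
    refine eventually_forall_of_forall_seq fun q => ?_
    by_contra hc
    rw [← Ultrafilter.eventually_not] at hc
    have e1 : ∀ᶠ i in 𝒰, (q i).1 ∈ B i := hc.mono fun i hi => by tauto
    have e2 : slpt (usl u fun i => (q i).2) ∈ zcl (slpt '' uPow 𝒰 u B) := by
      rw [slpt_usl, hZ]
      exact hc.mono fun i hi => by tauto
    have e3 : slpt (usl u fun i => (q i).1 * (q i).2) ∈ zcl (slpt '' uPow 𝒰 u B) := by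
      have e4 := zcl_preimage (isPolyMap_mul_left (usl u fun i => (q i).1).1)
        (X := slpt '' uPow 𝒰 u B) (Y := slpt '' uPow 𝒰 u B) (fun x hx => by
          obtain ⟨_, ⟨k, g, rfl, hg⟩, rfl⟩ := hx
          refine subset_zcl _ ⟨usl u ((fun i => (q i).1) * g), ⟨1 + k, _, rfl, ?_⟩, ?_⟩
          · filter_upwards [hg, e1] with i hi hi'
            rw [pow_add, pow_one]
            exact Set.mul_mem_mul hi' hi
          · rw [map_mul]; rfl) e2
      have : (fun i => (q i).1 * (q i).2) = (fun i => (q i).1) * fun i => (q i).2 := rfl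
      rw [this, map_mul]
      exact e4
    rw [slpt_usl, hZ] at e3
    obtain ⟨i, hi, hi'⟩ := (hc.and e3).exists
    tauto
  obtain ⟨g, rfl⟩ := usl_surjective hB.ultra h
  rw [slpt_usl, hZ]
  filter_upwards [h1, h2] with i hi1 hi2
  obtain ⟨k, hk⟩ := hB.exists_mem_pow i (g i)
  generalize g i = x at hk
  induction k generalizing x with
  | zero =>
    rw [pow_zero, Set.mem_one] at hk
    rw [hk]; exact hi1
  | succ k ih =>
    rw [pow_succ', Set.mem_mul] at hk
    obtain ⟨b, hb, y, hy, rfl⟩ := hk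
    exact hi2 (b, y) hb (ih y hy)

end Approx

section LarsenPink
open Filter MvPolynomial

variable {F : Type} [Field F] {n : ℕ}

@[simp] theorem vm_slpt (g : Matrix.SpecialLinearGroup (Fin n) F) : vm (slpt g) = g.1 := rfl

theorem slpt_eq_mv (g : Matrix.SpecialLinearGroup (Fin n) F) : slpt g = mv g.1 := rfl

theorem det_vm_of_mem_range {x : Fin n × Fin n → F}
    (hx : x ∈ Set.range (slpt (F := F) (n := n))) : (vm x).det = 1 := by
  obtain ⟨g, rfl⟩ := hx
  exact g.2

theorem zcl_subset_range_slpt {X : Set (Fin n × Fin n → F)} (hX : X ⊆ Set.range slpt) :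
    zcl X ⊆ Set.range slpt := by
  intro x hx
  obtain ⟨p, hp⟩ := (IsPolyMat.vm_id (F := F) (n := n)).det
  have h : (vm x).det = 1 := by
    have := mem_zcl.1 hx (p - C 1) fun y hy => by
      rw [map_sub, ← hp]; simp [det_vm_of_mem_range (hX hy)]
    rw [map_sub, ← hp] at this
    simpa [sub_eq_zero] using this
  exact ⟨(⟨vm x, h⟩ : Matrix.SpecialLinearGroup (Fin n) F), rfl⟩

/-- The map `(x, y) ↦ x * γ * y` on pairs of matrices. -/
def mulMid (γ : Matrix (Fin n) (Fin n) F) (z : (Fin n × Fin n) ⊕ (Fin n × Fin n) → F) :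
    Fin n × Fin n → F :=
  mv (vm (fun s => z (Sum.inl s)) * γ * vm fun s => z (Sum.inr s))

theorem isPolyMap_mulMid (γ : Matrix (Fin n) (Fin n) F) : IsPolyMap (mulMid γ) :=
  (((IsPolyMat.vm isPolyMap_inl).mul (IsPolyMat.const γ)).mul (IsPolyMat.vm isPolyMap_inr)).mv

theorem mulMid_slpt (γ v v' : Matrix.SpecialLinearGroup (Fin n) F) :
    mulMid γ.1 (Sum.elim (slpt v) (slpt v')) = slpt (v * γ * v') := rfl

section Closed
variable {V : Set (Fin n × Fin n → F)} {γ : Matrix.SpecialLinearGroup (Fin n) F}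

theorem isPolyMap_mul_mul (M N : Matrix (Fin n) (Fin n) F) :
    IsPolyMap fun x : Fin n × Fin n → F => mv (M * vm x * N) :=
  (((IsPolyMat.const M).mul IsPolyMat.vm_id).mul (IsPolyMat.const N)).mv

theorem mul_mul_mem_of_vdim_le (hV : IrredSet V) (hVS : V ⊆ Set.range slpt)
    (M N M' N' : Matrix.SpecialLinearGroup (Fin n) F) (W : Set (Fin n × Fin n → F))
    (hW : IrredSet W) (hMN : ∀ x, slpt x ∈ V → slpt (M * x * N) ∈ W) (hM : M' * M = 1)
    (hN : N * N' = 1) (hd : vdim W ≤ vdim V) {x : Matrix.SpecialLinearGroup (Fin n) F}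
    (hx : slpt x ∈ W) : slpt (M' * x * N') ∈ zcl V := by
  let φ : (Fin n × Fin n → F) → (Fin n × Fin n → F) := fun x => mv (M.1 * vm x * N.1)
  let ψ : (Fin n × Fin n → F) → (Fin n × Fin n → F) := fun x => mv (M'.1 * vm x * N'.1)
  have hφ : IsPolyMap φ := isPolyMap_mul_mul _ _
  have hψ : IsPolyMap ψ := isPolyMap_mul_mul _ _
  have hφs : ∀ g, φ (slpt g) = slpt (M * g * N) := fun g => by
    rw [slpt_eq_mv (M * g * N), Matrix.SpecialLinearGroup.coe_mul,
      Matrix.SpecialLinearGroup.coe_mul]; rfl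
  have hψs : ∀ g, ψ (slpt g) = slpt (M' * g * N') := fun g => by
    rw [slpt_eq_mv (M' * g * N'), Matrix.SpecialLinearGroup.coe_mul,
      Matrix.SpecialLinearGroup.coe_mul]; rfl
  have hψφ : ∀ x ∈ V, ψ (φ x) = x := by
    intro x hx
    obtain ⟨g, rfl⟩ := hVS hx
    rw [hφs, hψs]
    congr 1
    calc M' * (M * g * N) * N' = (M' * M) * g * (N * N') := by simp only [mul_assoc]
      _ = g := by rw [hM, hN, one_mul, mul_one]
  have h1 : IrredSet (φ '' V) := hV.image hφ
  have h2 : φ '' V ⊆ W := by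
    rintro _ ⟨x, hx, rfl⟩
    obtain ⟨g, rfl⟩ := hVS hx
    rw [hφs]
    exact hMN g hx
  have h3 : ψ '' (φ '' V) = V := by
    rw [Set.image_image]
    exact (Set.image_congr hψφ).trans (Set.image_id' V)
  have h4 : vdim W ≤ vdim (φ '' V) := hd.trans (by
    conv_lhs => rw [← h3]
    exact vdim_image_le hψ _)
  have h5 := h1.vanishingIdeal_eq hW (h2.trans (subset_zcl W)) h4
  have h6 : slpt x ∈ zcl (φ '' V) := zcl_mono_ideal h5.symm.le (subset_zcl _ hx)
  rw [← hψs]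
  exact zcl_preimage hψ (X := φ '' V) (fun y hy => by
    obtain ⟨z, hz, rfl⟩ := hy
    rw [hψφ z hz]; exact subset_zcl V hz) h6

end Closed

variable {K : ℕ → Type} [∀ i, Field (K i)] [∀ i, Finite (K i)]
variable {𝒰 : Ultrafilter ℕ} {u : (∀ i, K i) →+* F}
  {B : ∀ i, Set (Matrix.SpecialLinearGroup (Fin n) (K i))} {V : Set (Fin n × Fin n → F)}

/-- Irreducible subsets of `SL n` of dimension at most `r` satisfy the bound with exponent `e`. -/
def DimBound (𝒰 : Ultrafilter ℕ) (u : (∀ i, K i) →+* F)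
    (B : ∀ i, Set (Matrix.SpecialLinearGroup (Fin n) (K i))) (r : ℕ) (e : ℝ) : Prop :=
  ∀ X, IrredSet X → X ⊆ Set.range slpt → vdim X ≤ r → Bound 𝒰 u B (zcl X) e

theorem DimBound.mono_exp (hB : Approx 𝒰 u B) {r : ℕ} {e f : ℝ} (h : DimBound 𝒰 u B r e)
    (hef : e ≤ f) : DimBound 𝒰 u B r f :=
  fun X h1 h2 h3 => (h X h1 h2 h3).mono_exp hB hef

theorem DimBound.of_le {r : ℕ} {e : ℝ}
    (h : ∀ η > 0, DimBound 𝒰 u B r (e + η)) : DimBound 𝒰 u B r e := by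
  intro X h1 h2 h3 k S hS hSX η hη
  have := h (η / 2) (half_pos hη) X h1 h2 h3 k S hS hSX (η / 2) (half_pos hη)
  convert this using 4
  ring

theorem dimBound_zero (hB : Approx 𝒰 u B) : DimBound 𝒰 u B 0 0 := by
  intro X h1 _ h3
  obtain ⟨x, hx⟩ := h1.nonempty
  have := zcl_mono (h1.subset_singleton (by omega) hx)
  rw [zcl_singleton] at this
  exact (bound_singleton hB x).mono this

theorem DimBound.zeros (hB : Approx 𝒰 u B) {r : ℕ} {e : ℝ} (h : DimBound 𝒰 u B (r - 1) e)
    (hV : IrredSet V) (hVS : V ⊆ Set.range slpt) (hr : vdim V ≤ r)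
    (q : MvPolynomial (Fin n × Fin n) F) (hq : ∃ x ∈ V, aeval x q ≠ 0) :
    Bound 𝒰 u B {x | x ∈ V ∧ aeval x q = 0} e := by
  refine bound_of_irred hB fun Z hZ hZi => h Z hZi (fun z hz => hVS (hZ hz).1) ?_
  have := hZi.vdim_lt hV (fun z hz => (hZ hz).1) q (fun z hz => (hZ hz).2) hq
  omega

theorem elim_slpt_usl (g h : ∀ i, Matrix.SpecialLinearGroup (Fin n) (K i)) :
    Sum.elim (slpt (usl u g)) (slpt (usl u h)) =
      upt u fun i => Sum.elim (slpt (g i)) (slpt (h i)) := by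
  ext s; cases s <;> rfl

/-- Counting pairs in a fixed variety through the map `(x, y) ↦ x * γ * y`. -/
theorem pair_count (hB : Approx 𝒰 u B) (hV : IrredSet V) (hVS : V ⊆ Set.range slpt) {r : ℕ}
    (hr : vdim V ≤ r) {γ : Matrix.SpecialLinearGroup (Fin n) F} (hγ : γ ∈ uPow 𝒰 u B)
    {e1 e2 e3 e4 E : ℝ} (h1 : DimBound 𝒰 u B (r - 1) e1) (h2 : Bound 𝒰 u B V e2)
    (h3 : Bound 𝒰 u B (zcl (mulMid γ.1 '' prodSet V V)) e3)
    (h4 : DimBound 𝒰 u B (2 * r - vdim (mulMid γ.1 '' prodSet V V)) e4)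
    (hE1 : e1 + e2 ≤ E) (hE2 : e3 + e4 ≤ E) (k : ℕ)
    (S : ∀ i, Set (Matrix.SpecialLinearGroup (Fin n) (K i))) (hS : ∀ᶠ i in 𝒰, S i ⊆ B i ^ k)
    (hSV : ∀ g, (∀ᶠ i in 𝒰, g i ∈ S i) → slpt (usl u g) ∈ V) :
    ExpLE 𝒰 (fun i => ((B i).ncard : ℝ)) (fun i => ((S i).ncard : ℝ) * (S i).ncard) E := by
  obtain ⟨l, b, rfl, hb⟩ := hγ
  set γ := usl u b with hγ
  have hT := hB.tendsto
  obtain ⟨c, ⟨z0, hz0, hcz0⟩, hc⟩ := exists_fibre_bound (isPolyMap_mulMid γ.1) (hV.prod hV)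
  obtain ⟨x0, hx0⟩ := hVS hz0.1
  obtain ⟨y0, hy0⟩ := hVS hz0.2
  have hz0e : z0 = Sum.elim (slpt x0) (slpt y0) := by
    rw [hx0, hy0]; ext s; cases s <;> rfl
  have hx0V : slpt x0 ∈ V := hx0 ▸ hz0.1
  have hy0V : slpt y0 ∈ V := hy0 ▸ hz0.2
  rw [hz0e] at hcz0
  obtain ⟨y, rfl⟩ := usl_surjective hB.ultra y0
  obtain ⟨q, hq⟩ := exists_aeval_upt hB.ultra c
  let Z : ∀ i, Matrix.SpecialLinearGroup (Fin n) (K i) → Matrix.SpecialLinearGroup (Fin n) (K i) →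
    Prop := fun i g h => aeval (Sum.elim (slpt g) (slpt h)) (q i) = 0
  have hZ : ∀ g h : ∀ i, Matrix.SpecialLinearGroup (Fin n) (K i),
      (∀ᶠ i in 𝒰, Z i (g i) (h i)) ↔
        aeval (Sum.elim (slpt (usl u g)) (slpt (usl u h))) c = 0 := by
    intro g h
    rw [elim_slpt_usl, hq, hB.ultra.eq_zero_iff]
  -- the bad first coordinates
  have hS1 : ExpLE 𝒰 (fun i => ((B i).ncard : ℝ))
      (fun i => ({g | g ∈ S i ∧ Z i g (y i)}.ncard : ℝ)) e1 := by
    obtain ⟨p, hp⟩ := (isPolyMap_elim_right (σ := Fin n × Fin n)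
      (slpt (usl u y))).exists_pullback c
    refine h1.zeros hB hV hVS hr p ⟨slpt x0, hx0V, by rw [← hp]; exact hcz0⟩ k _
      (hS.mono fun i hi g hg => hi hg.1) fun g hg => ⟨hSV g (hg.mono fun i hi => hi.1), ?_⟩
    rw [← hp, ← hZ]
    exact hg.mono fun i hi => hi.2
  have hS0 := h2 k S hS hSV
  have hE1' : ExpLE 𝒰 (fun i => ((B i).ncard : ℝ))
      (fun i => (({g | g ∈ S i ∧ Z i g (y i)} ×ˢ S i).ncard : ℝ)) E := by
    refine ((hS1.mul hT hS0 fun i => Nat.cast_nonneg _).mono_exp hT hE1).mono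
      (Eventually.of_forall fun i => ?_)
    rw [Set.ncard_prod]; push_cast; rfl
  have hE2' : ExpLE 𝒰 (fun i => ((B i).ncard : ℝ))
      (fun i => ({z : _ × _ | z.1 ∈ S i ∧ z.2 ∈ S i ∧ ¬ Z i z.1 (y i) ∧ Z i z.1 z.2}.ncard : ℝ))
      E := by
    refine (ExpLE.fibre hT _ (fun i z => z.1) (e := e2) (f := e1) ?_ ?_).mono_exp hT
      (by linarith)
    · refine hS0.mono (Eventually.of_forall fun i => ?_)
      refine Nat.cast_le.2 (Set.ncard_le_ncard ?_ (Set.toFinite _))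
      rintro _ ⟨z, hz, rfl⟩
      exact hz.1
    · intro x hx
      have hx1 : slpt (usl u x) ∈ V := hSV x (hx.mono fun i hi => by
        obtain ⟨z, hz, hzx⟩ := hi; exact hzx ▸ hz.1)
      have hx2 : aeval (Sum.elim (slpt (usl u x)) (slpt (usl u y))) c ≠ 0 := by
        rw [Ne, ← hZ, ← Ultrafilter.eventually_not]
        exact hx.mono fun i hi => by
          obtain ⟨z, hz, hzx⟩ := hi; exact hzx ▸ hz.2.2.1
      obtain ⟨p, hp⟩ := (isPolyMap_elim_left (τ := Fin n × Fin n)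
        (slpt (usl u x))).exists_pullback c
      have := h1.zeros hB hV hVS hr p ⟨slpt (usl u y), hy0V, by rw [← hp]; exact hx2⟩ k
        (fun i => {g | g ∈ S i ∧ Z i (x i) g})
        (hS.mono fun i hi g hg => hi hg.1) fun g hg => ⟨hSV g (hg.mono fun i hi => hi.1), by
          rw [← hp, ← hZ]
          exact hg.mono fun i hi => hi.2⟩
      refine this.mono (Eventually.of_forall fun i => ?_)
      refine Nat.cast_le.2 (Set.ncard_le_ncard_of_injOn (fun z => z.2) ?_ ?_ (Set.toFinite _))
      · rintro z ⟨hz, hzx⟩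
        have hzx : z.1 = x i := hzx
        exact ⟨hz.2.1, hzx ▸ hz.2.2.2⟩
      · rintro z ⟨-, hz⟩ z' ⟨-, hz'⟩ h
        exact Prod.ext (hz.trans hz'.symm) h
  have hE3' : ExpLE 𝒰 (fun i => ((B i).ncard : ℝ))
      (fun i => ({z : _ × _ | z.1 ∈ S i ∧ z.2 ∈ S i ∧ ¬ Z i z.1 z.2}.ncard : ℝ)) E := by
    refine (ExpLE.fibre hT _ (fun i z => z.1 * b i * z.2) (e := e3) (f := e4) ?_ ?_).mono_exp hT
      (by linarith)
    · refine h3 (k + l + k) _ ?_ fun g hg => subset_zcl _ ?_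
      · filter_upwards [hS, hb] with i hi hbi
        rintro _ ⟨z, hz, rfl⟩
        rw [pow_add, pow_add]
        exact Set.mul_mem_mul (Set.mul_mem_mul (hi hz.1) hbi) (hi hz.2.1)
      · obtain ⟨z, hz⟩ := exists_seq_of_eventually (𝒰 := 𝒰) (P := fun i
          (z : Matrix.SpecialLinearGroup (Fin n) (K i) ×
            Matrix.SpecialLinearGroup (Fin n) (K i)) =>
          (z.1 ∈ S i ∧ z.2 ∈ S i ∧ ¬ Z i z.1 z.2) ∧ z.1 * b i * z.2 = g i) hg
        refine ⟨Sum.elim (slpt (usl u fun i => (z i).1)) (slpt (usl u fun i => (z i).2)),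
          elim_mem_prodSet.2 ⟨hSV _ (hz.mono fun i hi => hi.1.1),
            hSV _ (hz.mono fun i hi => hi.1.2.1)⟩, ?_⟩
        rw [hγ, mulMid_slpt, ← map_mul, ← map_mul]
        congr 1
        rw [usl_eq_iff hB.ultra]
        exact hz.mono fun i hi => hi.2
    · intro x _
      have hQ : Bound 𝒰 u B {v | v ∈ V ∧ mv (γ⁻¹.1 * (vm v).adjugate * (usl u x).1) ∈ V ∧
          aeval (Sum.elim v (mv (γ⁻¹.1 * (vm v).adjugate * (usl u x).1))) c ≠ 0} e4 := by
        refine bound_of_irred hB fun Z hZ hZi => h4 Z hZi (fun z hz => hVS (hZ hz).1) ?_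
        let ψ : (Fin n × Fin n → F) → ((Fin n × Fin n) ⊕ (Fin n × Fin n) → F) :=
          fun v => Sum.elim v (mv (γ⁻¹.1 * (vm v).adjugate * (usl u x).1))
        have hψ : IsPolyMap ψ := by
          rw [isPolyMap_iff]
          rintro (s | s)
          · exact IsPolyFun.coord s
          · exact isPolyMap_iff.1 (((IsPolyMat.const γ⁻¹.1).mul
              IsPolyMat.vm_id.adjugate).mul (IsPolyMat.const (usl u x).1)).mv s
        obtain ⟨z0, hz0⟩ := hZi.nonempty
        have hval : ∀ z ∈ Z, mulMid γ.1 (ψ z) = slpt (usl u x) := by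
          intro z hz
          have hd := det_vm_of_mem_range (hVS (hZ hz).1)
          have : mulMid γ.1 (ψ z) =
            mv (vm z * γ.1 * (γ⁻¹.1 * (vm z).adjugate * (usl u x).1)) := rfl
          rw [this, slpt_eq_mv]
          congr 1
          have e : γ.1 * γ⁻¹.1 = 1 := by
            rw [← Matrix.SpecialLinearGroup.coe_mul, mul_inv_cancel,
              Matrix.SpecialLinearGroup.coe_one]
          calc vm z * γ.1 * (γ⁻¹.1 * (vm z).adjugate * (usl u x).1)
              = vm z * (γ.1 * γ⁻¹.1) * (vm z).adjugate * (usl u x).1 := by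
                simp only [Matrix.mul_assoc]
            _ = _ := by rw [e, Matrix.mul_one, Matrix.mul_adjugate, hd, one_smul, Matrix.one_mul]
        have h5 := hc (ψ '' Z) (by
          rintro _ ⟨z, hz, rfl⟩
          exact elim_mem_prodSet.2 ⟨(hZ hz).1, (hZ hz).2.1⟩) (hZi.image hψ)
          ⟨_, ⟨z0, hz0, rfl⟩, (hZ hz0).2.2⟩ (by
            rintro _ ⟨z, hz, rfl⟩ _ ⟨z', hz', rfl⟩
            rw [hval z hz, hval z' hz'])
        have h6 : vdim Z ≤ vdim (ψ '' Z) := by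
          have : (fun z : (Fin n × Fin n) ⊕ (Fin n × Fin n) → F => fun s => z (Sum.inl s)) ''
              (ψ '' Z) = Z := by
            rw [Set.image_image]
            exact Set.image_id' Z
          conv_lhs => rw [← this]
          exact vdim_image_le isPolyMap_inl _
        have h7 := vdim_prod_le hV hV
        omega
      have := hQ k (fun i => {v | v ∈ S i ∧ (b i)⁻¹ * v⁻¹ * x i ∈ S i ∧
          ¬ Z i v ((b i)⁻¹ * v⁻¹ * x i)}) (hS.mono fun i hi g hg => hi hg.1) fun g hg => by
        have e : mv (γ⁻¹.1 * (vm (slpt (usl u g))).adjugate * (usl u x).1) =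
            slpt (usl u (b⁻¹ * g⁻¹ * x)) := by
          rw [map_mul, map_mul, map_inv, map_inv]
          rfl
        rw [Set.mem_ofPred_eq, e, Ne, ← hZ, ← Ultrafilter.eventually_not]
        exact ⟨hSV _ (hg.mono fun i hi => hi.1), hSV _ (hg.mono fun i hi => hi.2.1),
          hg.mono fun i hi => hi.2.2⟩
      refine this.mono (Eventually.of_forall fun i => ?_)
      refine Nat.cast_le.2 (Set.ncard_le_ncard_of_injOn (fun z => z.1) ?_ ?_ (Set.toFinite _))
      · rintro z ⟨hz, hzx⟩
        have : (b i)⁻¹ * z.1⁻¹ * x i = z.2 := by rw [← hzx]; group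
        change z.1 ∈ S i ∧ (b i)⁻¹ * z.1⁻¹ * x i ∈ S i ∧ ¬ Z i z.1 ((b i)⁻¹ * z.1⁻¹ * x i)
        rw [this]
        exact hz
      · rintro z ⟨-, hz⟩ z' ⟨-, hz'⟩ h
        refine Prod.ext h ?_
        have h' : z.1 = z'.1 := h
        have := hz.trans hz'.symm
        simp only [h'] at this
        exact mul_left_cancel this
  refine ((hE1'.add hT hE2').add hT hE3').mono (Eventually.of_forall fun i => ?_)
  have hsub : S i ×ˢ S i ⊆ ({g | g ∈ S i ∧ Z i g (y i)} ×ˢ S i) ∪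
      {z : _ × _ | z.1 ∈ S i ∧ z.2 ∈ S i ∧ ¬ Z i z.1 (y i) ∧ Z i z.1 z.2} ∪
      {z : _ × _ | z.1 ∈ S i ∧ z.2 ∈ S i ∧ ¬ Z i z.1 z.2} := by
    rintro z ⟨hz1, hz2⟩
    by_cases hz3 : Z i z.1 z.2
    · by_cases hz4 : Z i z.1 (y i)
      · exact Or.inl (Or.inl ⟨⟨hz1, hz4⟩, hz2⟩)
      · exact Or.inl (Or.inr ⟨hz1, hz2, hz4, hz3⟩)
    · exact Or.inr ⟨hz1, hz2, hz3⟩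
  have := (Set.ncard_le_ncard hsub (Set.toFinite _)).trans ((Set.ncard_union_le _ _).trans
    (Nat.add_le_add_right (Set.ncard_union_le _ _) _))
  rw [Set.ncard_prod (s := S i) (t := S i)] at this
  exact_mod_cast this

end LarsenPink

section LarsenPinkMain
open Filter MvPolynomial

theorem exists_pos_uniform (s : Finset ℕ) (Q : ℕ → ℝ → Prop)
    (mono : ∀ r μ μ', 0 < μ' → μ' ≤ μ → Q r μ → Q r μ') (h : ∀ r ∈ s, ∃ μ > 0, Q r μ) :
    ∃ μ > 0, ∀ r ∈ s, Q r μ := by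
  induction s using Finset.induction_on with
  | empty => exact ⟨1, one_pos, by simp⟩
  | insert a s _ ih =>
    obtain ⟨μ, hμ, h1⟩ := ih fun r hr => h r (Finset.mem_insert_of_mem hr)
    obtain ⟨ν, hν, h2⟩ := h a (Finset.mem_insert_self _ _)
    refine ⟨min μ ν, lt_min hμ hν, fun r hr => ?_⟩
    rcases Finset.mem_insert.1 hr with rfl | hr
    · exact mono _ _ _ (lt_min hμ hν) (min_le_right _ _) h2
    · exact mono _ _ _ (lt_min hμ hν) (min_le_left _ _) (h1 r hr)

variable {F : Type} [Field F] {n : ℕ}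

theorem vdim_le_sq (X : Set (Fin n × Fin n → F)) : vdim X ≤ n ^ 2 := by
  refine (vdim_le_card X).trans (le_of_eq ?_)
  rw [Nat.card_eq_fintype_card, Fintype.card_prod, Fintype.card_fin, sq]

variable {K : ℕ → Type} [∀ i, Field (K i)] [∀ i, Finite (K i)]
variable {𝒰 : Ultrafilter ℕ} {u : (∀ i, K i) →+* F}
  {B : ∀ i, Set (Matrix.SpecialLinearGroup (Fin n) (K i))} {V : Set (Fin n × Fin n → F)}

/-- A closed irreducible set with no expansion under `V, V ↦ V * γ * V` is a coset of a normal
subgroup. -/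
theorem normal_of_rigid (hB : Approx 𝒰 u B) (hV : IrredSet V) (hVS : V ⊆ Set.range slpt)
    (hVc : zcl V = V) (hrig : ∀ γ ∈ uPow 𝒰 u B, vdim (mulMid γ.1 '' prodSet V V) ≤ vdim V)
    {v : Matrix.SpecialLinearGroup (Fin n) F} (hv : slpt v ∈ V) :
    ∃ H : Subgroup (Matrix.SpecialLinearGroup (Fin n) F), H.Normal ∧
      ∀ g, g ∈ H ↔ slpt (g * v) ∈ V := by
  have hW : ∀ γ : Matrix.SpecialLinearGroup (Fin n) F,
      IrredSet (mulMid γ.1 '' prodSet V V) := fun γ => (hV.prod hV).image (isPolyMap_mulMid _)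
  have hWm : ∀ γ x y : Matrix.SpecialLinearGroup (Fin n) F, slpt x ∈ V → slpt y ∈ V →
      slpt (x * γ * y) ∈ mulMid γ.1 '' prodSet V V := fun γ x y hx hy =>
    ⟨Sum.elim (slpt x) (slpt y), elim_mem_prodSet.2 ⟨hx, hy⟩, mulMid_slpt _ _ _⟩
  have hL : ∀ γ ∈ uPow 𝒰 u B, ∀ x y z : Matrix.SpecialLinearGroup (Fin n) F, slpt x ∈ V →
      slpt y ∈ V → slpt z ∈ V → slpt (γ⁻¹ * x⁻¹ * y * γ * z) ∈ V := by
    intro γ hγ x y z hx hy hz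
    have := mul_mul_mem_of_vdim_le hV hVS (x * γ) 1 (γ⁻¹ * x⁻¹) 1 _ (hW γ)
      (fun g hg => by rw [mul_one]; exact hWm γ x g hx hg) (by group) (by group) (hrig γ hγ)
      (hWm γ y z hy hz)
    rw [hVc] at this
    convert this using 2
    group
  have hR : ∀ γ ∈ uPow 𝒰 u B, ∀ x y z : Matrix.SpecialLinearGroup (Fin n) F, slpt x ∈ V →
      slpt y ∈ V → slpt z ∈ V → slpt (x * γ * y * z⁻¹ * γ⁻¹) ∈ V := by
    intro γ hγ x y z hx hy hz
    have := mul_mul_mem_of_vdim_le hV hVS 1 (γ * z) 1 (z⁻¹ * γ⁻¹) _ (hW γ)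
      (fun g hg => by rw [one_mul, ← mul_assoc]; exact hWm γ g z hg hz)
      (by group) (by group) (hrig γ hγ) (hWm γ x y hx hy)
    rw [hVc] at this
    convert this using 2
    group
  have h1 : (1 : Matrix.SpecialLinearGroup (Fin n) F) ∈ uPow 𝒰 u B :=
    ⟨0, 1, (map_one _).symm, Eventually.of_forall fun i => by simp⟩
  have hC : ∀ x y z : Matrix.SpecialLinearGroup (Fin n) F, slpt x ∈ V →
      slpt y ∈ V → slpt z ∈ V → slpt (x * y⁻¹ * z) ∈ V := by
    intro x y z hx hy hz
    have := hR 1 h1 x _ v hx (hL 1 h1 y z v hy hz hv) hv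
    convert this using 2
    group
  let H : Subgroup (Matrix.SpecialLinearGroup (Fin n) F) :=
    { carrier := {g | slpt (g * v) ∈ V}
      one_mem' := by
        change slpt (1 * v) ∈ V
        rwa [one_mul]
      mul_mem' := by
        intro a b ha hb
        have := hC _ v _ ha hv hb
        change slpt (a * b * v) ∈ V
        convert this using 2
        group
      inv_mem' := by
        intro a ha
        have := hC v _ v hv ha hv
        change slpt (a⁻¹ * v) ∈ V
        convert this using 2
        group }
  have hH : ∀ g, g ∈ H ↔ slpt (g * v) ∈ V := fun g => Iff.rfl
  refine ⟨H, ⟨fun h hh g => ?_⟩, hH⟩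
  let φ : (Fin n × Fin n → F) → (Fin n × Fin n → F) :=
    fun x => mv (vm x * h.1 * (vm x).adjugate * v.1)
  have hφ : IsPolyMap φ := (((IsPolyMat.vm_id.mul (IsPolyMat.const h.1)).mul
    IsPolyMat.vm_id.adjugate).mul (IsPolyMat.const v.1)).mv
  have hφs : ∀ g, φ (slpt g) = slpt (g * h * g⁻¹ * v) := fun g => by
    rw [slpt_eq_mv (g * h * g⁻¹ * v)]
    simp only [Matrix.SpecialLinearGroup.coe_mul, Matrix.SpecialLinearGroup.coe_inv]
    rfl
  have := zcl_preimage hφ (X := slpt '' uPow 𝒰 u B) (Y := V) (fun x hx => by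
    obtain ⟨γ, hγ, rfl⟩ := hx
    rw [hφs, hVc]
    have h2 := hR γ hγ v _ v hv hh hv
    have h3 := hL 1 h1 v _ v hv h2 hv
    convert h3 using 2
    group) (hB.dense g)
  rwa [hφs, hVc, ← hH] at this

variable [CharZero F]

theorem dimBound (hn : 2 ≤ n) (hB : Approx 𝒰 u B) (r : ℕ) :
    DimBound 𝒰 u B r (r / ((n : ℝ) ^ 2 - 1)) := by
  have hT := hB.tendsto
  have hn' : (2 : ℝ) ≤ n := by exact_mod_cast hn
  have hD : 0 < (n : ℝ) ^ 2 - 1 := by nlinarith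
  let G : Set ℝ := {s | 0 ≤ s ∧ ∀ r : ℕ, DimBound 𝒰 u B r (s * r)}
  have hb1 : ∀ r : ℕ, DimBound 𝒰 u B r 1 := fun r X _ _ _ => bound_one hB
  have hG1 : (1 : ℝ) ∈ G := by
    refine ⟨zero_le_one, fun r => ?_⟩
    rcases Nat.eq_zero_or_pos r with rfl | hr
    · simpa using dimBound_zero hB
    · exact (hb1 r).mono_exp hB (by rw [one_mul]; exact_mod_cast hr)
  have hGb : BddBelow G := ⟨0, fun s hs => hs.1⟩
  set s := sInf G with hs
  have hs0 : 0 ≤ s := le_csInf ⟨1, hG1⟩ fun s hs => hs.1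
  have hsG : ∀ r : ℕ, DimBound 𝒰 u B r (s * r) := by
    intro r
    refine DimBound.of_le fun η hη => ?_
    obtain ⟨s', hs', hlt⟩ := exists_lt_of_csInf_lt ⟨1, hG1⟩
      (show sInf G < s + η / (r + 1) by rw [← hs]; linarith [show 0 < η / ((r : ℝ) + 1) by positivity])
    refine (hs'.2 r).mono_exp hB ?_
    have h1 : s' * r ≤ (s + η / (r + 1)) * r :=
      mul_le_mul_of_nonneg_right hlt.le (Nat.cast_nonneg _)
    have h2 : η / (r + 1) * r ≤ η := by
      rw [div_mul_eq_mul_div, div_le_iff₀ (by positivity)]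
      nlinarith
    linarith
  suffices hsD : s ≤ 1 / ((n : ℝ) ^ 2 - 1) by
    refine (hsG r).mono_exp hB ?_
    have := mul_le_mul_of_nonneg_right hsD (Nat.cast_nonneg (α := ℝ) r)
    rwa [one_div_mul_eq_div] at this
  by_contra hcon
  push Not at hcon
  have hspos : 0 < s := lt_trans (by positivity) hcon
  let tight : ℕ → Prop := fun r => ∀ μ > 0, ¬ DimBound 𝒰 u B r (s * r - μ)
  have hmono : ∀ (r : ℕ) (μ μ' : ℝ), 0 < μ' → μ' ≤ μ → DimBound 𝒰 u B r (s * r - μ) →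
      DimBound 𝒰 u B r (s * r - μ') := fun r μ μ' _ h1 h2 => h2.mono_exp hB (by linarith)
  have hex : ∃ r ∈ Finset.Icc 1 (n ^ 2), tight r := by
    by_contra hne
    push Not at hne
    obtain ⟨μ, hμ, hall⟩ := exists_pos_uniform (Finset.Icc 1 (n ^ 2)) _ hmono fun r hr => by
      have := hne r hr
      simp only [tight] at this
      push Not at this
      exact this
    have hn2 : (0 : ℝ) < (n : ℝ) ^ 2 := by positivity
    have hmem : s - min s (μ / (n : ℝ) ^ 2) ∈ G := by
      have h0 : 0 ≤ s - min s (μ / (n : ℝ) ^ 2) := by linarith [min_le_left s (μ / (n : ℝ) ^ 2)]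
      have hle : ∀ r ∈ Finset.Icc 1 (n ^ 2),
          DimBound 𝒰 u B r ((s - min s (μ / (n : ℝ) ^ 2)) * r) := fun r hr => by
        refine (hall r hr).mono_exp hB ?_
        have hr2 : (r : ℝ) ≤ (n : ℝ) ^ 2 := by exact_mod_cast (Finset.mem_Icc.1 hr).2
        have h1 : min s (μ / (n : ℝ) ^ 2) * r ≤ μ / (n : ℝ) ^ 2 * (n : ℝ) ^ 2 :=
          mul_le_mul (min_le_right _ _) hr2 (Nat.cast_nonneg _) (by positivity)
        rw [div_mul_cancel₀ _ hn2.ne'] at h1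
        linarith
      refine ⟨h0, fun r => ?_⟩
      rcases Nat.eq_zero_or_pos r with rfl | hr
      · simpa using dimBound_zero hB
      rcases le_or_gt r (n ^ 2) with hr2 | hr2
      · exact hle r (Finset.mem_Icc.2 ⟨hr, hr2⟩)
      · intro X h1 h2 _
        refine (hle (n ^ 2) (Finset.mem_Icc.2 ⟨by nlinarith, le_rfl⟩) X h1 h2
          (vdim_le_sq X)).mono_exp hB ?_
        exact mul_le_mul_of_nonneg_left (by exact_mod_cast hr2.le) h0
    have h1 := csInf_le hGb hmem
    rw [← hs] at h1
    have h2 : 0 < min s (μ / (n : ℝ) ^ 2) := lt_min hspos (by positivity)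
    linarith
  obtain ⟨r, ⟨hr, htight⟩, hmax⟩ : ∃ r, (r ∈ Finset.Icc 1 (n ^ 2) ∧ tight r) ∧
      ∀ w, (w ∈ Finset.Icc 1 (n ^ 2) ∧ tight w) → w ≤ r := by
    classical
    obtain ⟨r, hr, hmax⟩ := Finset.exists_max_image ((Finset.Icc 1 (n ^ 2)).filter tight) id (by
      obtain ⟨r, hr, h⟩ := hex
      exact ⟨r, Finset.mem_filter.2 ⟨hr, h⟩⟩)
    exact ⟨r, Finset.mem_filter.1 hr, fun w hw => hmax w (Finset.mem_filter.2 hw)⟩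
  obtain ⟨hr1, hr2⟩ := Finset.mem_Icc.1 hr
  obtain ⟨M₀, hM₀, hall⟩ := exists_pos_uniform (Finset.Ioc r (n ^ 2)) _ hmono fun w hw => by
    obtain ⟨hw1, hw2⟩ := Finset.mem_Ioc.1 hw
    by_contra hne
    push Not at hne
    have := hmax w ⟨Finset.mem_Icc.2 ⟨by omega, hw2⟩, hne⟩
    omega
  obtain ⟨M, hM, hMs, hMM⟩ : ∃ M > 0, M ≤ s ∧ M ≤ M₀ :=
    ⟨min s M₀, lt_min hspos hM₀, min_le_left _ _, min_le_right _ _⟩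
  have hr1' : (1 : ℝ) ≤ r := by exact_mod_cast hr1
  have hsr : s ≤ s * r := by nlinarith
  have hex := htight (M / 4) (by linarith)
  unfold DimBound at hex
  push Not at hex
  obtain ⟨X, hXi, hXS, hXr, hXb⟩ := hex
  have hVi := irredSet_zcl hXi
  have hVS := zcl_subset_range_slpt hXS
  have hVc : zcl (zcl X) = zcl X := zcl_zcl X
  have hVr : vdim (zcl X) ≤ r := by rwa [vdim_zcl]
  have hVr' : r ≤ vdim (zcl X) := by
    by_contra hlt
    refine hXb ((hsG (r - 1) X hXi hXS (by rw [← vdim_zcl]; omega)).mono_exp hB ?_)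
    rw [Nat.cast_sub hr1]
    push_cast
    linarith
  set V := zcl X
  have hrig : ∀ γ ∈ uPow 𝒰 u B, vdim (mulMid γ.1 '' prodSet V V) ≤ vdim V := by
    intro γ hγ
    by_contra hlt
    push Not at hlt
    set w := vdim (mulMid γ.1 '' prodSet V V) with hw
    have hw2r : w ≤ 2 * r := by
      have h1 := vdim_image_le (isPolyMap_mulMid γ.1) (prodSet V V)
      have h2 := vdim_prod_le hVi hVi
      omega
    have hWS : mulMid γ.1 '' prodSet V V ⊆ Set.range slpt := by
      rintro _ ⟨z, hz, rfl⟩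
      obtain ⟨x, hx⟩ := hVS hz.1
      obtain ⟨y, hy⟩ := hVS hz.2
      refine ⟨x * γ * y, ?_⟩
      rw [← mulMid_slpt, hx, hy]
      congr 1
      ext t; cases t <;> rfl
    have hWb := hall w (Finset.mem_Ioc.2 ⟨by omega, vdim_le_sq _⟩) _
      ((hVi.prod hVi).image (isPolyMap_mulMid _)) hWS le_rfl
    unfold Bound at hXb
    push Not at hXb
    obtain ⟨k, S, hS, hSV, hSb⟩ := hXb
    have hVb := hsG r X hXi hXS hXr
    have hcount := pair_count hB hVi hVS hVr hγ (hsG (r - 1)) hVb hWb (hsG (2 * r - w))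
      (E := 2 * (s * r) - M) (by rw [Nat.cast_sub hr1]; push_cast; linarith)
      (by rw [Nat.cast_sub hw2r]; push_cast; linarith) k S hS hSV
    unfold ExpLE at hSb
    push Not at hSb
    obtain ⟨η, hη, hSb⟩ := hSb
    obtain ⟨i, ⟨h1, h2⟩, h3⟩ := ((hSb.and (hcount (M / 2) (by linarith))).and
      (hT.eventually_ge_atTop 1)).exists
    have h4 : ((B i).ncard : ℝ) ^ (s * r - M / 4) ≤ (S i).ncard :=
      (Real.rpow_le_rpow_of_exponent_le h3 (by linarith)).trans h1.le
    have h5 : ((B i).ncard : ℝ) ^ (s * r - M / 4) < (S i).ncard :=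
      lt_of_le_of_lt (Real.rpow_le_rpow_of_exponent_le h3 (by linarith)) h1
    have h6 : ((B i).ncard : ℝ) ^ (2 * (s * r) - M + M / 2) =
        ((B i).ncard : ℝ) ^ (s * r - M / 4) * ((B i).ncard : ℝ) ^ (s * r - M / 4) := by
      rw [← Real.rpow_add (by linarith)]; congr 1; ring
    rw [h6] at h2
    have h7 : 0 ≤ ((B i).ncard : ℝ) ^ (s * r - M / 4) := Real.rpow_nonneg (by linarith) _
    exact absurd h2 (not_le.2 (mul_lt_mul'' h5 h5 h7 h7))
  obtain ⟨x, hx⟩ := hVi.nonempty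
  obtain ⟨v, rfl⟩ := hVS hx
  obtain ⟨H, hHn, hH⟩ := normal_of_rigid hB hVi hVS hVc hrig hx
  have : Nontrivial (Fin n) := Fin.nontrivial_iff_two_le.2 hn
  have : Nonempty (Fin n) := inferInstance
  have hHtop : H = ⊤ := by
    refine normal_eq_top H fun hle => ?_
    have hfin : (H : Set (Matrix.SpecialLinearGroup (Fin n) F)).Finite :=
      finite_center_SL.subset hle
    have hVe : V ⊆ ⋃₀ ((fun g => {slpt (g * v)}) '' (H : Set _)) := by
      intro x hx
      obtain ⟨g, rfl⟩ := hVS hx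
      refine ⟨_, ⟨g * v⁻¹, (hH _).2 (by simpa using hx), rfl⟩, by simp⟩
    have hVb : Bound 𝒰 u B V 0 := by
      refine (bound_sUnion hB (hfin.image _) ?_).mono hVe
      rintro _ ⟨g, -, rfl⟩
      refine ⟨?_, bound_singleton hB _⟩
      have := internal_zcl hB.ultra {slpt (g * v)}
      rwa [zcl_singleton] at this
    exact hXb (hVb.mono_exp hB (by linarith))
  have hrn : n ^ 2 - 1 ≤ r := by
    refine (le_vdim_SL (F := F) (by omega)).trans (le_trans (vdim_mono ?_) hVr)
    rintro _ ⟨g, rfl⟩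
    have := (hH (g * v⁻¹)).1 (hHtop ▸ Subgroup.mem_top _)
    simpa using this
  have hsr1 : s * r ≤ 1 := by
    by_contra h
    push Not at h
    exact htight (s * r - 1) (by linarith) ((hb1 r).mono_exp hB (by linarith))
  have hrn' : (n : ℝ) ^ 2 - 1 ≤ r := by
    have : n ^ 2 ≤ r + 1 := by omega
    have : (n : ℝ) ^ 2 ≤ r + 1 := by exact_mod_cast this
    linarith
  rw [div_lt_iff₀ hD] at hcon
  nlinarith

end LarsenPinkMain

section Pivot
open Filter MvPolynomial

variable {F : Type} [Field F] {n : ℕ}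

theorem commute_coe_iff (x y : Matrix.SpecialLinearGroup (Fin n) F) :
    Commute x y ↔ x.1 * y.1 = y.1 * x.1 := by
  rw [← Matrix.SpecialLinearGroup.coe_mul, ← Matrix.SpecialLinearGroup.coe_mul]
  exact ⟨fun h => congrArg Subtype.val h.eq, fun h => Subtype.ext h⟩

theorem tdisc_conj_SL (h t : Matrix.SpecialLinearGroup (Fin n) F) :
    tdisc (h * t * h⁻¹).1 = tdisc t.1 := by
  rw [Matrix.SpecialLinearGroup.coe_mul, Matrix.SpecialLinearGroup.coe_mul]
  apply tdisc_conj
  rw [← Matrix.SpecialLinearGroup.coe_mul, inv_mul_cancel, Matrix.SpecialLinearGroup.coe_one]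

theorem charpoly_conj_SL (h t : Matrix.SpecialLinearGroup (Fin n) F) :
    (h * t * h⁻¹).1.charpoly = t.1.charpoly := by
  rw [Matrix.SpecialLinearGroup.coe_mul, Matrix.charpoly_mul_comm,
    ← Matrix.SpecialLinearGroup.coe_mul, inv_mul_cancel_left]

/-- If centralizers of regular elements of `B ^ m` meet the regular part of `B ^ 2`, then the
centralizer of every conjugate of a regular element of `B ^ m` meets the regular part of `B ^ m`. -/
theorem exists_regular_commute (B : Set (Matrix.SpecialLinearGroup (Fin n) F))
    (h1 : 1 ∈ B) (hinv : ∀ g ∈ B, g⁻¹ ∈ B) {m : ℕ} (hm : 4 ≤ m)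
    {t₀ : Matrix.SpecialLinearGroup (Fin n) F} (ht₀ : t₀ ∈ B ^ m) (hr : tdisc t₀.1 ≠ 0)
    (hs : ∀ t ∈ B ^ m, tdisc t.1 ≠ 0 → ∃ s ∈ B ^ 2, tdisc s.1 ≠ 0 ∧ Commute s t) (k : ℕ)
    (g : Matrix.SpecialLinearGroup (Fin n) F) (hg : g ∈ B ^ k) :
    ∃ t ∈ B ^ m, tdisc t.1 ≠ 0 ∧ Commute t (g * t₀ * g⁻¹) := by
  induction k generalizing g with
  | zero =>
    rw [pow_zero, Set.mem_one] at hg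
    subst hg
    exact ⟨t₀, ht₀, hr, by simp⟩
  | succ k ih =>
    rw [pow_succ', Set.mem_mul] at hg
    obtain ⟨a, ha, g, hg, rfl⟩ := hg
    obtain ⟨t, ht, htr, htc⟩ := ih g hg
    obtain ⟨s, hs, hsr, hst⟩ := hs t ht htr
    refine ⟨a * s * a⁻¹, ?_, by rwa [tdisc_conj_SL], ?_⟩
    · refine Set.pow_subset_pow_right h1 hm ?_
      have : B ^ 4 = B * B ^ 2 * B := by rw [← pow_succ', ← pow_succ]
      rw [this]
      exact Set.mul_mem_mul (Set.mul_mem_mul ha hs) (hinv a ha)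
    · have hc : Commute s (g * t₀ * g⁻¹) := by
        rw [commute_coe_iff]
        exact commute_of_commute_regular htr ((commute_coe_iff _ _).1 hst)
          ((commute_coe_iff _ _).1 htc).symm
      have e : a * g * t₀ * (a * g)⁻¹ = a * (g * t₀ * g⁻¹) * a⁻¹ := by group
      rw [e, commute_iff_eq]
      have := hc.eq
      calc a * s * a⁻¹ * (a * (g * t₀ * g⁻¹) * a⁻¹) = a * (s * (g * t₀ * g⁻¹)) * a⁻¹ := by group
        _ = a * ((g * t₀ * g⁻¹) * s) * a⁻¹ := by rw [this]
        _ = _ := by group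

variable {K : ℕ → Type} [∀ i, Field (K i)]
variable {𝒰 : Ultrafilter ℕ} {u : (∀ i, K i) →+* F}
  {B : ∀ i, Set (Matrix.SpecialLinearGroup (Fin n) (K i))}

theorem tdisc_usl (u : (∀ i, K i) →+* F) (g : ∀ i, Matrix.SpecialLinearGroup (Fin n) (K i)) :
    tdisc (usl u g).1 = u fun i => tdisc (g i).1 := by
  have h1 : (usl u g).1 = (slPi g).1.map u := rfl
  rw [h1, tdisc_map]
  congr 1
  funext i
  exact (tdisc_map (Pi.evalRingHom K i) (slPi g).1).symm

theorem tdisc_usl_ne_zero (hu : IsUltra 𝒰 u)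
    (g : ∀ i, Matrix.SpecialLinearGroup (Fin n) (K i)) :
    tdisc (usl u g).1 ≠ 0 ↔ ∀ᶠ i in 𝒰, tdisc (g i).1 ≠ 0 := by
  rw [tdisc_usl, hu.ne_zero_iff]

theorem eventually_exists_cyclic_vector [Infinite F] (hu : IsUltra 𝒰 u) :
    ∀ᶠ i in 𝒰, ∀ h : Matrix.SpecialLinearGroup (Fin n) (K i), tdisc h.1 ≠ 0 →
      ∃ v, (krylov h.1 v).det ≠ 0 := by
  refine eventually_forall_of_forall_seq fun h => ?_
  by_contra hc
  rw [← Ultrafilter.eventually_not] at hc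
  have hr : tdisc (usl u h).1 ≠ 0 := (tdisc_usl_ne_zero hu h).2 (hc.mono fun i hi => by tauto)
  obtain ⟨v, hv⟩ := exists_cyclic_vector hr
  choose w hw using fun j => hu.surj (v j)
  have h1 : (usl u h).1 = (slPi h).1.map u := rfl
  have h2 : v = fun j => u (w j) := (funext hw).symm
  rw [h1, h2, ← det_krylov_map, hu.ne_zero_iff] at hv
  obtain ⟨i, hi, hi'⟩ := (hv.and hc).exists
  refine hi' fun _ => ⟨fun j => w j i, ?_⟩
  have := det_krylov_map (Pi.evalRingHom K i) (slPi h).1 w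
  change _ = (krylov (h i).1 fun j => w j i).det at this
  rw [← this]
  exact hi

variable [∀ i, Finite (K i)] [CharZero F]

theorem exists_regular_mem_uPow (hn : 2 ≤ n) (hB : Approx 𝒰 u B) :
    ∃ γ ∈ uPow 𝒰 u B, tdisc γ.1 ≠ 0 := by
  obtain ⟨g, hg⟩ := exists_regular_SL (K := F) (n := n) (by omega)
  by_contra! hcon
  obtain ⟨p, hp⟩ := (IsPolyMat.vm_id (F := F) (n := n)).tdisc
  have := mem_zcl.1 (hB.dense g) p (by
    rintro _ ⟨γ, hγ, rfl⟩
    rw [← hp]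
    exact hcon γ hγ)
  rw [← hp] at this
  exact hg this

theorem bound_conj (hn : 2 ≤ n) (hB : Approx 𝒰 u B) {T : Matrix.SpecialLinearGroup (Fin n) F}
    (hT : tdisc T.1 ≠ 0) :
    Bound 𝒰 u B (Set.range fun h => slpt (h * T * h⁻¹)) (n / ((n : ℝ) + 1)) := by
  have hn' : (2 : ℝ) ≤ n := by exact_mod_cast hn
  refine bound_of_irred hB fun Z hZ hZi => ?_
  obtain ⟨z, hz⟩ := hZi.nonempty
  obtain ⟨h, rfl⟩ := hZ hz
  obtain ⟨v, hv⟩ := exists_cyclic_vector (t := (h * T * h⁻¹).1) (by rwa [tdisc_conj_SL])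
  have hd := vdim_conj_le (h * T * h⁻¹).1 v hv Z hZi hz fun w hw => by
    obtain ⟨h', rfl⟩ := hZ hw
    rw [charpoly_conj_SL, ← charpoly_conj_SL h' T]
    exact Matrix.aeval_self_charpoly _
  refine (dimBound hn hB _ Z hZi (fun z hz => ?_) hd).mono_exp hB (le_of_eq ?_)
  · obtain ⟨h', rfl⟩ := hZ hz
    exact ⟨_, rfl⟩
  · rw [Nat.cast_mul, Nat.cast_sub (by omega)]
    have h1 : (n : ℝ) ^ 2 - 1 ≠ 0 := by nlinarith
    have h2 : (n : ℝ) + 1 ≠ 0 := by linarith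
    push_cast
    field_simp
    ring

theorem bound_singular_commutant (hn : 2 ≤ n) (hB : Approx 𝒰 u B)
    {T : Matrix.SpecialLinearGroup (Fin n) F} (hT : tdisc T.1 ≠ 0) :
    Bound 𝒰 u B {z | vm z * T.1 = T.1 * vm z ∧ (vm z).det = 1 ∧ tdisc (vm z) = 0}
      (1 / ((n : ℝ) + 1) - 1 / ((n : ℝ) ^ 2 - 1)) := by
  have hn' : (2 : ℝ) ≤ n := by exact_mod_cast hn
  refine bound_of_irred hB fun Z hZ hZi => ?_
  obtain ⟨v, hv⟩ := exists_cyclic_vector hT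
  have hd := vdim_singular_commutant_le hn T.1 v hv hT Z hZi fun z hz => hZ hz
  refine (dimBound hn hB _ Z hZi (fun z hz => ?_) hd).mono_exp hB (le_of_eq ?_)
  · exact ⟨(⟨vm z, (hZ hz).2.1⟩ : Matrix.SpecialLinearGroup (Fin n) F), rfl⟩
  · rw [Nat.cast_sub hn]
    have h1 : (n : ℝ) ^ 2 - 1 ≠ 0 := by nlinarith
    have h2 : (n : ℝ) + 1 ≠ 0 := by linarith
    push_cast
    field_simp
    ring

theorem eventually_le_regular_commute (hn : 2 ≤ n) (hB : Approx 𝒰 u B) (m : ℕ) {η : ℝ}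
    (hη : 0 < η) :
    ∀ᶠ i in 𝒰, ∀ t : Matrix.SpecialLinearGroup (Fin n) (K i), t ∈ B i ^ m ∧ tdisc t.1 ≠ 0 →
      ((B i).ncard : ℝ) ^ (1 / ((n : ℝ) + 1) - η) ≤
        ({s | s ∈ B i ^ 2 ∧ tdisc s.1 ≠ 0 ∧ Commute s t}.ncard : ℝ) := by
  have hn' : (2 : ℝ) ≤ n := by exact_mod_cast hn
  refine eventually_forall_of_forall_seq fun t => ?_
  by_contra hc
  rw [← Ultrafilter.eventually_not] at hc
  have hA := hB.tendsto
  have ht : ∀ᶠ i in 𝒰, t i ∈ B i ^ m := hc.mono fun i hi => by tauto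
  have hT : tdisc (usl u t).1 ≠ 0 :=
    (tdisc_usl_ne_zero hB.ultra t).2 (hc.mono fun i hi => by tauto)
  set f : ℝ := max (1 / ((n : ℝ) + 1) - 1 / ((n : ℝ) ^ 2 - 1)) (1 / ((n : ℝ) + 1) - η) with hf
  have hcomm : ExpLE 𝒰 (fun i => ((B i).ncard : ℝ))
      (fun i => ({s | s ∈ B i ^ 2 ∧ Commute s (t i)}.ncard : ℝ)) f := by
    have h1 := bound_singular_commutant hn hB hT 2
      (fun i => {s | s ∈ B i ^ 2 ∧ tdisc s.1 = 0 ∧ Commute s (t i)})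
      (Eventually.of_forall fun i s hs => hs.1) fun g hg => by
        refine ⟨?_, (usl u g).2, ?_⟩
        · rw [vm_slpt, ← commute_coe_iff, commute_iff_eq, ← map_mul, ← map_mul,
            usl_eq_iff hB.ultra]
          exact hg.mono fun i hi => hi.2.2
        · by_contra h
          rw [vm_slpt, ← Ne, tdisc_usl_ne_zero hB.ultra] at h
          obtain ⟨i, hi, hi'⟩ := (h.and hg).exists
          exact hi hi'.2.1
    have h2 : ExpLE 𝒰 (fun i => ((B i).ncard : ℝ))
        (fun i => ({s | s ∈ B i ^ 2 ∧ tdisc s.1 ≠ 0 ∧ Commute s (t i)}.ncard : ℝ))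
        (1 / ((n : ℝ) + 1) - η) := by
      intro η' hη'
      filter_upwards [hc, hA.eventually_ge_atTop 1] with i hi h1
      push Not at hi
      exact hi.2.le.trans (Real.rpow_le_rpow_of_exponent_le h1 (by linarith))
    refine ((h1.mono_exp hA (le_max_left _ _)).add hA (h2.mono_exp hA (le_max_right _ _))).mono
      (Eventually.of_forall fun i => ?_)
    have hsub : {s | s ∈ B i ^ 2 ∧ Commute s (t i)} ⊆
        {s | s ∈ B i ^ 2 ∧ tdisc s.1 = 0 ∧ Commute s (t i)} ∪
        {s | s ∈ B i ^ 2 ∧ tdisc s.1 ≠ 0 ∧ Commute s (t i)} := by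
      rintro s ⟨h1, h2⟩
      by_cases h : tdisc s.1 = 0
      · exact Or.inl ⟨h1, h, h2⟩
      · exact Or.inr ⟨h1, h, h2⟩
    exact_mod_cast (Set.ncard_le_ncard hsub (Set.toFinite _)).trans (Set.ncard_union_le _ _)
  have hmain : ExpLE 𝒰 (fun i => ((B i).ncard : ℝ)) (fun i => ((B i).ncard : ℝ))
      (n / ((n : ℝ) + 1) + f) := by
    refine ExpLE.fibre hA B (fun i b => b * t i * b⁻¹) ?_ ?_
    · refine bound_conj hn hB hT (1 + m + 1) _ ?_ fun g hg => ?_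
      · filter_upwards [ht] with i hi
        rintro _ ⟨b, hb, rfl⟩
        rw [pow_add, pow_add, pow_one]
        exact Set.mul_mem_mul (Set.mul_mem_mul hb hi) (hB.inv_mem i b hb)
      · obtain ⟨b, hb⟩ := exists_seq_of_eventually (𝒰 := 𝒰)
          (P := fun i b => b ∈ B i ∧ b * t i * b⁻¹ = g i) hg
        refine ⟨usl u b, ?_⟩
        change slpt (usl u b * usl u t * (usl u b)⁻¹) = _
        rw [← map_mul, ← map_inv, ← map_mul]
        congr 1
        rw [usl_eq_iff hB.ultra]
        exact hb.mono fun i hi => hi.2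
    · intro y hy
      refine hcomm.mono ?_
      filter_upwards [hy] with i hi
      obtain ⟨b₀, hb₀, hb₀y⟩ := hi
      refine Nat.cast_le.2 (Set.ncard_le_ncard_of_injOn (fun b => b₀⁻¹ * b) ?_ ?_
        (Set.toFinite _))
      · rintro b ⟨hb, hby⟩
        refine ⟨?_, ?_⟩
        · rw [pow_two]
          exact Set.mul_mem_mul (hB.inv_mem i _ hb₀) hb
        · have e : b₀ * t i * b₀⁻¹ = b * t i * b⁻¹ := hb₀y.trans hby.symm
          rw [commute_iff_eq]
          calc b₀⁻¹ * b * t i = b₀⁻¹ * (b * t i * b⁻¹) * b := by group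
            _ = b₀⁻¹ * (b₀ * t i * b₀⁻¹) * b := by rw [e]
            _ = _ := by group
      · intro b _ b' _ h
        exact mul_left_cancel h
  have h1 := hmain.one_le hA
  have h2 : (n : ℝ) / (n + 1) + 1 / (n + 1) = 1 := by
    rw [← add_div, div_self (by linarith)]
  have h3 : 0 < 1 / ((n : ℝ) ^ 2 - 1) := by
    apply one_div_pos.2; nlinarith
  rcases max_choice (1 / ((n : ℝ) + 1) - 1 / ((n : ℝ) ^ 2 - 1)) (1 / ((n : ℝ) + 1) - η) with h | h
  · rw [hf, h] at h1; linarith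
  · rw [hf, h] at h1; linarith

theorem Approx.false_of_card_le (hn : 2 ≤ n) (hB : Approx 𝒰 u B) {δ : ℝ} (hδ : 0 < δ)
    (hcard : ∀ᶠ i in 𝒰, ((B i).ncard : ℝ) ≤ (Nat.card (K i) : ℝ) ^ ((n : ℝ) + 1 - δ)) : False := by
  have hn' : (2 : ℝ) ≤ n := by exact_mod_cast hn
  have hA := hB.tendsto
  obtain ⟨γ, ⟨m₀, t, rfl, htm⟩, hγ⟩ := exists_regular_mem_uPow hn hB
  rw [tdisc_usl_ne_zero hB.ultra] at hγ
  set m := max m₀ 4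
  set η : ℝ := δ / (6 * (n + 1)) with hη
  have hη0 : 0 < η := by positivity
  have hc := (expLE_const hA ((2 ^ n * n * n ^ n : ℕ) : ℝ)) η hη0
  obtain ⟨i, ⟨⟨⟨⟨⟨⟨h1, h2⟩, h3⟩, h4⟩, h5⟩, h6⟩, h7⟩, h8⟩ := (((((((hcard.and htm).and hγ).and
    (eventually_le_regular_commute hn hB m hη0)).and
    (eventually_exists_cyclic_vector (n := n) hB.ultra)).and hc).and (hB.growth 2 η hη0)).and
    (hA.eventually_ge_atTop 1)).exists
  set a : ℝ := ((B i).ncard : ℝ) with ha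
  set q := Nat.card (K i) with hq
  have hq2 : 2 ≤ q := Finite.one_lt_card
  have ha0 : 0 < a := by linarith
  have htm' : t i ∈ B i ^ m := hB.pow_mono i (le_max_left _ _) h2
  have hreg : ∀ s ∈ B i ^ m, tdisc s.1 ≠ 0 → ∃ x ∈ B i ^ 2, tdisc x.1 ≠ 0 ∧ Commute x s := by
    intro s hs hsr
    have := h4 s ⟨hs, hsr⟩
    have hpos : 0 < {x | x ∈ B i ^ 2 ∧ tdisc x.1 ≠ 0 ∧ Commute x s}.ncard := by
      have := lt_of_lt_of_le (Real.rpow_pos_of_pos ha0 _) this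
      exact_mod_cast this
    obtain ⟨x, hx⟩ := (Set.ncard_pos (Set.toFinite _)).1 hpos
    exact ⟨x, hx⟩
  have hfin : {s | s ∈ B i ^ 2 ∧ tdisc s.1 ≠ 0}.Finite := Set.toFinite _
  have hcount := card_SL_mul_le (t i) h3 hfin.toFinset ⌈a ^ (1 / ((n : ℝ) + 1) - η)⌉₊
    (n * q ^ n / (q - 1)) (fun g => by
      obtain ⟨k, hk⟩ := hB.exists_mem_pow i g
      obtain ⟨s, hs, hsr, hsc⟩ := exists_regular_commute (B i) (hB.one_mem i) (hB.inv_mem i)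
        (le_max_right _ _) htm' h3 hreg k g hk
      refine (Nat.ceil_le.2 (h4 s ⟨hs, hsr⟩)).trans (Set.ncard_le_ncard ?_ (Set.toFinite _))
      rintro x ⟨hx, hxr, hxs⟩
      refine ⟨by simpa using ⟨hx, hxr⟩, ?_⟩
      rw [commute_coe_iff] at hxs hsc ⊢
      exact commute_of_commute_regular hsr hxs hsc.symm) (fun h hh => by
      have hr : tdisc h.1 ≠ 0 := by
        have := hfin.mem_toFinset.1 hh
        exact this.2
      obtain ⟨v, hv⟩ := h5 h hr
      rw [Nat.le_div_iff_mul_le (by omega), mul_comm]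
      refine le_trans (le_of_eq ?_) (card_units_mul_centralizer_le (by omega) h.1 v hv)
      congr 2
      ext x
      exact commute_coe_iff x h)
  set L := ⌈a ^ (1 / ((n : ℝ) + 1) - η)⌉₊ with hL
  have hR : hfin.toFinset.card ≤ (B i ^ 2).ncard := by
    rw [← Set.ncard_eq_toFinset_card]
    exact Set.ncard_le_ncard (fun s hs => hs.1) (Set.toFinite _)
  have hSL := card_SL_ge (n := n) (K := K i)
  rw [← hq] at hSL
  have hnat : q ^ (n * n) * L ≤ (2 ^ n * n * n ^ n * (B i ^ 2).ncard) * q ^ n := by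
    calc q ^ (n * n) * L
        ≤ 2 ^ n * ((q - 1) * Nat.card (Matrix.SpecialLinearGroup (Fin n) (K i))) * L :=
          Nat.mul_le_mul_right _ hSL
      _ = 2 ^ n * (q - 1) * (Nat.card (Matrix.SpecialLinearGroup (Fin n) (K i)) * L) := by ring
      _ ≤ 2 ^ n * (q - 1) * ((B i ^ 2).ncard * (n * q ^ n / (q - 1) * n ^ n)) :=
          Nat.mul_le_mul_left _ (hcount.trans (Nat.mul_le_mul_right _ hR))
      _ = 2 ^ n * n ^ n * (B i ^ 2).ncard * ((q - 1) * (n * q ^ n / (q - 1))) := by ring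
      _ ≤ 2 ^ n * n ^ n * (B i ^ 2).ncard * (n * q ^ n) :=
          Nat.mul_le_mul_left _ (Nat.mul_div_le _ _)
      _ = _ := by ring
  have hnat2 : q ^ n * L ≤ 2 ^ n * n * n ^ n * (B i ^ 2).ncard := by
    have hqn : 0 < q ^ n := by positivity
    refine Nat.le_of_mul_le_mul_right (le_trans ?_ hnat) hqn
    rw [mul_right_comm, ← pow_add]
    exact Nat.mul_le_mul_right _ (Nat.pow_le_pow_right (by omega) (by nlinarith))
  have hreal : (q : ℝ) ^ n * a ^ (1 / ((n : ℝ) + 1) - η) ≤ a ^ (1 + 2 * η) := by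
    calc (q : ℝ) ^ n * a ^ (1 / ((n : ℝ) + 1) - η) ≤ (q : ℝ) ^ n * L := by
          gcongr; exact Nat.le_ceil _
      _ ≤ ((2 ^ n * n * n ^ n : ℕ) : ℝ) * (B i ^ 2).ncard := by exact_mod_cast hnat2
      _ ≤ a ^ (0 + η) * a ^ (1 + η) := by gcongr
      _ = _ := by rw [← Real.rpow_add ha0]; congr 1; ring
  have hqa : (q : ℝ) ^ (n : ℝ) ≤ a ^ (1 + 3 * η - 1 / ((n : ℝ) + 1)) := by
    rw [Real.rpow_natCast]
    have e : a ^ (1 + 2 * η) =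
        a ^ (1 + 3 * η - 1 / ((n : ℝ) + 1)) * a ^ (1 / ((n : ℝ) + 1) - η) := by
      rw [← Real.rpow_add ha0]; congr 1; ring
    rw [e] at hreal
    exact le_of_mul_le_mul_right hreal (Real.rpow_pos_of_pos ha0 _)
  have hq1 : (1 : ℝ) < q := by exact_mod_cast hq2
  have hinv : 1 / ((n : ℝ) + 1) * (n + 1) = 1 := by
    rw [div_mul_cancel₀ _ (by linarith)]
  have hinv1 : 1 / ((n : ℝ) + 1) ≤ 1 / 3 := by
    apply one_div_le_one_div_of_le <;> linarith
  have hηn : 6 * (η * (n + 1)) = δ := by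
    rw [hη]; field_simp
  have hexp : ((n : ℝ) + 1 - δ) * (1 + 3 * η - 1 / ((n : ℝ) + 1)) < n := by
    nlinarith [mul_pos hδ hη0]
  have hle : a ^ (1 + 3 * η - 1 / ((n : ℝ) + 1)) ≤
      (q : ℝ) ^ (((n : ℝ) + 1 - δ) * (1 + 3 * η - 1 / ((n : ℝ) + 1))) := by
    rw [Real.rpow_mul (by linarith)]
    exact Real.rpow_le_rpow ha0.le h1 (by linarith)
  have := Real.rpow_lt_rpow_of_exponent_lt hq1 hexp
  linarith

end Pivot

section Reduction
open Filter Finset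

theorem card_zpow_mul_zpow_mul_zpow_le {G : Type*} [Group G] [DecidableEq G] {A : Finset G} {K : ℝ}
    (h : (#(A ^ 3) : ℝ) ≤ K * #A) {x y z : ℤ} (hx : |x| = 1) (hy : |y| = 1) (hz : |z| = 1) :
    (#(A ^ x * A ^ y * A ^ z) : ℝ) ≤ K ^ 3 * #A := by
  have := small_alternating_pow_of_small_tripling le_rfl h ![x, y, z] (by
    intro i; fin_cases i <;> simpa)
  simpa [List.finRange_succ, mul_assoc] using this

theorem card_union_inv_pow_three_le {G : Type*} [Group G] [DecidableEq G] {A : Finset G} {K : ℝ}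
    (h : (#(A ^ 3) : ℝ) ≤ K * #A) : (#((A ∪ A⁻¹) ^ 3) : ℝ) ≤ 8 * K ^ 3 * #A := by
  have h1 : |(1 : ℤ)| = 1 := by simp
  have h2 : |(-1 : ℤ)| = 1 := by simp
  have key : (A ∪ A⁻¹) ^ 3 ⊆ (Finset.univ : Finset (Fin 2 × Fin 2 × Fin 2)).biUnion fun w =>
      A ^ (![1, -1] w.1 : ℤ) * A ^ (![1, -1] w.2.1 : ℤ) * A ^ (![1, -1] w.2.2 : ℤ) := by
    have hS : ∀ x ∈ A ∪ A⁻¹, ∃ j : Fin 2, x ∈ A ^ (![1, -1] j : ℤ) := by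
      intro x hx
      rcases Finset.mem_union.1 hx with hx | hx
      · exact ⟨0, by simpa using hx⟩
      · exact ⟨1, by simpa using hx⟩
    intro g hg
    rw [pow_three', Finset.mem_mul] at hg
    obtain ⟨b, hb, z, hz, rfl⟩ := hg
    obtain ⟨x, hx, y, hy, rfl⟩ := Finset.mem_mul.1 hb
    obtain ⟨i, hi⟩ := hS x hx
    obtain ⟨j, hj⟩ := hS y hy
    obtain ⟨k, hk⟩ := hS z hz
    exact Finset.mem_biUnion.2 ⟨(i, j, k), Finset.mem_univ _, mul_mem_mul (mul_mem_mul hi hj) hk⟩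
  have hj : ∀ j : Fin 2, |(![1, -1] j : ℤ)| = 1 := by intro j; fin_cases j <;> simp
  have h3 : (#((A ∪ A⁻¹) ^ 3) : ℝ) ≤ ∑ w : Fin 2 × Fin 2 × Fin 2,
      (#(A ^ (![1, -1] w.1 : ℤ) * A ^ (![1, -1] w.2.1 : ℤ) * A ^ (![1, -1] w.2.2 : ℤ)) : ℝ) := by
    exact_mod_cast (card_le_card key).trans card_biUnion_le
  refine h3.trans ((Finset.sum_le_card_nsmul _ _ (K ^ 3 * #A) fun w _ =>
    card_zpow_mul_zpow_mul_zpow_le h (hj _) (hj _) (hj _)).trans (le_of_eq ?_))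
  simp
  ring

theorem insert_one_pow_subset {G : Type*} [Group G] [DecidableEq G] (S : Finset G) (m : ℕ) :
    (insert 1 S) ^ m ⊆ (range (m + 1)).biUnion fun j => S ^ j := by
  induction m with
  | zero => simp
  | succ m ih =>
    intro g hg
    rw [pow_succ, Finset.mem_mul] at hg
    obtain ⟨x, hx, y, hy, rfl⟩ := hg
    obtain ⟨j, hj, hxj⟩ := Finset.mem_biUnion.1 (ih hx)
    rw [Finset.mem_range] at hj
    rw [Finset.mem_biUnion]
    rcases Finset.mem_insert.1 hy with rfl | hy
    · exact ⟨j, Finset.mem_range.2 (by omega), by simpa using hxj⟩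
    · exact ⟨j + 1, Finset.mem_range.2 (by omega), by rw [pow_succ]; exact mul_mem_mul hxj hy⟩

/-- Small tripling controls all powers of the symmetrization. -/
theorem card_insert_one_union_inv_pow_le {G : Type*} [Group G] [DecidableEq G] {A : Finset G}
    (hA : A.Nonempty) {K : ℝ} (h : (#(A ^ 3) : ℝ) ≤ K * #A) {m : ℕ} (hm : 3 ≤ m) :
    (#((insert 1 (A ∪ A⁻¹)) ^ m) : ℝ) ≤ (m + 1) * ((8 * K ^ 3) ^ (m - 2) * (2 * #A)) := by
  set S := A ∪ A⁻¹ with hS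
  have hSne : S.Nonempty := hA.mono subset_union_left
  have hinv : S⁻¹ = S := by
    ext x
    simp [hS, or_comm]
  have hK : 0 ≤ K := by
    by_contra hK
    have : (0 : ℝ) < #A := by exact_mod_cast hA.card_pos
    have h0 : (0 : ℝ) ≤ #(A ^ 3) := by positivity
    nlinarith
  have h3 : (#(S ^ 3) : ℝ) ≤ 8 * K ^ 3 * #S := by
    refine (card_union_inv_pow_three_le h).trans ?_
    gcongr
    exact subset_union_left
  have h4 := small_pow_of_small_tripling hm h3 hinv
  have h5 : (#S : ℝ) ≤ 2 * #A := by
    have := card_union_le A A⁻¹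
    rw [card_inv, ← hS] at this
    have h' : #S ≤ 2 * #A := by omega
    exact_mod_cast h'
  have h6 : ∀ j ∈ range (m + 1), #(S ^ j) ≤ #(S ^ m) := fun j hj =>
    hSne.card_pow_mono (by have := Finset.mem_range.1 hj; omega)
  have h7 : #((insert 1 S) ^ m) ≤ (m + 1) * #(S ^ m) := by
    refine (card_le_card (insert_one_pow_subset S m)).trans (card_biUnion_le.trans ?_)
    simpa using Finset.sum_le_card_nsmul _ _ _ h6
  calc (#((insert 1 S) ^ m) : ℝ) ≤ (m + 1) * #(S ^ m) := by exact_mod_cast h7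
    _ ≤ _ := by gcongr; exact h4.trans (by gcongr)

/-- There is no sequence of counterexamples with constants tending to zero. -/
theorem false_of_small_tripling {n : ℕ} (hn : 2 ≤ n) {δ : ℝ} (hδ : 0 < δ) (p : ℕ → ℕ)
    [∀ i, Fact (p i).Prime] [∀ i, DecidableEq (Matrix.SpecialLinearGroup (Fin n) (ZMod (p i)))]
    (A : ∀ i, Finset (Matrix.SpecialLinearGroup (Fin n) (ZMod (p i))))
    (hgen : ∀ i, Subgroup.closure (A i : Set (Matrix.SpecialLinearGroup (Fin n) (ZMod (p i)))) = ⊤)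
    (hcard : ∀ i, (#(A i) : ℝ) < (p i : ℝ) ^ ((n : ℝ) + 1 - δ))
    (htrip : ∀ i, (#(A i ^ 3) : ℝ) < 1 / ((i : ℝ) + 1) * (#(A i) : ℝ) ^ (1 + 1 / ((i : ℝ) + 1))) :
    False := by
  have hi0 : ∀ i : ℕ, (0 : ℝ) < (i : ℝ) + 1 := fun i => by positivity
  have hne : ∀ i, (A i).Nonempty := by
    intro i
    rw [Finset.nonempty_iff_ne_empty]
    intro h
    have := htrip i
    rw [h, card_empty, Nat.cast_zero, Real.zero_rpow (by have := hi0 i; positivity)] at this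
    simp at this
  have hpos : ∀ i, (1 : ℝ) ≤ #(A i) := fun i => by exact_mod_cast (hne i).card_pos
  have hpos' : ∀ i, (0 : ℝ) < #(A i) := fun i => by linarith [hpos i]
  have hsplit : ∀ i : ℕ, (#(A i) : ℝ) ^ (1 + 1 / ((i : ℝ) + 1)) =
      (#(A i) : ℝ) ^ (1 / ((i : ℝ) + 1)) * #(A i) := fun i => by
    rw [Real.rpow_add (hpos' i), Real.rpow_one, mul_comm]
  have hlarge : ∀ i : ℕ, (i : ℝ) + 1 < #(A i) := by
    intro i
    have h1 : (#(A i) : ℝ) ≤ #(A i ^ 3) := by exact_mod_cast card_le_card_pow (by norm_num)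
    have h2 := h1.trans_lt (htrip i)
    rw [hsplit, ← mul_assoc, lt_mul_iff_one_lt_left (hpos' i), one_div, inv_mul_eq_div,
      one_lt_div (hi0 i)] at h2
    refine h2.trans_le ?_
    conv_rhs => rw [← Real.rpow_one (#(A i) : ℝ)]
    refine Real.rpow_le_rpow_of_exponent_le (hpos i) ?_
    rw [inv_le_one₀ (hi0 i)]
    linarith [(Nat.cast_nonneg i : (0 : ℝ) ≤ i)]
  have htrip' : ∀ i : ℕ, (#(A i ^ 3) : ℝ) ≤ (#(A i) : ℝ) ^ (1 / ((i : ℝ) + 1)) * #(A i) := by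
    intro i
    refine (htrip i).le.trans ?_
    rw [hsplit]
    refine mul_le_of_le_one_left (by positivity) ?_
    rw [one_div, inv_le_one₀ (hi0 i)]
    linarith [(Nat.cast_nonneg i : (0 : ℝ) ≤ i)]
  have hitop : Tendsto (fun i : ℕ => (i : ℝ) + 1) atTop atTop :=
    tendsto_atTop_add_const_right _ _ tendsto_natCast_atTop_atTop
  have hAtop : Tendsto (fun i => (#(A i) : ℝ)) atTop atTop :=
    tendsto_atTop_mono (fun i => (hlarge i).le) hitop
  have hp1 : ∀ i, (1 : ℝ) ≤ p i := fun i => by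
    exact_mod_cast (Fact.out : (p i).Prime).one_lt.le
  have hptop : Tendsto (fun i => (p i : ℝ)) atTop atTop := by
    have h1 : Tendsto (fun i => (p i : ℝ) ^ (n + 1)) atTop atTop := by
      refine tendsto_atTop_mono (fun i => (hcard i).le.trans ?_) hAtop
      rw [← Real.rpow_natCast]
      refine Real.rpow_le_rpow_of_exponent_le (hp1 i) ?_
      push_cast
      linarith
    rw [tendsto_atTop]
    intro b
    filter_upwards [h1.eventually_gt_atTop (|b| ^ (n + 1))] with i hi
    exact (le_abs_self b).trans (lt_of_pow_lt_pow_left₀ _ (by linarith [hp1 i]) hi).le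
  set 𝒰 : Ultrafilter ℕ := Filter.hyperfilter ℕ
  have hU : (𝒰 : Filter ℕ) ≤ atTop := by
    rw [← Nat.cofinite_eq_atTop]
    exact Filter.hyperfilter_le_cofinite
  obtain ⟨F, _, u, hu⟩ := exists_isUltra 𝒰 (fun i => ZMod (p i))
  have : CharZero F := hu.charZero fun m hm => hU (by
    filter_upwards [hptop.eventually_gt_atTop (m : ℝ)] with i hi h0
    rw [ZMod.natCast_eq_zero_iff] at h0
    have := Nat.le_of_dvd (Nat.pos_of_ne_zero hm) h0
    exact absurd hi (not_lt.2 (by exact_mod_cast this)))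
  set B : ∀ i, Finset (Matrix.SpecialLinearGroup (Fin n) (ZMod (p i))) :=
    fun i => insert 1 (A i ∪ (A i)⁻¹) with hBdef
  have hAB : ∀ i, A i ⊆ B i := fun i => subset_union_left.trans (subset_insert _ _)
  have hAB' : ∀ i, (#(A i) : ℝ) ≤ #(B i) := fun i => by exact_mod_cast card_le_card (hAB i)
  have hBA : ∀ i, (#(B i) : ℝ) ≤ 3 * #(A i) := by
    intro i
    have h1 := card_insert_le 1 (A i ∪ (A i)⁻¹)
    have h2 := card_union_le (A i) (A i)⁻¹
    have h3 := (hne i).card_pos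
    rw [card_inv] at h2
    have : #(B i) ≤ 3 * #(A i) := by simp only [hBdef]; omega
    exact_mod_cast this
  have hB : Approx 𝒰 u (fun i => (B i : Set (Matrix.SpecialLinearGroup (Fin n) (ZMod (p i))))) :=
    { ultra := hu
      one_mem := fun i => by simp [hBdef]
      inv_mem := fun i g hg => by
        simp only [hBdef, Finset.mem_coe, Finset.mem_insert, Finset.mem_union, Finset.mem_inv'] at hg ⊢
        rcases hg with rfl | hg | hg
        · simp
        · simp [hg]
        · simp [hg]
      closure := fun i => by
        rw [eq_top_iff, ← hgen i]
        exact Subgroup.closure_mono (by exact_mod_cast hAB i)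
      tendsto := by
        simp only [Set.ncard_coe_finset]
        exact (tendsto_atTop_mono hAB' hAtop).mono_left hU
      growth := fun k η hη => hU (by
        set m := max k 3
        have hm : 3 ≤ m := le_max_right _ _
        have h1 : ∀ᶠ i : ℕ in atTop, (((3 * (m - 2) : ℕ) : ℝ)) * (1 / ((i : ℝ) + 1)) ≤ η / 2 := by
          filter_upwards [hitop.eventually_ge_atTop ((((3 * (m - 2) : ℕ) : ℝ)) / (η / 2))] with i hi
          rw [mul_one_div, div_le_iff₀ (hi0 i)]
          rw [div_le_iff₀ (by positivity)] at hi
          linarith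
        have h2 := ((tendsto_rpow_atTop (by positivity : 0 < η / 2)).comp hAtop).eventually_ge_atTop
          (((m : ℝ) + 1) * (8 ^ (m - 2) * 2))
        filter_upwards [h1, h2] with i h1 h2
        have h3 := card_insert_one_union_inv_pow_le (hne i) (htrip' i) hm
        simp only [Function.comp] at h2
        rw [← Finset.coe_pow, Set.ncard_coe_finset, Set.ncard_coe_finset]
        have h4 : #(B i ^ k) ≤ #(B i ^ m) :=
          Finset.Nonempty.card_pow_mono ⟨1, by simp [hBdef]⟩ (le_max_left _ _)
        have h5 : ((#(A i) : ℝ) ^ (1 / ((i : ℝ) + 1))) ^ (3 * (m - 2)) ≤ (#(A i) : ℝ) ^ (η / 2) := by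
          rw [← Real.rpow_natCast, ← Real.rpow_mul (hpos' i).le]
          refine Real.rpow_le_rpow_of_exponent_le (hpos i) ?_
          rwa [mul_comm]
        calc (#(B i ^ k) : ℝ) ≤ #(B i ^ m) := by exact_mod_cast h4
          _ ≤ _ := h3
          _ = ((m : ℝ) + 1) * (8 ^ (m - 2) * 2) *
              ((#(A i) : ℝ) ^ (1 / ((i : ℝ) + 1))) ^ (3 * (m - 2)) * #(A i) := by
            rw [mul_pow, ← pow_mul]; ring
          _ ≤ (#(A i) : ℝ) ^ (η / 2) * (#(A i) : ℝ) ^ (η / 2) * #(A i) := by gcongr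
          _ = (#(A i) : ℝ) ^ (1 + η) := by
            rw [← Real.rpow_add (hpos' i), add_halves, Real.rpow_add (hpos' i), Real.rpow_one,
              mul_comm]
          _ ≤ (#(B i) : ℝ) ^ (1 + η) :=
            Real.rpow_le_rpow (hpos' i).le (hAB' i) (by positivity)) }
  refine hB.false_of_card_le hn (half_pos hδ) (hU ?_)
  have h1 := ((tendsto_rpow_atTop (half_pos hδ)).comp hptop).eventually_ge_atTop 3
  filter_upwards [h1] with i h1
  simp only [Function.comp] at h1
  have hp0 : (0 : ℝ) < p i := by linarith [hp1 i]
  rw [Set.ncard_coe_finset, Nat.card_zmod]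
  calc (#(B i) : ℝ) ≤ 3 * #(A i) := hBA i
    _ ≤ (p i : ℝ) ^ (δ / 2) * (p i : ℝ) ^ ((n : ℝ) + 1 - δ) := by
      gcongr
      exact (hcard i).le
    _ = (p i : ℝ) ^ ((n : ℝ) + 1 - δ / 2) := by
      rw [← Real.rpow_add hp0]
      ring_nf

end Reduction

/-- **Main Theorem.** Let `n ≥ 2` and fix `δ > 0`. Then there are `ε, C > 0` such that
for every prime `p` and every generating set `A` of `SL_n(ℤ/pℤ)`, if
`|A| < p^(n+1-δ)` then `|A·A·A| ≥ C·|A|^(1+ε)`. -/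
theorem statement_0 (n : ℕ) (hn : 2 ≤ n) (δ : ℝ) (hδ : 0 < δ) :
    ∃ ε C : ℝ, 0 < ε ∧ 0 < C ∧
      ∀ (p : ℕ), p.Prime →
        ∀ A : Set (Matrix.SpecialLinearGroup (Fin n) (ZMod p)),
          Subgroup.closure A = ⊤ →
          (A.ncard : ℝ) < (p : ℝ) ^ ((n : ℝ) + 1 - δ) →
          C * (A.ncard : ℝ) ^ (1 + ε) ≤ ((A * A * A).ncard : ℝ) := by
  classical
  by_contra hcon
  push Not at hcon
  choose p hp A hgen hcard htrip using fun i : ℕ =>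
    hcon (1 / ((i : ℝ) + 1)) (1 / ((i : ℝ) + 1)) (by positivity) (by positivity)
  have : ∀ i, Fact (p i).Prime := fun i => ⟨hp i⟩
  have hA : ∀ i, ((A i).toFinite.toFinset : Set _) = A i := fun i => Set.Finite.coe_toFinset _
  refine false_of_small_tripling hn hδ p (fun i => (A i).toFinite.toFinset) (fun i => ?_)
    (fun i => ?_) (fun i => ?_)
  · rw [hA]; exact hgen i
  · rw [← Set.ncard_coe_finset, hA]; exact hcard i
  · have := htrip i
    rw [← Set.ncard_coe_finset, ← Set.ncard_coe_finset, Finset.coe_pow, hA, pow_three']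
    exact this
end

section
/- Let k > 2 be an integer and let c and ε be positive real numbers. Then there exist positive real numbers c' and ε' (depending only on k, c, ε) such that for every group G and every finite nonempty subset A of G satisfying |A_k| ≥ c·|A|^{1+ε}, we have |A·A·A| ≥ c'·|A|^{1+ε'}. -/
open Pointwise

namespace Finset

variable {G : Type*} [Group G] [DecidableEq G] {A : Finset G} {K : ℝ} {k : ℕ}

/-- A set of small tripling has small products of at most `k` factors `A` or `A⁻¹`. -/
lemma card_prod_zpow_le_of_small_tripling (hk : 3 ≤ k) (hA₀ : A.Nonempty)
    (hA : ((A ^ 3).card : ℝ) ≤ K * A.card) (l : List ℤ) (hl : ∀ x ∈ l, |x| = 1)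
    (hlk : l.length ≤ k) :
    ((l.map fun x ↦ A ^ x).prod.card : ℝ) ≤ K ^ (3 * (k - 2)) * A.card := by
  obtain ⟨l', hl', hlen⟩ : ∃ l' : List ℤ, (∀ x ∈ l', |x| = 1) ∧ (l ++ l').length = k :=
    ⟨List.replicate (k - l.length) 1, by simp +contextual, by simp; omega⟩
  have hne : (l'.map fun x ↦ A ^ x).prod.Nonempty := by
    clear hlen
    induction l' with
    | nil => simp
    | cons x t ih =>
      simp only [List.map_cons, List.prod_cons]
      exact (hA₀.zpow).mul (ih fun y hy ↦ hl' y (by simp [hy]))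
  have hle : (l.map fun x ↦ A ^ x).prod.card ≤ ((l ++ l').map fun x ↦ A ^ x).prod.card := by
    rw [List.map_append, List.prod_append]
    exact card_le_card_mul_right hne
  have hall : ∀ x ∈ l ++ l', |x| = 1 := fun x hx ↦
    (List.mem_append.1 hx).elim (hl x) (hl' x)
  generalize l ++ l' = L at hlen hle hall
  subst hlen
  have := small_alternating_pow_of_small_tripling hk hA L.get fun i ↦ hall _ (L.get_mem i)
  have hmap : (List.finRange L.length).map (fun i ↦ A ^ L.get i) = L.map fun x ↦ A ^ x := by
    rw [← List.ofFn_eq_map]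
    exact List.ofFn_getElem_eq_map L fun x ↦ A ^ x
  rw [hmap] at this
  exact le_trans (mod_cast hle) this

/-- A set `A` of small tripling has small powers of `A ∪ A⁻¹ ∪ {1}`. -/
lemma card_union_inv_union_one_pow_le_of_small_tripling (hk : 3 ≤ k) (hA₀ : A.Nonempty)
    (hA : ((A ^ 3).card : ℝ) ≤ K * A.card) :
    (((A ∪ A⁻¹ ∪ {1}) ^ k).card : ℝ) ≤ 3 ^ k * (K ^ (3 * (k - 2)) * A.card) := by
  suffices H : ∀ (j : ℕ) (l : List ℤ), (∀ x ∈ l, |x| = 1) → l.length + j ≤ k →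
      (((l.map fun x ↦ A ^ x).prod * (A ∪ A⁻¹ ∪ {1}) ^ j).card : ℝ) ≤
        3 ^ j * (K ^ (3 * (k - 2)) * A.card) by
    simpa using H k [] (by simp) (by simp)
  intro j
  induction j with
  | zero =>
    intro l hl hlk
    simpa using card_prod_zpow_le_of_small_tripling hk hA₀ hA l hl hlk
  | succ j ih =>
    intro l hl hlk
    have hpos := ih (l ++ [1]) (by simpa [or_imp, forall_and] using hl) (by simp; omega)
    have hneg := ih (l ++ [-1]) (by simpa [or_imp, forall_and] using hl) (by simp; omega)
    have hone := ih l hl (by omega)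
    simp only [List.map_append, List.prod_append, List.map_cons, List.map_nil, List.prod_cons,
      List.prod_nil, mul_one, zpow_one, zpow_neg] at hpos hneg
    set P := (l.map fun x ↦ A ^ x).prod
    set T := (A ∪ A⁻¹ ∪ {1}) ^ j
    have hsplit : P * (A ∪ A⁻¹ ∪ {1}) ^ (j + 1) = P * A * T ∪ P * A⁻¹ * T ∪ P * T := by
      rw [pow_succ', ← mul_assoc, mul_union, mul_union, union_mul, union_mul, singleton_one,
        mul_one]
      rfl
    have hcard : ((P * (A ∪ A⁻¹ ∪ {1}) ^ (j + 1)).card : ℝ) ≤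
        (P * A * T).card + (P * A⁻¹ * T).card + (P * T).card := by
      rw [hsplit]
      exact_mod_cast (card_union_le _ _).trans (Nat.add_le_add_right (card_union_le _ _) _)
    rw [pow_succ (3 : ℝ)]
    linarith

end Finset

/-- Extracting an `m`-th root from a power bound on the growth of `n`. -/
lemma rpow_mul_rpow_one_add_le_mul {n K c d ε : ℝ} {m : ℕ} (hn : 0 < n) (hK : 0 ≤ K) (hc : 0 ≤ c)
    (hd : 0 < d) (hm : m ≠ 0) (h : c * n ^ (1 + ε) ≤ d * (K ^ m * n)) :
    (c / d) ^ (m : ℝ)⁻¹ * n ^ (1 + ε / m) ≤ K * n := by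
  have hpow : c / d * n ^ ε ≤ K ^ m := by
    rw [Real.rpow_add hn, Real.rpow_one] at h
    rw [div_mul_eq_mul_div, div_le_iff₀ hd]
    refine le_of_mul_le_mul_right ?_ hn
    linarith
  have hroot : (c / d) ^ (m : ℝ)⁻¹ * n ^ (ε / m) ≤ K := by
    rw [div_eq_mul_inv ε, Real.rpow_mul hn.le, ← Real.mul_rpow (by positivity) (by positivity)]
    exact (Real.rpow_le_rpow (by positivity) hpow (by positivity)).trans_eq
      (Real.pow_rpow_inv_natCast hK hm)
  rw [Real.rpow_add hn, Real.rpow_one, mul_left_comm, mul_comm K]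
  gcongr

/-- **Tripling Lemma.** Let `k > 2` and `c, ε > 0`. Then there exist `c', ε' > 0`
(depending only on `k, c, ε`) such that for every group `G` and finite nonempty
`A ⊆ G` with `|A_k| ≥ c·|A|^(1+ε)`, we have `|A·A·A| ≥ c'·|A|^(1+ε')`.
Here `A_k = (A ∪ A⁻¹ ∪ {1})^k`. -/
theorem statement_1 (k : ℕ) (hk : 2 < k) (c ε : ℝ) (hc : 0 < c) (hε : 0 < ε) :
    ∃ c' ε' : ℝ, 0 < c' ∧ 0 < ε' ∧
      ∀ (G : Type*) [Group G] (A : Set G), A.Finite → A.Nonempty →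
        c * (A.ncard : ℝ) ^ (1 + ε) ≤ ((((A ∪ A⁻¹ ∪ {1}) ^ k : Set G)).ncard : ℝ) →
        c' * (A.ncard : ℝ) ^ (1 + ε') ≤ ((A * A * A).ncard : ℝ) := by
  set m : ℕ := 3 * (k - 2) with hm
  have hm₀ : m ≠ 0 := by omega
  have hm_pos : (0 : ℝ) < m := by positivity
  refine ⟨(c / 3 ^ k) ^ (m : ℝ)⁻¹, ε / m, by positivity, by positivity, ?_⟩
  intro G _ A hfin hne h
  classical
  lift A to Finset G using hfin
  rw [Finset.coe_nonempty] at hne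
  have hcoe : ((A : Set G) ∪ (A : Set G)⁻¹ ∪ {1}) ^ k = ↑((A ∪ A⁻¹ ∪ {1}) ^ k) := by
    push_cast; rfl
  have hcube : (A : Set G) * A * A = ↑(A ^ 3) := by
    push_cast; rw [pow_succ, pow_two]
  rw [hcoe, Set.ncard_coe_finset, Set.ncard_coe_finset] at h
  rw [hcube, Set.ncard_coe_finset, Set.ncard_coe_finset]
  have hn : (0 : ℝ) < A.card := by exact_mod_cast hne.card_pos
  have hK : ((A ^ 3).card : ℝ) = (A ^ 3).card / A.card * A.card := by field_simp
  rw [hK]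
  exact rpow_mul_rpow_one_add_le_mul hn (by positivity) hc.le (by positivity) hm₀
    (h.trans (Finset.card_union_inv_union_one_pow_le_of_small_tripling hk hne hK.le))
end
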